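/- For constrained-degree percolation on ℤ^d, d ≥ 2, with κ ∈ {2,…,2d}: for all 0 < p_− < p_+ < 1 there exists a constant C > 0 depending only on p_−, p_+ and d such that for every n ≥ 1 and every p ∈ [p_−, p_+], the function τ_n is differentiable at p and τ_n′(p) ≥ (n / (C · Σ_n(p))) · τ_n(p), where Σ_n(p) = Σ_{k=0}^{n−1} τ_k(p). -/

import Mathlib

open MeasureTheory

namespace CDP

/-- Vertices of the hypercubic lattice `ℤ^d`. -/
abbrev Vertex (d : ℕ) := Fin d → ℤ

/-- Nearest-neighbour adjacency in `ℤ^d`. -/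
def adj {d : ℕ} (x y : Vertex d) : Prop := (∑ i, |x i - y i|) = 1

/-- `e` is a nearest-neighbour (non-oriented) edge of `ℤ^d`, i.e. an element of `𝓔`. -/
def IsNNEdge {d : ℕ} (e : Sym2 (Vertex d)) : Prop := ∃ x y, adj x y ∧ e = s(x, y)

/-- Configurations: labels attached to (unordered) pairs of vertices; only the labels of
nearest-neighbour edges (elements of `𝓔`) are ever relevant. -/
abbrev Config (d : ℕ) := Sym2 (Vertex d) → ℝ

/-- `ℓ^1` norm of a vertex. -/
def norm1 {d : ℕ} (x : Vertex d) : ℤ := ∑ i, |x i|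

/-- The set `Ω`: configurations with values in `[0,1]`, pairwise distinct coordinates on `𝓔`,
and no infinite walk along which the labels are strictly monotone. -/
def goodConfigs (d : ℕ) : Set (Config d) :=
  {U | (∀ e, IsNNEdge e → U e ∈ Set.Icc (0 : ℝ) 1) ∧
    (∀ e f, IsNNEdge e → IsNNEdge f → U e = U f → e = f) ∧
    ¬ ∃ w : ℕ → Vertex d, (∀ i, adj (w i) (w (i + 1))) ∧
      (StrictMono (fun i => U s(w i, w (i + 1))) ∨ StrictAnti (fun i => U s(w i, w (i + 1))))}

/-- A labelling `σ` of the edges by "ever opens" which is consistent with the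
constrained-degree dynamics driven by `U`: an edge (attempting to open at time `U e`)
opens iff at that moment both of its end-vertices have degree `< κ` among the
previously opened edges. -/
def Consistent {d : ℕ} (κ : ℕ) (U : Config d) (σ : Sym2 (Vertex d) → Prop) : Prop :=
  ∀ e, IsNNEdge e →
    (σ e ↔ ∀ v ∈ e,
      Set.ncard {f : Sym2 (Vertex d) | IsNNEdge f ∧ v ∈ f ∧ f ≠ e ∧ U f < U e ∧ σ f} < κ)

/-- `ω_p(U, e) = 1`, i.e. the edge `e` is `p`-open in the constrained-degree percolation
process with constraint `κ` driven by `U`. -/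
def openEdge {d : ℕ} (κ : ℕ) (U : Config d) (p : ℝ) (e : Sym2 (Vertex d)) : Prop :=
  IsNNEdge e ∧ U e ≤ p ∧ ∃ σ, Consistent κ U σ ∧ σ e

/-- `x 0, …, x k` is a path: consecutive vertices adjacent, all vertices distinct. -/
def IsPathOn {d : ℕ} (k : ℕ) (x : ℕ → Vertex d) : Prop :=
  (∀ i < k, adj (x i) (x (i + 1))) ∧ ∀ i ≤ k, ∀ j ≤ k, x i = x j → i = j

/-- The modified one-arm event `E_n(p)`: a path `x_0, …, x_k` with `‖x_0‖₁ = n`,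
`‖x_i‖₁ < n` for `1 ≤ i ≤ k`, `x_k = 0`, whose head consists of `p`-open edges and whose
tail is decreasing (values `≤ p`, strictly decreasing towards the origin). -/
def modifiedOneArm {d : ℕ} (κ n : ℕ) (p : ℝ) (U : Config d) : Prop :=
  ∃ (k : ℕ) (x : ℕ → Vertex d),
    IsPathOn k x ∧ norm1 (x 0) = (n : ℤ) ∧ (∀ i, 1 ≤ i → i ≤ k → norm1 (x i) < (n : ℤ)) ∧
    x k = 0 ∧
    ∃ l ≤ k,
      (∀ i < l, openEdge κ U p s(x i, x (i + 1))) ∧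
      (∀ i, l ≤ i → i < k → U s(x i, x (i + 1)) ≤ p) ∧
      (∀ i, l ≤ i → i + 1 < k → U s(x (i + 1), x (i + 2)) < U s(x i, x (i + 1)))

/-- `a` and `b` are connected by a `p`-open path. -/
def openConn {d : ℕ} (κ : ℕ) (U : Config d) (p : ℝ) (a b : Vertex d) : Prop :=
  ∃ (k : ℕ) (x : ℕ → Vertex d), IsPathOn k x ∧ x 0 = a ∧ x k = b ∧
    ∀ i < k, openEdge κ U p s(x i, x (i + 1))

/-- There is an infinite `p`-open path starting at the origin. -/
def zeroToInf {d : ℕ} (κ : ℕ) (U : Config d) (p : ℝ) : Prop :=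
  ∃ x : ℕ → Vertex d, x 0 = 0 ∧ (∀ i, adj (x i) (x (i + 1))) ∧ Function.Injective x ∧
    ∀ i, openEdge κ U p s(x i, x (i + 1))

/-- `P` is the law of i.i.d. `Uniform[0,1]` labels: a probability measure whose
finite-dimensional cylinder probabilities are products of uniform probabilities. -/
def IsProductUniform {d : ℕ} (P : Measure (Config d)) : Prop :=
  IsProbabilityMeasure P ∧
    ∀ (s : Finset (Sym2 (Vertex d))) (f : Sym2 (Vertex d) → Set ℝ),
      (∀ e ∈ s, MeasurableSet (f e)) →
      P {U | ∀ e ∈ s, U e ∈ f e} = ∏ e ∈ s, volume (f e ∩ Set.Icc 0 1)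

/-- The one-arm probability `θ_n(p)`. -/
noncomputable def theta {d : ℕ} (κ : ℕ) (P : Measure (Config d)) (n : ℕ) (p : ℝ) : ℝ :=
  (P {U | U ∈ goodConfigs d ∧ ∃ b, norm1 b = (n : ℤ) ∧ openConn κ U p 0 b}).toReal

/-- `θ(p) = ℙ(0 ↔ ∞)`. -/
noncomputable def thetaInf {d : ℕ} (κ : ℕ) (P : Measure (Config d)) (p : ℝ) : ℝ :=
  (P {U | U ∈ goodConfigs d ∧ zeroToInf κ U p}).toReal

/-- The critical point `p_c`. -/
noncomputable def pc {d : ℕ} (κ : ℕ) (P : Measure (Config d)) : ℝ :=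
  sSup {p : ℝ | p ∈ Set.Icc (0 : ℝ) 1 ∧ thetaInf κ P p = 0}

/-- The modified one-arm probability `τ_n(p)`. -/
noncomputable def tau {d : ℕ} (κ : ℕ) (P : Measure (Config d)) (n : ℕ) (p : ℝ) : ℝ :=
  (P {U | U ∈ goodConfigs d ∧ modifiedOneArm κ n p U}).toReal

/-- `e` is `p`-pivotal for `E_n(p)` at `U`. -/
def pPivotal {d : ℕ} (κ n : ℕ) (p : ℝ) (e : Sym2 (Vertex d)) (U : Config d) : Prop :=
  U ∈ goodConfigs d ∧ p < U e ∧ Function.update U e p ∈ goodConfigs d ∧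
    ¬ (modifiedOneArm κ n p U ↔ modifiedOneArm κ n p (Function.update U e p))

/-- `e` is `U`-pivotal for `E_n(p)` at `U`. -/
def uPivotal {d : ℕ} (κ n : ℕ) (p : ℝ) (e : Sym2 (Vertex d)) (U : Config d) : Prop :=
  U ∈ goodConfigs d ∧ ∃ U' ∈ goodConfigs d, (∀ f, f ≠ e → U' f = U f) ∧
    ¬ (modifiedOneArm κ n p U ↔ modifiedOneArm κ n p U')

section
open scoped Classical
variable {d : ℕ}

/-- Unordered pairs of vertices, carrying the labels. -/
abbrev Edge (d : ℕ) := Sym2 (Vertex d)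

lemma adj_comm {x y : Vertex d} : adj x y ↔ adj y x := by
  simp only [adj, abs_sub_comm]

lemma isNNEdge_mk {x y : Vertex d} : IsNNEdge s(x, y) ↔ adj x y := by
  constructor
  · rintro ⟨a, b, h, he⟩
    rcases Sym2.eq_iff.1 he with ⟨rfl, rfl⟩ | ⟨rfl, rfl⟩
    · exact h
    · exact adj_comm.1 h
  · exact fun h => ⟨x, y, h, rfl⟩

/-- The lattice neighbours of a vertex. -/
noncomputable def nbrs (v : Vertex d) : Finset (Vertex d) :=
  (Finset.univ : Finset (Fin d × Bool)).image fun q => v + Pi.single q.1 (if q.2 then 1 else -1)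

lemma mem_nbrs {v w : Vertex d} : w ∈ nbrs v ↔ adj v w := by
  simp only [nbrs, Finset.mem_image, Finset.mem_univ, true_and, Prod.exists]
  constructor
  · rintro ⟨i, b, rfl⟩
    unfold adj
    rw [Finset.sum_eq_single i]
    · cases b <;> simp
    · intro j _ hj
      simp [hj]
    · simp
  · intro h
    unfold adj at h
    have h1 : ∃ i, v i - w i ≠ 0 := by
      by_contra! h2
      simp [h2] at h
    obtain ⟨i, hi⟩ := h1
    have hi' : 1 ≤ |v i - w i| := Int.one_le_abs hi
    have hs := Finset.add_sum_erase Finset.univ (fun i => |v i - w i|) (Finset.mem_univ i)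
    have h0 : 0 ≤ ∑ j ∈ Finset.univ.erase i, |v j - w j| :=
      Finset.sum_nonneg fun _ _ => abs_nonneg _
    have hz : ∑ j ∈ Finset.univ.erase i, |v j - w j| = 0 := by omega
    have hone : |v i - w i| = 1 := by omega
    rw [Finset.sum_eq_zero_iff_of_nonneg (fun _ _ => abs_nonneg _)] at hz
    have hj : ∀ j, j ≠ i → w j = v j := by
      intro j hj
      have := hz j (by simp [hj])
      rw [abs_eq_zero] at this
      omega
    rcases (abs_eq (by norm_num)).1 hone with h3 | h3
    · refine ⟨i, false, ?_⟩
      ext j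
      by_cases hji : j = i
      · subst hji; simp; omega
      · simp [hji, hj j hji]
    · refine ⟨i, true, ?_⟩
      ext j
      by_cases hji : j = i
      · subst hji; simp; omega
      · simp [hji, hj j hji]

lemma card_nbrs_le (v : Vertex d) : (nbrs v).card ≤ 2 * d := by
  refine Finset.card_image_le.trans ?_
  simp [mul_comm]

/-- The nearest-neighbour edges at a vertex. -/
noncomputable def star (v : Vertex d) : Finset (Edge d) := (nbrs v).image fun w => s(v, w)

lemma mem_star {v : Vertex d} {f : Edge d} : f ∈ star v ↔ IsNNEdge f ∧ v ∈ f := by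
  simp only [star, Finset.mem_image, mem_nbrs]
  constructor
  · rintro ⟨w, h, rfl⟩
    exact ⟨isNNEdge_mk.2 h, Sym2.mem_mk_left _ _⟩
  · rintro ⟨h, hv⟩
    obtain ⟨w, rfl⟩ := Sym2.mem_iff_exists.1 hv
    exact ⟨w, isNNEdge_mk.1 h, rfl⟩

lemma card_star_le (v : Vertex d) : (star v).card ≤ 2 * d :=
  Finset.card_image_le.trans (card_nbrs_le v)

/-- The nearest-neighbour edges sharing a vertex with the nearest-neighbour edge `e`. -/
noncomputable def lnb (e : Edge d) : Finset (Edge d) :=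
  if IsNNEdge e then e.toFinset.biUnion star else ∅

lemma mem_lnb {e f : Edge d} : f ∈ lnb e ↔ IsNNEdge e ∧ IsNNEdge f ∧ ∃ v, v ∈ e ∧ v ∈ f := by
  unfold lnb
  split_ifs with h
  · simp only [Finset.mem_biUnion, Sym2.mem_toFinset, mem_star]
    tauto
  · simp [h]

lemma mem_lnb_comm {e f : Edge d} : f ∈ lnb e ↔ e ∈ lnb f := by
  simp only [mem_lnb]; tauto

lemma self_mem_lnb {e : Edge d} (h : IsNNEdge e) : e ∈ lnb e := by
  rw [mem_lnb]
  refine ⟨h, h, ?_⟩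
  obtain ⟨x, y, -, rfl⟩ := h
  exact ⟨x, by simp⟩

lemma card_toFinset_le (e : Edge d) : e.toFinset.card ≤ 2 := by
  induction e using Sym2.inductionOn with
  | hf x y =>
    rw [Sym2.toFinset_mk_eq]
    exact Finset.card_le_two

lemma card_lnb_le (e : Edge d) : (lnb e).card ≤ 4 * d := by
  unfold lnb
  split_ifs
  · calc _ ≤ e.toFinset.card * (2 * d) :=
          Finset.card_biUnion_le_card_mul _ _ _ fun v _ => card_star_le v
      _ ≤ 2 * (2 * d) := Nat.mul_le_mul_right _ (card_toFinset_le e)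
      _ = _ := by ring
  · simp

/-- Distinct nearest-neighbour edges sharing a vertex. -/
def LAdj (e f : Edge d) : Prop := IsNNEdge e ∧ IsNNEdge f ∧ e ≠ f ∧ ∃ v, v ∈ e ∧ v ∈ f

lemma LAdj.symm {e f : Edge d} (h : LAdj e f) : LAdj f e :=
  ⟨h.2.1, h.1, h.2.2.1.symm, h.2.2.2.imp fun _ h => h.symm⟩

lemma LAdj.mem_lnb {e f : Edge d} (h : LAdj e f) : f ∈ lnb e :=
  CDP.mem_lnb.2 ⟨h.1, h.2.1, h.2.2.2⟩

/-- Sequences with at most `m` steps, each one inside `nb`, which start at `a` and are constant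
after time `m`. -/
noncomputable def walks {α : Type*} (nb : α → Finset α) : ℕ → α → Finset (ℕ → α)
  | 0, a => {fun _ => a}
  | m + 1, a => (nb a).biUnion fun b =>
      (walks nb m b).image fun w i => Nat.casesOn i a w

lemma card_walks_le {α : Type*} {nb : α → Finset α} {D : ℕ} (h : ∀ a, (nb a).card ≤ D) (m : ℕ)
    (a : α) : (walks nb m a).card ≤ D ^ m := by
  induction m generalizing a with
  | zero => simp [walks]
  | succ m ih =>
    rw [walks, pow_succ']
    refine (Finset.card_biUnion_le_card_mul _ _ (D ^ m) fun b _ => ?_).trans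
      (Nat.mul_le_mul_right _ (h a))
    exact Finset.card_image_le.trans (ih b)

lemma exists_mem_walks {α : Type*} {nb : α → Finset α} (m : ℕ) (x : ℕ → α)
    (hx : ∀ i < m, x (i + 1) ∈ nb (x i)) : ∃ w ∈ walks nb m (x 0), ∀ i ≤ m, w i = x i := by
  induction m generalizing x with
  | zero => exact ⟨_, Finset.mem_singleton_self _, fun i hi => by rw [Nat.le_zero.1 hi]⟩
  | succ m ih =>
    obtain ⟨w, hw, hwx⟩ := ih (fun i => x (i + 1)) fun i hi => hx (i + 1) (by omega)
    refine ⟨fun i => Nat.casesOn i (x 0) w, ?_, ?_⟩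
    · rw [walks, Finset.mem_biUnion]
      exact ⟨x 1, hx 0 (by omega), Finset.mem_image.2 ⟨w, hw, rfl⟩⟩
    · rintro (_ | i) hi
      · rfl
      · exact hwx i (by omega)

/-- Edges within `M` steps of `e` in the line graph. -/
noncomputable def lball : ℕ → Edge d → Finset (Edge d)
  | 0, e => {e}
  | M + 1, e => (lball M e).biUnion lnb

lemma lball_trans {M N : ℕ} {e f g : Edge d} (h : f ∈ lball M e) (h' : g ∈ lball N f) :
    g ∈ lball (M + N) e := by
  induction N generalizing g with
  | zero => rw [lball, Finset.mem_singleton] at h'; simpa [h'] using h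
  | succ N ih =>
    rw [lball, Finset.mem_biUnion] at h'
    obtain ⟨a, ha, hg⟩ := h'
    rw [← add_assoc, lball, Finset.mem_biUnion]
    exact ⟨a, ih ha, hg⟩

lemma mem_lball_chain {m : ℕ} {f : ℕ → Edge d} (h : ∀ i < m, f (i + 1) ∈ lnb (f i)) :
    f m ∈ lball m (f 0) := by
  induction m with
  | zero => simp [lball]
  | succ m ih =>
    rw [lball, Finset.mem_biUnion]
    exact ⟨f m, ih fun i hi => h i (by omega), h m (by omega)⟩

open ENNReal in
lemma sum_biUnion_le_sum {α β : Type*} [DecidableEq β] (s : Finset α) (t : α → Finset β)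
    (ψ : β → ℝ≥0∞) :
    ∑ f ∈ s.biUnion t, ψ f ≤ ∑ g ∈ s, ∑ f ∈ t g, ψ f := by
  induction s using Finset.induction_on with
  | empty => simp
  | insert a s ha ih =>
    rw [Finset.biUnion_insert, Finset.sum_insert ha]
    calc _ ≤ ∑ f ∈ t a ∪ s.biUnion t, ψ f + ∑ f ∈ t a ∩ s.biUnion t, ψ f := le_self_add
      _ = ∑ f ∈ t a, ψ f + ∑ f ∈ s.biUnion t, ψ f := Finset.sum_union_inter
      _ ≤ _ := by gcongr

open ENNReal in
lemma tsum_lball_le (ψ : Edge d → ℝ≥0∞) (M : ℕ) :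
    ∑' e, ∑ f ∈ lball M e, ψ f ≤ (4 * d : ℕ) ^ M * ∑' f, ψ f := by
  induction M generalizing ψ with
  | zero => simp [lball]
  | succ M ih =>
    have h1 : ∀ e : Edge d, ∑ f ∈ lball (M + 1) e, ψ f ≤
        ∑ g ∈ lball M e, ∑ f ∈ lnb g, ψ f := fun e => by
      rw [lball]
      exact sum_biUnion_le_sum _ _ _
    have h2 : ∑' g : Edge d, ∑ f ∈ lnb g, ψ f ≤ (4 * d : ℕ) * ∑' f, ψ f := by
      calc ∑' g : Edge d, ∑ f ∈ lnb g, ψ f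
          = ∑' g : Edge d, ∑' f, if f ∈ lnb g then ψ f else 0 := by
            refine tsum_congr fun g => ?_
            rw [tsum_eq_sum (s := lnb g) (fun f hf => by simp [hf])]
            exact Finset.sum_congr rfl fun f hf => by simp [hf]
        _ = ∑' f : Edge d, ∑' g, if f ∈ lnb g then ψ f else 0 := ENNReal.tsum_comm
        _ ≤ ∑' f : Edge d, (4 * d : ℕ) * ψ f := by
            refine ENNReal.tsum_le_tsum fun f => ?_
            rw [tsum_eq_sum (s := lnb f) (fun g hg => by
              rw [mem_lnb_comm] at hg; simp [hg])]
            calc _ ≤ ∑ g ∈ lnb f, ψ f := Finset.sum_le_sum fun g _ => by split_ifs <;> simp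
              _ ≤ _ := by
                rw [Finset.sum_const, nsmul_eq_mul]
                gcongr
                exact card_lnb_le f
        _ = _ := ENNReal.tsum_mul_left
    calc _ ≤ _ := ENNReal.tsum_le_tsum h1
      _ ≤ _ := ih _
      _ ≤ (4 * d : ℕ) ^ M * ((4 * d : ℕ) * ∑' f, ψ f) := by gcongr
      _ = _ := by rw [pow_succ, mul_assoc]

end

section
open scoped Classical
variable {d : ℕ} {κ : ℕ} {U V : Config d} {p : ℝ}

/-- Approximations of the set of edges that ever open, for the order `r` of arrival. -/
def opm (κ : ℕ) (r : Edge d → Edge d → Prop) : ℕ → Edge d → Prop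
  | 0, _ => False
  | m + 1, e => ∀ v ∈ e, Set.ncard {f | IsNNEdge f ∧ v ∈ f ∧ f ≠ e ∧ r f e ∧ opm κ r m f} < κ

/-- The edge `e` opens at its arrival time. -/
def mop (κ : ℕ) (U : Config d) (e : Edge d) : Prop :=
  ∃ m₀, ∀ m ≥ m₀, opm κ (fun f g => U f < U g) m e

/-- The edge `e` is open at time `p`. -/
def oe (κ : ℕ) (U : Config d) (p : ℝ) (e : Edge d) : Prop := IsNNEdge e ∧ U e ≤ p ∧ mop κ U e

/-- Adjacent earlier edges form a well-founded relation. -/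
def Wf (U : Config d) : Prop := WellFounded fun f e => LAdj f e ∧ U f < U e

/-- Adjacent later edges form a well-founded relation. -/
def WfUp (U : Config d) : Prop := WellFounded fun f e => LAdj f e ∧ U e < U f

lemma ladj_of {e f : Edge d} {v : Vertex d} (he : IsNNEdge e) (hv : v ∈ e) (hf : IsNNEdge f)
    (hvf : v ∈ f) (hne : f ≠ e) : LAdj f e := ⟨hf, he, hne, v, hvf, hv⟩

lemma mop_stab (hU : Wf U) (e : Edge d) (he : IsNNEdge e) :
    ∃ m₀, ∀ m ≥ m₀, (opm κ (fun f g => U f < U g) m e ↔ mop κ U e) := by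
  induction e using hU.induction with
  | h e ih =>
    have : ∀ f, ∃ m₀, (LAdj f e ∧ U f < U e) → ∀ m ≥ m₀,
        (opm κ (fun f g => U f < U g) m f ↔ mop κ U f) := by
      intro f
      by_cases hf : LAdj f e ∧ U f < U e
      · obtain ⟨m₀, h⟩ := ih f hf hf.1.1
        exact ⟨m₀, fun _ => h⟩
      · exact ⟨0, fun h => absurd h hf⟩
    choose m₀ hm₀ using this
    have key : ∀ m ≥ (lnb e).sup m₀ + 1, (opm κ (fun f g => U f < U g) m e ↔
        ∀ v ∈ e, Set.ncard {f | IsNNEdge f ∧ v ∈ f ∧ f ≠ e ∧ U f < U e ∧ mop κ U f} < κ) := by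
      intro m hm
      obtain ⟨m, rfl⟩ : ∃ m', m = m' + 1 := ⟨m - 1, by omega⟩
      rw [opm]
      refine forall₂_congr fun v hv => ?_
      have : {f | IsNNEdge f ∧ v ∈ f ∧ f ≠ e ∧ U f < U e ∧ opm κ (fun f g => U f < U g) m f} =
          {f | IsNNEdge f ∧ v ∈ f ∧ f ≠ e ∧ U f < U e ∧ mop κ U f} := by
        ext f
        simp only [Set.mem_ofPred_eq]
        refine and_congr_right fun h1 => and_congr_right fun h2 => and_congr_right fun h3 =>
          and_congr_right fun h4 => ?_
        have hl := ladj_of he hv h1 h2 h3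
        refine hm₀ f ⟨hl, h4⟩ m ?_
        have := Finset.le_sup (f := m₀) hl.symm.mem_lnb
        omega
      rw [this]
    refine ⟨(lnb e).sup m₀ + 1, fun m hm => ?_⟩
    rw [key m hm]
    constructor
    · exact fun h => ⟨_, fun m hm => (key m hm).2 h⟩
    · rintro ⟨m₁, h⟩
      exact (key _ (le_max_right m₁ _)).1 (h _ (le_max_left _ _))

lemma mop_iff (hU : Wf U) (e : Edge d) (he : IsNNEdge e) :
    mop κ U e ↔ ∀ v ∈ e,
      Set.ncard {f | IsNNEdge f ∧ v ∈ f ∧ f ≠ e ∧ U f < U e ∧ mop κ U f} < κ := by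
  have : ∀ f, ∃ m₀, IsNNEdge f → ∀ m ≥ m₀,
      (opm κ (fun f g => U f < U g) m f ↔ mop κ U f) := by
    intro f
    by_cases hf : IsNNEdge f
    · obtain ⟨m₀, h⟩ := mop_stab (κ := κ) hU f hf
      exact ⟨m₀, fun _ => h⟩
    · exact ⟨0, fun h => absurd h hf⟩
  choose m₀ hm₀ using this
  set m := (lnb e).sup m₀
  have he' : m₀ e ≤ m := Finset.le_sup (self_mem_lnb he)
  rw [← hm₀ e he (m + 1) (by omega), opm]
  refine forall₂_congr fun v hv => ?_
  have : {f | IsNNEdge f ∧ v ∈ f ∧ f ≠ e ∧ U f < U e ∧ opm κ (fun f g => U f < U g) m f} =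
      {f | IsNNEdge f ∧ v ∈ f ∧ f ≠ e ∧ U f < U e ∧ mop κ U f} := by
    ext f
    simp only [Set.mem_ofPred_eq]
    refine and_congr_right fun h1 => and_congr_right fun h2 => and_congr_right fun h3 =>
      and_congr_right fun h4 => ?_
    exact hm₀ f h1 m (Finset.le_sup (ladj_of he hv h1 h2 h3).symm.mem_lnb)
  rw [this]

lemma mop_eq_of_closed (hU : Wf U) (T : Set (Edge d))
    (hT : ∀ e ∈ T, ∀ f, LAdj f e → U f < U e → f ∈ T) (σ : Edge d → Prop)
    (hσ : ∀ e ∈ T, IsNNEdge e → (σ e ↔ ∀ v ∈ e,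
      Set.ncard {f | IsNNEdge f ∧ v ∈ f ∧ f ≠ e ∧ U f < U e ∧ σ f} < κ))
    (e : Edge d) (he : e ∈ T) (hn : IsNNEdge e) : mop κ U e ↔ σ e := by
  induction e using hU.induction with
  | h e ih =>
    rw [mop_iff hU e hn, hσ e he hn]
    refine forall₂_congr fun v hv => ?_
    have : {f | IsNNEdge f ∧ v ∈ f ∧ f ≠ e ∧ U f < U e ∧ mop κ U f} =
        {f | IsNNEdge f ∧ v ∈ f ∧ f ≠ e ∧ U f < U e ∧ σ f} := by
      ext f
      simp only [Set.mem_ofPred_eq]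
      refine and_congr_right fun h1 => and_congr_right fun h2 => and_congr_right fun h3 =>
        and_congr_right fun h4 => ?_
      have hl := ladj_of hn hv h1 h2 h3
      exact ih f ⟨hl, h4⟩ (hT e he f hl h4) h1
    rw [this]

lemma mop_congr (hU : Wf U) (hV : Wf V) (T : Set (Edge d))
    (hT : ∀ e ∈ T, ∀ f, LAdj f e → U f < U e → f ∈ T)
    (hc : ∀ e ∈ T, ∀ f, LAdj f e → (U f < U e ↔ V f < V e))
    (e : Edge d) (he : e ∈ T) (hn : IsNNEdge e) : mop κ U e ↔ mop κ V e := by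
  refine mop_eq_of_closed hU T hT _ (fun e he hn => ?_) e he hn
  rw [mop_iff hV e hn]
  refine forall₂_congr fun v hv => ?_
  have : {f | IsNNEdge f ∧ v ∈ f ∧ f ≠ e ∧ U f < U e ∧ mop κ V f} =
      {f | IsNNEdge f ∧ v ∈ f ∧ f ≠ e ∧ V f < V e ∧ mop κ V f} := by
    ext f
    simp only [Set.mem_ofPred_eq]
    refine and_congr_right fun h1 => and_congr_right fun h2 => and_congr_right fun h3 => ?_
    rw [hc e he f (ladj_of hn hv h1 h2 h3)]
  rw [this]

lemma openEdge_iff (hU : Wf U) (e : Edge d) : openEdge κ U p e ↔ oe κ U p e := by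
  unfold openEdge oe
  refine and_congr_right fun hn => and_congr_right fun _ => ?_
  constructor
  · rintro ⟨σ, hσ, he⟩
    exact (mop_eq_of_closed hU Set.univ (fun _ _ _ _ _ => trivial) σ (fun e _ hn => hσ e hn) e
      trivial hn).2 he
  · exact fun h => ⟨mop κ U, fun e hn => mop_iff hU e hn, h⟩

lemma wf_iff : Wf U ↔
    ¬ ∃ x : ℕ → Edge d, ∀ i, LAdj (x (i + 1)) (x i) ∧ U (x (i + 1)) < U (x i) := by
  unfold Wf
  rw [wellFounded_iff_isEmpty_descending_chain]
  constructor
  · rintro h ⟨x, hx⟩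
    exact h.false ⟨x, hx⟩
  · exact fun h => ⟨fun x => h ⟨x.1, x.2⟩⟩

lemma wfUp_iff : WfUp U ↔ Wf (fun e => - U e) := by
  simp only [Wf, WfUp, neg_lt_neg_iff]

lemma Wf.congr_off (hU : Wf U) (R : Set (Edge d)) (hR : R.Finite) (h : ∀ e, e ∉ R → V e = U e) :
    Wf V := by
  rw [wf_iff] at hU ⊢
  rintro ⟨x, hx⟩
  have hanti : StrictAnti fun i => V (x i) := strictAnti_nat_of_succ_lt fun i => (hx i).2
  have hinj : Function.Injective x := fun i j hij => hanti.injective (by simp [hij])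
  have hfin : (x ⁻¹' R).Finite := hR.preimage hinj.injOn
  obtain ⟨N, hN⟩ := hfin.bddAbove
  have hoff : ∀ i, x (N + 1 + i) ∉ R := fun i hi => by
    have : N + 1 + i ≤ N := hN hi
    omega
  refine hU ⟨fun i => x (N + 1 + i), fun i => ⟨(hx _).1, ?_⟩⟩
  have := (hx (N + 1 + i)).2
  rw [h _ (hoff i), add_assoc, h _ (hoff (i + 1))] at this
  exact this

lemma wf_of_finite (c : ℝ) (R : Set (Edge d)) (hR : R.Finite) (h : ∀ e, e ∉ R → V e = c) :
    Wf V := by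
  refine Wf.congr_off (U := fun _ => c) ?_ R hR h
  rw [wf_iff]
  rintro ⟨x, hx⟩
  exact lt_irrefl _ (hx 0).2

/-- The configuration in which the edges of `K` never arrive. -/
noncomputable def rem (K : Finset (Edge d)) (U : Config d) : Config d :=
  fun e => if e ∈ K then 2 else U e

@[simp] lemma rem_empty : rem ∅ U = U := by ext; simp [rem]

lemma rem_rem (K S : Finset (Edge d)) : rem K (rem S U) = rem (S ∪ K) U := by
  ext e
  simp only [rem, Finset.mem_union]
  split_ifs <;> tauto

lemma rem_of_mem {K : Finset (Edge d)} {e : Edge d} (h : e ∈ K) : rem K U e = 2 := by simp [rem, h]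

lemma rem_of_notMem {K : Finset (Edge d)} {e : Edge d} (h : e ∉ K) : rem K U e = U e := by
  simp [rem, h]

lemma Wf.rem (hU : Wf U) (K : Finset (Edge d)) : Wf (rem K U) :=
  hU.congr_off K K.finite_toSet fun e he => rem_of_notMem (by simpa using he)

lemma notMem_of_rem_le {K : Finset (Edge d)} {e : Edge d} (hp : p < 2) (h : rem K U e ≤ p) :
    e ∉ K := fun he => by
  rw [rem_of_mem he] at h
  linarith

/-- Removing the edges of `W` does not change the state at time `p` of the other edges. -/
def Inert (κ : ℕ) (U : Config d) (p : ℝ) (W : Finset (Edge d)) : Prop :=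
  ∀ t, t ∉ W → IsNNEdge t → U t ≤ p → ¬ mop κ U t → ∀ g ∈ W, LAdj g t → U g < U t → ¬ mop κ U g

lemma Inert.mop_rem {W : Finset (Edge d)} (hp : p < 2) (hU : Wf U) (hW : Inert κ U p W)
    {e : Edge d} (he : IsNNEdge e) (hep : rem W U e ≤ p) : mop κ (rem W U) e ↔ mop κ U e := by
  refine mop_eq_of_closed (hU.rem W) {e | rem W U e ≤ p} (fun e he f _ hf => hf.le.trans he) _ ?_
    e hep he
  clear e he hep
  intro e hep he
  have heW : e ∉ W := notMem_of_rem_le hp hep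
  have hue : rem W U e = U e := rem_of_notMem heW
  have hUp : U e ≤ p := hue ▸ hep
  have hsub : ∀ v ∈ e, {f | IsNNEdge f ∧ v ∈ f ∧ f ≠ e ∧ rem W U f < rem W U e ∧ mop κ U f} ⊆
      {f | IsNNEdge f ∧ v ∈ f ∧ f ≠ e ∧ U f < U e ∧ mop κ U f} := by
    rintro v hv f ⟨h1, h2, h3, h4, h5⟩
    refine ⟨h1, h2, h3, ?_, h5⟩
    rwa [rem_of_notMem (notMem_of_rem_le hp (h4.le.trans hep)), hue] at h4
  constructor
  · intro h v hv
    refine lt_of_le_of_lt (Set.ncard_le_ncard (hsub v hv) ?_) ((mop_iff hU e he).1 h v hv)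
    exact (star v).finite_toSet.subset fun f hf => by
      simpa using mem_star.2 ⟨hf.1, hf.2.1⟩
  · intro h
    by_contra hn
    refine hn ((mop_iff hU e he).2 fun v hv => ?_)
    convert h v hv using 3
    refine Set.Subset.antisymm ?_ (hsub v hv)
    rintro f ⟨h1, h2, h3, h4, h5⟩
    refine ⟨h1, h2, h3, ?_, h5⟩
    have : f ∉ W := fun hf => hW e heW he hUp hn f hf (ladj_of he hv h1 h2 h3) h4 h5
    rwa [rem_of_notMem this, hue]

lemma Inert.oe_of_rem {W : Finset (Edge d)} (hp : p < 2) (hU : Wf U) (hW : Inert κ U p W)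
    {e : Edge d} (h : oe κ (rem W U) p e) : oe κ U p e := by
  refine ⟨h.1, ?_, (hW.mop_rem hp hU h.1 h.2.1).1 h.2.2⟩
  have := h.2.1
  rwa [rem_of_notMem (notMem_of_rem_le hp this)] at this

lemma Inert.oe_rem {W : Finset (Edge d)} (hp : p < 2) (hU : Wf U) (hW : Inert κ U p W)
    {e : Edge d} (he : e ∉ W) (h : oe κ U p e) : oe κ (rem W U) p e := by
  have : rem W U e ≤ p := by rw [rem_of_notMem he]; exact h.2.1
  exact ⟨h.1, this, (hW.mop_rem hp hU h.1 this).2 h.2.2⟩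

lemma inert_of_lt {W : Finset (Edge d)} (h : ∀ g ∈ W, p < U g) : Inert κ U p W :=
  fun _ _ _ htp _ g hg _ hgt _ => absurd (h g hg) (by linarith)

/-- `x` is a witness for the modified arm event from the sphere of radius `n` around `c` to `c`;
its first `l` edges satisfy `O` and the labels decrease along the others. -/
structure Wit (O : Edge d → Prop) (U : Config d) (p : ℝ) (n : ℕ) (c : Vertex d) (k l : ℕ)
    (x : ℕ → Vertex d) : Prop where
  path : IsPathOn k x
  start : norm1 (x 0 - c) = n
  inside : ∀ i, 1 ≤ i → i ≤ k → norm1 (x i - c) < n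
  fin : x k = c
  le : l ≤ k
  head : ∀ i < l, O s(x i, x (i + 1))
  tail_le : ∀ i, l ≤ i → i < k → U s(x i, x (i + 1)) ≤ p
  tail_lt : ∀ i, l ≤ i → i + 1 < k → U s(x (i + 1), x (i + 2)) < U s(x i, x (i + 1))

lemma Wit.congr {O O' : Edge d → Prop} {n : ℕ} {c : Vertex d} {k l : ℕ} {x : ℕ → Vertex d}
    (h : Wit O U p n c k l x) (hO : ∀ i < l, O s(x i, x (i + 1)) → O' s(x i, x (i + 1)))
    (hV : ∀ i, l ≤ i → i < k → V s(x i, x (i + 1)) = U s(x i, x (i + 1))) :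
    Wit O' V p n c k l x where
  path := h.path
  start := h.start
  inside := h.inside
  fin := h.fin
  le := h.le
  head i hi := hO i hi (h.head i hi)
  tail_le i hi hik := by rw [hV i hi hik]; exact h.tail_le i hi hik
  tail_lt i hi hik := by
    rw [hV i hi (by omega), hV (i + 1) (by omega) hik]; exact h.tail_lt i hi hik

/-- The modified one-arm event around `c`. -/
def Arm (κ : ℕ) (U : Config d) (p : ℝ) (n : ℕ) (c : Vertex d) : Prop :=
  ∃ k l x, Wit (oe κ U p) U p n c k l x

/-- The one-arm event: the origin is connected to the sphere of radius `n` by an open path. -/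
def Thet (κ : ℕ) (U : Config d) (p : ℝ) (n : ℕ) : Prop :=
  ∃ k x, Wit (oe κ U p) U p n 0 k k x

lemma Thet.arm {n : ℕ} (h : Thet κ U p n) : Arm κ U p n 0 := by
  obtain ⟨k, x, h⟩ := h
  exact ⟨k, k, x, h⟩

lemma modifiedOneArm_iff (hU : Wf U) {n : ℕ} : modifiedOneArm κ n p U ↔ Arm κ U p n 0 := by
  unfold modifiedOneArm Arm
  simp only [openEdge_iff hU]
  constructor
  · rintro ⟨k, x, h1, h2, h3, h4, l, h5, h6, h7, h8⟩
    exact ⟨k, l, x, h1, by simpa using h2, by simpa using h3, h4, h5, h6, h7, h8⟩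
  · rintro ⟨k, l, x, h1, h2, h3, h4, h5, h6, h7, h8⟩
    exact ⟨k, x, h1, by simpa using h2, by simpa using h3, h4, l, h5, h6, h7, h8⟩

lemma Inert.arm_of_rem {W : Finset (Edge d)} (hp : p < 2) (hU : Wf U) (hW : Inert κ U p W) {n : ℕ}
    {c : Vertex d} (h : Arm κ (rem W U) p n c) : Arm κ U p n c := by
  obtain ⟨k, l, x, h⟩ := h
  refine ⟨k, l, x, h.congr (fun i _ => hW.oe_of_rem hp hU) fun i hi hik => ?_⟩
  exact (rem_of_notMem (notMem_of_rem_le hp (h.tail_le i hi hik))).symm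

lemma Inert.wit_rem {W : Finset (Edge d)} (hp : p < 2) (hU : Wf U) (hW : Inert κ U p W) {n : ℕ}
    {c : Vertex d} {k l : ℕ} {x : ℕ → Vertex d} (h : Wit (oe κ U p) U p n c k l x)
    (hx : ∀ i < k, s(x i, x (i + 1)) ∉ W) : Wit (oe κ (rem W U) p) (rem W U) p n c k l x :=
  h.congr (fun i hi => hW.oe_rem hp hU (hx i (by have := h.le; omega)))
    fun i _ hik => rem_of_notMem (hx i hik)

lemma Wit.le_p {n : ℕ} {c : Vertex d} {k l : ℕ} {x : ℕ → Vertex d}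
    (h : Wit (oe κ U p) U p n c k l x) {i : ℕ} (hi : i < k) : U s(x i, x (i + 1)) ≤ p := by
  by_cases hl : i < l
  · exact (h.head i hl).2.1
  · exact h.tail_le i (by omega) hi

lemma Wit.nn {O : Edge d → Prop} {n : ℕ} {c : Vertex d} {k l : ℕ} {x : ℕ → Vertex d}
    (h : Wit O U p n c k l x) {i : ℕ} (hi : i < k) : IsNNEdge s(x i, x (i + 1)) :=
  isNNEdge_mk.2 (h.path.1 i hi)

lemma arm_rem_iff_of_lt {W : Finset (Edge d)} (hp : p < 2) (hU : Wf U) (h : ∀ g ∈ W, p < U g)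
    {n : ℕ} {c : Vertex d} : Arm κ (rem W U) p n c ↔ Arm κ U p n c := by
  refine ⟨(inert_of_lt h).arm_of_rem hp hU, ?_⟩
  rintro ⟨k, l, x, hx⟩
  exact ⟨k, l, x, (inert_of_lt h).wit_rem hp hU hx fun i hi hW => absurd (h _ hW)
    (not_lt.2 (hx.le_p hi))⟩

end

section
open scoped Classical
variable {d : ℕ} {κ : ℕ} {U V : Config d} {p : ℝ}

/-- The edge `e` with the later adjacent edges that fail to open although they arrive before `p`. -/
noncomputable def kset (κ : ℕ) (U : Config d) (p : ℝ) (e : Edge d) : Finset (Edge d) :=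
  insert e ((lnb e).filter fun g => U e < U g ∧ U g ≤ p ∧ ¬ mop κ U g)

lemma kset_subset {e : Edge d} (he : IsNNEdge e) : kset κ U p e ⊆ lnb e :=
  Finset.insert_subset (self_mem_lnb he) (Finset.filter_subset _ _)

lemma self_mem_kset {e : Edge d} : e ∈ kset κ U p e := Finset.mem_insert_self _ _

lemma mem_kset_of_ne {e g : Edge d} (hg : g ∈ kset κ U p e) (h : g ≠ e) :
    g ∈ lnb e ∧ U e < U g ∧ U g ≤ p ∧ ¬ mop κ U g := by
  simpa [kset, h] using hg

lemma mem_kset {e g : Edge d} (h : g ∈ lnb e) (h1 : U e < U g) (h2 : U g ≤ p)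
    (h3 : ¬ mop κ U g) : g ∈ kset κ U p e := by
  simp [kset, h, h1, h2, h3]

lemma inert_of_not_mop {W : Finset (Edge d)} (h : ∀ g ∈ W, ¬ mop κ U g) : Inert κ U p W :=
  fun _ _ _ _ _ g hg _ _ => h g hg

lemma inert_kset (e : Edge d) : Inert κ U p (kset κ U p e) := by
  intro t htW htn htp ht g hg hgt hlt hgm
  by_cases hge : g = e
  · subst hge
    exact htW (mem_kset hgt.mem_lnb hlt htp ht)
  · exact (mem_kset_of_ne hg hge).2.2.2 hgm

lemma exists_flip {α : Type*} [DecidableEq α] (Φ : Finset α → Prop) {A B : Finset α}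
    (hAB : A ⊆ B) (h : ¬ (Φ A ↔ Φ B)) :
    ∃ S, A ⊆ S ∧ S ⊆ B ∧ ∃ g ∈ B, g ∉ S ∧ ¬ (Φ S ↔ Φ (insert g S)) := by
  by_contra! hc
  have key : ∀ C : Finset α, C ⊆ B → (Φ A ↔ Φ (A ∪ C)) := by
    intro C
    induction C using Finset.induction_on with
    | empty => simp
    | insert g C _ ih =>
      intro hC
      rw [Finset.insert_subset_iff] at hC
      refine (ih hC.2).trans ?_
      rw [Finset.union_insert]
      by_cases hg : g ∈ A ∪ C
      · rw [Finset.insert_eq_of_mem hg]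
      · exact hc _ Finset.subset_union_left (Finset.union_subset hAB hC.2) g hC.1 hg
  have := key B subset_rfl
  rw [Finset.union_eq_right.2 hAB] at this
  exact h this

lemma exists_terminal (hp : p < 2) (hU : Wf U) (hUp : WfUp U) {n : ℕ} {c : Vertex d} (e : Edge d)
    (he : IsNNEdge e) (S : Finset (Edge d)) (heS : e ∉ S)
    (h : ¬ (Arm κ (rem S U) p n c ↔ Arm κ (rem (insert e S) U) p n c)) :
    ∃ (m : ℕ) (f : ℕ → Edge d) (S' : Finset (Edge d)), f 0 = e ∧
      (∀ i < m, LAdj (f i) (f (i + 1)) ∧ U (f i) < U (f (i + 1))) ∧ S ⊆ S' ∧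
      (∀ i < m, f i ∈ S') ∧ f m ∉ S' ∧ U (f m) ≤ p ∧ IsNNEdge (f m) ∧
      S' ⊆ S ∪ (Finset.range m).biUnion (fun i => lnb (f i)) ∧
      Arm κ (rem S' U) p n c ∧ ¬ Arm κ (rem (kset κ (rem S' U) p (f m)) (rem S' U)) p n c := by
  induction e using hUp.induction generalizing S with
  | h e ih =>
    set U₁ := rem S U with hU₁
    have hw : Wf U₁ := hU.rem S
    have hins : rem (insert e S) U = rem {e} U₁ := by
      rw [hU₁, rem_rem, Finset.union_comm, Finset.insert_eq]
    rw [hins] at h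
    by_cases hK : Arm κ (rem {e} U₁) p n c ↔ Arm κ (rem (kset κ U₁ p e) U₁) p n c
    · rw [hK] at h
      have himp := (inert_kset (κ := κ) (p := p) (U := U₁) e).arm_of_rem hp hw (n := n) (c := c)
      have h1 : Arm κ U₁ p n c ∧ ¬ Arm κ (rem (kset κ U₁ p e) U₁) p n c := by tauto
      refine ⟨0, fun _ => e, S, rfl, by simp, subset_rfl, by simp, heS, ?_, he, by simp, h1⟩
      by_contra hlt
      push Not at hlt
      refine h1.2 ((arm_rem_iff_of_lt hp hw fun g hg => ?_).2 h1.1)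
      have hUe : p < U₁ e := by rwa [hU₁, rem_of_notMem heS]
      by_cases hge : g = e
      · rwa [hge]
      · exact hUe.trans (mem_kset_of_ne hg hge).2.1
    · obtain ⟨S₁, hS₁, hS₁K, g, hgK, hgS, hg⟩ := exists_flip
        (fun K => Arm κ (rem K U₁) p n c) (Finset.singleton_subset_iff.2 self_mem_kset) hK
      have heS₁ : e ∈ S₁ := by simpa using hS₁
      have hge : g ≠ e := fun h => hgS (h ▸ heS₁)
      obtain ⟨hgl, hlt, hgp, -⟩ := mem_kset_of_ne hgK hge
      have hgnS : g ∉ S := notMem_of_rem_le hp hgp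
      have hUg : U₁ g = U g := rem_of_notMem hgnS
      have hUe : U₁ e = U e := rem_of_notMem heS
      rw [hUg, hUe] at hlt
      have hgn := (mem_lnb.1 hgl).2.1
      have hadj : LAdj e g := ⟨he, hgn, hge.symm, (mem_lnb.1 hgl).2.2⟩
      rw [hU₁, rem_rem, rem_rem, Finset.union_insert] at hg
      obtain ⟨m, f, S', h0, h1, h2, h3, h4, h5, h6, h7, h8⟩ := ih g ⟨hadj.symm, hlt⟩ hgn (S ∪ S₁)
        (by simp [hgnS, hgS]) hg
      obtain ⟨F, hF0, hF⟩ : ∃ F : ℕ → Edge d, F 0 = e ∧ ∀ i, F (i + 1) = f i :=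
        ⟨fun i => match i with
          | 0 => e
          | i + 1 => f i, rfl, fun _ => rfl⟩
      rw [← hF] at h4 h5 h6 h8
      refine ⟨m + 1, F, S', hF0, ?_, Finset.subset_union_left.trans h2,
        ?_, h4, h5, h6, ?_, h8⟩
      · rintro (_ | i) hi
        · rw [hF, hF0, h0]
          exact ⟨hadj, hlt⟩
        · rw [hF, hF]
          exact h1 i (by omega)
      · rintro (_ | i) hi
        · rw [hF0]
          exact h2 (Finset.mem_union_right _ heS₁)
        · rw [hF]
          exact h3 i (by omega)
      · intro a ha
        have ha' := h7 ha
        simp only [Finset.mem_union, Finset.mem_biUnion, Finset.mem_range] at ha' ⊢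
        rcases ha' with (ha' | ha') | ⟨i, hi, ha'⟩
        · exact Or.inl ha'
        · exact Or.inr ⟨0, by omega, hF0 ▸ kset_subset he (hS₁K ha')⟩
        · exact Or.inr ⟨i + 1, by omega, hF i ▸ ha'⟩

/-- Pivotality of `f` for the modified one-arm event, between the labels `p` and `2`. -/
def Piv (κ : ℕ) (p : ℝ) (n : ℕ) (f : Edge d) (V : Config d) : Prop :=
  Arm κ (Function.update V f p) p n 0 ∧ ¬ Arm κ (rem {f} V) p n 0

lemma Wf.update (hU : Wf U) (f : Edge d) (a : ℝ) : Wf (Function.update U f a) :=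
  hU.congr_off {f} (Set.finite_singleton f) fun e he =>
    Function.update_of_ne (by simpa using he) _ _

lemma mop_update (hV : Wf V)
    (hinj : ∀ a b, IsNNEdge a → IsNNEdge b → V a ≤ p → V a = V b → a = b) {e : Edge d}
    (he : IsNNEdge e) (hep : V e ≤ p) (hem : mop κ V e)
    (hno : ∀ f ∈ lnb e, V e < V f → V f ≤ p → mop κ V f) {f : Edge d} (hf : IsNNEdge f)
    (hfp : Function.update V e p f ≤ p) : mop κ (Function.update V e p) f ↔ mop κ V f := by
  refine mop_eq_of_closed (hV.update e p) {f | Function.update V e p f ≤ p}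
    (fun a ha b _ hb => hb.le.trans ha) _ ?_ f hfp hf
  clear f hf hfp
  intro f hfp hf
  have hfin : ∀ (v : Vertex d) (A : Set (Edge d)), (∀ g ∈ A, IsNNEdge g ∧ v ∈ g) → A.Finite :=
    fun v A hA => (star v).finite_toSet.subset fun g hg => by simpa using mem_star.2 (hA g hg)
  by_cases hfe : f = e
  · subst hfe
    refine iff_of_true hem fun v hv => ?_
    rw [Function.update_self]
    set A := {g | IsNNEdge g ∧ v ∈ g ∧ g ≠ f ∧ Function.update V f p g < p ∧ mop κ V g} with hA
    have hAfin : A.Finite := hfin v A fun g hg => ⟨hg.1, hg.2.1⟩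
    have hAv : ∀ g ∈ A, V g < p := fun g hg => by
      have := hg.2.2.2.1
      rwa [Function.update_of_ne hg.2.2.1] at this
    by_cases hall : ∀ g ∈ A, V g < V f
    · refine lt_of_le_of_lt (Set.ncard_le_ncard (fun g hg => ?_) ?_) ((mop_iff hV f hf).1 hem v hv)
      · exact ⟨hg.1, hg.2.1, hg.2.2.1, hall g hg, hg.2.2.2.2⟩
      · exact hfin v _ fun g hg => ⟨hg.1, hg.2.1⟩
    · push Not at hall
      obtain ⟨g₀, hg₀, hfg₀⟩ := hall
      obtain ⟨g, hg, hmax⟩ := hAfin.exists_maximalFor V A ⟨g₀, hg₀⟩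
      have hmax' : ∀ a ∈ A, V a ≤ V g := fun a ha => by
        rcases le_total (V a) (V g) with h | h
        · exact h
        · exact hmax ha h
      have hfg : V f < V g := by
        refine lt_of_le_of_ne (hfg₀.trans (hmax' _ hg₀)) fun h => hg.2.2.1 ?_
        exact (hinj f g hf hg.1 hep h).symm
      have hlt := (mop_iff hV g hg.1).1 hg.2.2.2.2 v hg.2.1
      refine lt_of_le_of_lt ?_ hlt
      have hsub : insert f (A \ {g}) ⊆
          {a | IsNNEdge a ∧ v ∈ a ∧ a ≠ g ∧ V a < V g ∧ mop κ V a} := by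
        intro a ha
        rcases ha with rfl | ⟨ha, hag⟩
        · exact ⟨hf, hv, hg.2.2.1.symm, hfg, hem⟩
        · have hag : a ≠ g := hag
          refine ⟨ha.1, ha.2.1, hag, lt_of_le_of_ne (hmax' a ha) fun h => ?_, ha.2.2.2.2⟩
          exact hag (hinj a g ha.1 hg.1 (hAv a ha).le h)
      calc A.ncard = (insert f (A \ {g})).ncard := by
            rw [Set.ncard_insert_of_notMem (fun h => h.1.2.2.1 rfl) (hAfin.subset Set.sdiff_subset),
              Set.ncard_sdiff_singleton_add_one hg hAfin]
        _ ≤ _ := Set.ncard_le_ncard hsub (hfin v _ fun g hg => ⟨hg.1, hg.2.1⟩)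
  · have hVf : Function.update V e p f = V f := Function.update_of_ne hfe _ _
    have hfp' : V f ≤ p := hVf ▸ hfp
    have hsub : ∀ v, {g | IsNNEdge g ∧ v ∈ g ∧ g ≠ f ∧ Function.update V e p g <
        Function.update V e p f ∧ mop κ V g} ⊆
        {g | IsNNEdge g ∧ v ∈ g ∧ g ≠ f ∧ V g < V f ∧ mop κ V g} := by
      rintro v g ⟨h1, h2, h3, h4, h5⟩
      refine ⟨h1, h2, h3, ?_, h5⟩
      have hge : g ≠ e := by
        rintro rfl
        rw [Function.update_self] at h4
        exact absurd hfp (not_le.2 h4)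
      rwa [hVf, Function.update_of_ne hge] at h4
    rw [mop_iff hV f hf]
    constructor
    · exact fun h v hv => lt_of_le_of_lt
        (Set.ncard_le_ncard (hsub v) (hfin v _ fun g hg => ⟨hg.1, hg.2.1⟩)) (h v hv)
    · intro h
      rw [← mop_iff hV f hf]
      by_contra hn
      refine hn ((mop_iff hV f hf).2 fun v hv => ?_)
      convert h v hv using 3
      refine Set.Subset.antisymm ?_ (hsub v)
      rintro g ⟨h1, h2, h3, h4, h5⟩
      refine ⟨h1, h2, h3, ?_, h5⟩
      have hge : g ≠ e := by
        rintro rfl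
        exact hn (hno f (mem_lnb.2 ⟨he, hf, v, h2, hv⟩) h4 hfp')
      rwa [hVf, Function.update_of_ne hge]

/-- A terminal edge which touches no vertex of the decreasing tail is pivotal once the later
adjacent edges that fail to open are removed. -/
lemma Wit.piv (hp : p < 2) (hV : Wf V)
    (hinj : ∀ a b, IsNNEdge a → IsNNEdge b → V a ≤ p → V a = V b → a = b) {e : Edge d}
    (he : IsNNEdge e) (hep : V e ≤ p) {n k l : ℕ} {x : ℕ → Vertex d}
    (h : Wit (oe κ V p) V p n 0 k l x) (hn : ¬ Arm κ (rem (kset κ V p e) V) p n 0)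
    (htail : ∀ i, l ≤ i → i ≤ k → x i ∉ e) : Piv κ p n e (rem ((kset κ V p e).erase e) V) := by
  set B := (kset κ V p e).erase e with hB
  have hBK : B ∪ {e} = kset κ V p e := by
    ext a
    by_cases hae : a = e
    · simp [hae, self_mem_kset]
    · simp [hB, hae]
  refine ⟨?_, by rwa [rem_rem, hBK]⟩
  have hBmem : ∀ g ∈ B, g ∈ lnb e ∧ V e < V g ∧ V g ≤ p ∧ ¬ mop κ V g := fun g hg =>
    mem_kset_of_ne (Finset.mem_of_mem_erase hg) (Finset.ne_of_mem_erase hg)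
  have hBin : Inert κ V p B := inert_of_not_mop fun g hg => (hBmem g hg).2.2.2
  have htl : ∀ i, l ≤ i → i < k → s(x i, x (i + 1)) ∉ lnb e := by
    intro i hi hik hm
    obtain ⟨-, -, v, hv, hv'⟩ := mem_lnb.1 hm
    rcases Sym2.mem_iff.1 hv' with rfl | rfl
    · exact htail i hi hik.le hv
    · exact htail (i + 1) (by omega) hik hv
  have hav : ∀ i < k, s(x i, x (i + 1)) ∉ B := by
    intro i hik hm
    by_cases hi : i < l
    · exact (hBmem _ hm).2.2.2 (h.head i hi).2.2
    · exact htl i (by omega) hik (hBmem _ hm).1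
  have heB : e ∉ B := Finset.notMem_erase _ _
  have hex : ∃ i < l, s(x i, x (i + 1)) = e := by
    by_contra! hc
    refine hn ⟨k, l, x, (inert_kset e).wit_rem hp hV h fun i hik hm => ?_⟩
    by_cases hie : s(x i, x (i + 1)) = e
    · by_cases hi : i < l
      · exact hc i hi hie
      · exact htail i (by omega) hik.le (hie ▸ Sym2.mem_mk_left _ _)
    · exact hav i hik (Finset.mem_erase.2 ⟨hie, hm⟩)
  set V₁ := rem B V with hV₁
  have h₁ : Wit (oe κ V₁ p) V₁ p n 0 k l x := hBin.wit_rem hp hV h hav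
  have heV : V₁ e = V e := rem_of_notMem heB
  have hmop : ∀ f, IsNNEdge f → Function.update V₁ e p f ≤ p →
      (mop κ (Function.update V₁ e p) f ↔ mop κ V₁ f) := by
    intro f hf hfp
    refine mop_update (hV.rem B) ?_ he (heV.le.trans hep) ?_ ?_ hf hfp
    · intro a b ha hb hap hab
      have haB : a ∉ B := notMem_of_rem_le hp hap
      have hbB : b ∉ B := notMem_of_rem_le hp (hab ▸ hap)
      rw [rem_of_notMem haB, rem_of_notMem hbB] at hab
      rw [rem_of_notMem haB] at hap
      exact hinj a b ha hb hap hab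
    · obtain ⟨i, hi, rfl⟩ := hex
      exact (h₁.head i hi).2.2
    · intro g hg hlt hgp
      have hgn := (mem_lnb.1 hg).2.1
      rw [hBin.mop_rem hp hV hgn hgp]
      by_contra hm
      have hgB : g ∉ B := notMem_of_rem_le hp hgp
      rw [rem_of_notMem hgB] at hlt hgp
      rw [rem_of_notMem heB] at hlt
      refine hgB (Finset.mem_erase.2 ⟨?_, mem_kset hg hlt hgp hm⟩)
      rintro rfl
      exact lt_irrefl _ hlt
  refine ⟨k, l, x, h₁.congr (fun i hi ho => ?_) fun i hi hik => ?_⟩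
  · have : Function.update V₁ e p s(x i, x (i + 1)) ≤ p := by
      by_cases hie : s(x i, x (i + 1)) = e
      · rw [hie, Function.update_self]
      · rw [Function.update_of_ne hie]; exact ho.2.1
    exact ⟨ho.1, this, (hmop _ ho.1 this).2 ho.2.2⟩
  · refine Function.update_of_ne ?_ _ _
    rintro hie
    exact htail i hi hik.le (hie ▸ Sym2.mem_mk_left _ _)

end

section
open scoped Classical
variable {d : ℕ} {κ : ℕ} {U V : Config d} {p : ℝ}

/-- Edges near the vertices `y 0, …, y r`. -/
noncomputable def nearV (r : ℕ) (y : ℕ → Vertex d) : Finset (Edge d) :=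
  (Finset.range (r + 1)).biUnion fun i => (star (y i)).biUnion lnb

lemma card_nearV_le (r : ℕ) (y : ℕ → Vertex d) :
    (nearV r y).card ≤ (r + 1) * (2 * d * (4 * d)) := by
  refine (Finset.card_biUnion_le_card_mul _ _ (2 * d * (4 * d)) fun i _ => ?_).trans (by simp)
  exact (Finset.card_biUnion_le_card_mul _ _ _ fun e _ => card_lnb_le e).trans
    (Nat.mul_le_mul_right _ (card_star_le _))

/-- The path `y 0, …, y r = 0` is joined to the sphere of radius `n` by an open path ending at
`y 0`, and the last edge of this path is the only edge touching `y 0, …, y r` that has arrived. -/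
structure HeadCut (κ : ℕ) (U : Config d) (p : ℝ) (n r : ℕ) (y : ℕ → Vertex d) (s : ℕ)
    (x : ℕ → Vertex d) : Prop where
  pos : 1 ≤ r
  path : IsPathOn r y
  inside : ∀ i, 1 ≤ i → i ≤ r → norm1 (y i) < n
  fin : y r = 0
  xpath : IsPathOn s x
  xstart : norm1 (x 0) = n
  xinside : ∀ i, 1 ≤ i → i ≤ s → norm1 (x i) < n
  join : x s = y 0
  disj : ∀ i < s, ∀ j ≤ r, x i ≠ y j
  xopen : ∀ i < s, oe κ U p s(x i, x (i + 1))
  only : ∀ j ≤ r, ∀ f, IsNNEdge f → y j ∈ f → U f ≤ p → 1 ≤ s ∧ j = 0 ∧ f = s(x (s - 1), x s)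

lemma Wit.headCut (hp : p < 2) (hV : Wf V) {n k l : ℕ} (hn : 1 ≤ n) {x : ℕ → Vertex d}
    (h : Wit (oe κ V p) V p n 0 k l x) {s : ℕ} (hs : s = l - 1) :
    ∃ W ⊆ nearV (k - s) (fun i => x (s + i)),
      (∀ i < k - s, s(x (s + i), x (s + i + 1)) ∈ W) ∧
      HeadCut κ (rem W V) p n (k - s) (fun i => x (s + i)) s x := by
  have hk : 1 ≤ k := by
    by_contra hk
    have hk0 : k = 0 := by omega
    have h1 := h.start
    have h2 := h.fin
    rw [hk0] at h2
    rw [h2] at h1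
    simp [norm1] at h1
    omega
  have hle := h.le
  have hsk : s < k := by omega
  set Inc : Edge d → Prop := fun f => ∃ j ≤ k - s, x (s + j) ∈ f with hInc
  set Kp : Edge d → Prop := fun f => 1 ≤ s ∧ f = s(x (s - 1), x s) with hKp
  set W := (nearV (k - s) (fun i => x (s + i))).filter fun f => ¬ Kp f ∧ (Inc f ∨ ¬ mop κ V f)
    with hW
  have hmemW : ∀ f g, IsNNEdge g → Inc g → f ∈ lnb g → ¬ Kp f → (Inc f ∨ ¬ mop κ V f) → f ∈ W := by
    rintro f g hg ⟨j, hj, hjg⟩ hf h1 h2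
    refine Finset.mem_filter.2 ⟨?_, h1, h2⟩
    simp only [nearV, Finset.mem_biUnion, Finset.mem_range]
    exact ⟨j, by omega, g, mem_star.2 ⟨hg, hjg⟩, hf⟩
  have hmemW' : ∀ f, IsNNEdge f → Inc f → ¬ Kp f → f ∈ W := fun f hf hi hk =>
    hmemW f f hf hi (self_mem_lnb hf) hk (Or.inl hi)
  have hinert : Inert κ V p W := by
    intro t htW htn htp ht g hg hgt hlt hgm
    have hg' := (Finset.mem_filter.1 hg).2
    have hgi : Inc g := by tauto
    have hkp : Kp t := by
      by_contra hkp
      exact htW (hmemW t g hgt.1 hgi hgt.mem_lnb hkp (Or.inr ht))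
    apply ht
    rw [hkp.2]
    have := (h.head (s - 1) (by omega)).2.2
    have hs1 := hkp.1
    rwa [Nat.sub_add_cancel hs1] at this
  have hdist : ∀ i ≤ k, ∀ j ≤ k, x i = x j → i = j := h.path.2
  have hedge : ∀ i < k - s, s(x (s + i), x (s + i + 1)) ∈ W := by
    intro i hi
    refine hmemW' _ (h.nn (by omega)) ⟨i, by omega, Sym2.mem_mk_left _ _⟩ ?_
    rintro ⟨h1, h2⟩
    have : x (s + i + 1) ∈ s(x (s - 1), x s) := h2 ▸ Sym2.mem_mk_right _ _
    rcases Sym2.mem_iff.1 this with h3 | h3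
    · have := hdist _ (by omega) _ (by omega) h3; omega
    · have := hdist _ (by omega) _ (by omega) h3; omega
  refine ⟨W, Finset.filter_subset _ _, hedge, ?_⟩
  constructor
  · omega
  · refine ⟨fun i hi => ?_, fun i hi j hj hij => ?_⟩
    · exact h.path.1 (s + i) (by omega)
    · have := hdist _ (by omega) _ (by omega) hij; omega
  · intro i hi hik
    simpa using h.inside (s + i) (by omega) (by omega)
  · simpa [Nat.add_sub_cancel' hsk.le] using h.fin
  · exact ⟨fun i hi => h.path.1 i (by omega), fun i hi j hj => hdist i (by omega) j (by omega)⟩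
  · simpa using h.start
  · intro i hi his
    simpa using h.inside i hi (by omega)
  · rfl
  · intro i hi j hj hij
    have := hdist _ (by omega) _ (by omega) hij; omega
  · intro i hi
    have ho := h.head i (by omega)
    refine hinert.oe_rem hp hV (fun hm => ?_) ho
    obtain ⟨h1, h2⟩ := (Finset.mem_filter.1 hm).2
    rcases h2 with ⟨j, hj, hji⟩ | h2
    · rcases Sym2.mem_iff.1 hji with h3 | h3
      · have := hdist _ (by omega) _ (by omega) h3; omega
      · have := hdist _ (by omega) _ (by omega) h3
        have hs' : i = s - 1 := by omega
        refine h1 ⟨by omega, ?_⟩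
        rw [hs', Nat.sub_add_cancel (by omega)]
    · exact h2 ho.2.2
  · intro j hj f hf hjf hfp
    have hfW := notMem_of_rem_le hp hfp
    have hK : Kp f := by
      by_contra hK
      exact hfW (hmemW' f hf ⟨j, hj, hjf⟩ hK)
    refine ⟨hK.1, ?_, hK.2⟩
    have hjf' : x (s + j) ∈ s(x (s - 1), x s) := hK.2 ▸ hjf
    have hs1 := hK.1
    rcases Sym2.mem_iff.1 hjf' with h3 | h3
    · have := hdist _ (by omega) _ (by omega) h3; omega
    · have := hdist _ (by omega) _ (by omega) h3; omega

/-- The edges of the path `y 0, …, y r`. -/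
def pathEdges (r : ℕ) (y : ℕ → Vertex d) : Finset (Edge d) :=
  (Finset.range r).image fun i => s(y i, y (i + 1))

lemma mem_pathEdges {r : ℕ} {y : ℕ → Vertex d} {f : Edge d} :
    f ∈ pathEdges r y ↔ ∃ i < r, s(y i, y (i + 1)) = f := by
  simp [pathEdges]

lemma HeadCut.thet (hκ : 2 ≤ κ) (hp : p < 2) (hU : Wf U) {n r s : ℕ} {y x : ℕ → Vertex d}
    {K : Finset (Edge d)} (h : HeadCut κ (rem K U) p n r y s x)
    (hQ : ∀ f ∈ pathEdges r y, U f ≤ p)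
    (hK : ∀ f ∈ K, f ∉ pathEdges r y → p < U f) :
    Thet κ U p n := by
  set Q := pathEdges r y with hQdef
  set V := rem K U with hV
  have hVw : Wf V := hU.rem K
  have hdist := h.path.2
  have hinc : ∀ f ∈ Q, ∀ v ∈ f, ∃ j ≤ r, v = y j := by
    intro f hf v hv
    obtain ⟨i, hi, rfl⟩ := mem_pathEdges.1 hf
    rcases Sym2.mem_iff.1 hv with rfl | rfl
    · exact ⟨i, by omega, rfl⟩
    · exact ⟨i + 1, by omega, rfl⟩
  have hle : ∀ f, U f ≤ p → f ∈ Q ∨ (f ∉ K ∧ V f = U f) := by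
    intro f hf
    by_cases hfQ : f ∈ Q
    · exact Or.inl hfQ
    · have : f ∉ K := fun hfK => absurd (hK f hfK hfQ) (not_lt.2 hf)
      exact Or.inr ⟨this, rem_of_notMem this⟩
  have htwo : ∀ j ≤ r, ∀ g, IsNNEdge g → y j ∈ g → U g ≤ p →
      g = s(y j, y (j + 1)) ∨ g = (if j = 0 then s(x (s - 1), x s) else s(y (j - 1), y j)) := by
    intro j hj g hg hjg hgp
    rcases hle g hgp with hgQ | ⟨hgK, hVg⟩
    · obtain ⟨i, hi, rfl⟩ := mem_pathEdges.1 hgQ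
      rcases Sym2.mem_iff.1 hjg with h1 | h1
      · have := hdist _ hj _ (by omega) h1
        subst this
        exact Or.inl rfl
      · have := hdist _ hj _ (by omega) h1
        subst this
        exact Or.inr (by simp)
    · obtain ⟨-, hj0, hgs⟩ := h.only j hj g hg hjg (hVg ▸ hgp)
      subst hj0
      exact Or.inr (by simpa using hgs)
  have hsmall : ∀ j ≤ r, ∀ f, IsNNEdge f → y j ∈ f → U f ≤ p → ∀ A : Set (Edge d),
      (∀ g ∈ A, IsNNEdge g ∧ y j ∈ g ∧ g ≠ f ∧ U g < U f) → A.ncard < κ := by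
    intro j hj f hf hjf hfp A hA
    have hone : ∃ c, A ⊆ {c} := by
      rcases htwo j hj f hf hjf hfp with hf1 | hf1
      · refine ⟨if j = 0 then s(x (s - 1), x s) else s(y (j - 1), y j), fun g hg => ?_⟩
        obtain ⟨h1, h2, h3, h4⟩ := hA g hg
        rcases htwo j hj g h1 h2 (h4.le.trans hfp) with hg1 | hg1
        · exact absurd (hg1.trans hf1.symm) h3
        · exact hg1
      · refine ⟨s(y j, y (j + 1)), fun g hg => ?_⟩
        obtain ⟨h1, h2, h3, h4⟩ := hA g hg
        rcases htwo j hj g h1 h2 (h4.le.trans hfp) with hg1 | hg1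
        · exact hg1
        · exact absurd (hg1.trans hf1.symm) h3
    obtain ⟨c, hc⟩ := hone
    have := Set.ncard_le_ncard hc (Set.finite_singleton c)
    rw [Set.ncard_singleton] at this
    omega
  have hmop : ∀ f, U f ≤ p → IsNNEdge f → (mop κ U f ↔ (f ∈ Q ∨ mop κ V f)) := by
    intro f hfp hf
    refine mop_eq_of_closed hU {f | U f ≤ p} (fun a ha b _ hb => hb.le.trans ha)
      (fun f => f ∈ Q ∨ mop κ V f) ?_ f hfp hf
    clear f hfp hf
    intro f hfp hf
    have hfp : U f ≤ p := hfp
    by_cases hfQ : f ∈ Q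
    · refine iff_of_true (Or.inl hfQ) fun v hv => ?_
      obtain ⟨j, hj, rfl⟩ := hinc f hfQ v hv
      exact hsmall j hj f hf hv hfp _ fun g hg => ⟨hg.1, hg.2.1, hg.2.2.1, hg.2.2.2.1⟩
    · have hVf : f ∉ K ∧ V f = U f := (hle f hfp).resolve_left hfQ
      simp only [hfQ, false_or]
      rw [mop_iff hVw f hf]
      refine forall₂_congr fun v hv => ?_
      have hVU : ∀ g, V g < V f → U g < U f := by
        intro g hg
        have : g ∉ K := notMem_of_rem_le hp (hg.le.trans (hVf.2.le.trans hfp))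
        rwa [hVf.2, hV, rem_of_notMem this] at hg
      by_cases hvY : ∃ j ≤ r, v = y j
      · obtain ⟨j, hj, rfl⟩ := hvY
        exact iff_of_true
          (hsmall j hj f hf hv hfp _ fun g hg => ⟨hg.1, hg.2.1, hg.2.2.1, hVU g hg.2.2.2.1⟩)
          (hsmall j hj f hf hv hfp _ fun g hg => ⟨hg.1, hg.2.1, hg.2.2.1, hg.2.2.2.1⟩)
      · have : {g | IsNNEdge g ∧ v ∈ g ∧ g ≠ f ∧ V g < V f ∧ mop κ V g} =
            {g | IsNNEdge g ∧ v ∈ g ∧ g ≠ f ∧ U g < U f ∧ (g ∈ Q ∨ mop κ V g)} := by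
          ext g
          constructor
          · rintro ⟨h1, h2, h3, h4, h5⟩
            exact ⟨h1, h2, h3, hVU g h4, Or.inr h5⟩
          · rintro ⟨h1, h2, h3, h4, h5⟩
            have hgQ : g ∉ Q := fun hgQ => hvY (hinc g hgQ v h2)
            have hVg := ((hle g (h4.le.trans hfp)).resolve_left hgQ).2
            exact ⟨h1, h2, h3, by rwa [hVg, hVf.2], h5.resolve_left hgQ⟩
        rw [this]
  have hxo : ∀ i < s, oe κ U p s(x i, x (i + 1)) := by
    intro i hi
    obtain ⟨h1, h2, h3⟩ := h.xopen i hi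
    have hk := notMem_of_rem_le hp h2
    rw [hV, rem_of_notMem hk] at h2
    exact ⟨h1, h2, (hmop _ h2 h1).2 (Or.inr h3)⟩
  have hyo : ∀ i < r, oe κ U p s(y i, y (i + 1)) := by
    intro i hi
    have hm : s(y i, y (i + 1)) ∈ Q := mem_pathEdges.2 ⟨i, hi, rfl⟩
    have hnn := isNNEdge_mk.2 (h.path.1 i hi)
    exact ⟨hnn, hQ _ hm, (hmop _ (hQ _ hm) hnn).2 (Or.inl hm)⟩
  set z : ℕ → Vertex d := fun i => if i ≤ s then x i else y (i - s) with hz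
  have hzx : ∀ i ≤ s, z i = x i := fun i hi => if_pos hi
  have hzy : ∀ i, s ≤ i → z i = y (i - s) := by
    intro i hi
    rcases hi.eq_or_lt with rfl | hi
    · rw [hzx _ le_rfl, h.join, Nat.sub_self]
    · exact if_neg (by omega)
  have hzo : ∀ i < s + r, oe κ U p s(z i, z (i + 1)) := by
    intro i hi
    by_cases his : i < s
    · rw [hzx i (by omega), hzx (i + 1) (by omega)]
      exact hxo i his
    · rw [hzy i (by omega), hzy (i + 1) (by omega), Nat.sub_add_comm (by omega)]
      exact hyo (i - s) (by omega)
  refine ⟨s + r, z, ⟨⟨fun i hi => isNNEdge_mk.1 (hzo i hi).1, ?_⟩, ?_, ?_, ?_, le_rfl, hzo, ?_, ?_⟩⟩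
  · intro i hi j hj hij
    rcases lt_or_ge i s with his | his <;> rcases lt_or_ge j s with hjs | hjs
    · rw [hzx i his.le, hzx j hjs.le] at hij
      exact h.xpath.2 i his.le j hjs.le hij
    · rw [hzx i his.le, hzy j hjs] at hij
      exact absurd hij (h.disj i his _ (by omega))
    · rw [hzx j hjs.le, hzy i his] at hij
      exact absurd hij.symm (h.disj j hjs _ (by omega))
    · rw [hzy i his, hzy j hjs] at hij
      have := hdist _ (by omega) _ (by omega) hij
      omega
  · rw [hzx 0 (by omega), sub_zero, h.xstart]
  · intro i hi hik
    rw [sub_zero]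
    by_cases his : i ≤ s
    · rw [hzx i his]
      exact h.xinside i hi his
    · rw [hzy i (by omega)]
      exact h.inside _ (by omega) (by omega)
  · rw [hzy _ (by omega), Nat.add_sub_cancel_left, h.fin]
  · intro i h1 h2
    omega
  · intro i h1 h2
    omega

lemma HeadCut.piv (hκ : 2 ≤ κ) (hp : p < 2) (hU : Wf U) {n r s : ℕ} {y x : ℕ → Vertex d}
    {K : Finset (Edge d)} (h : HeadCut κ (rem K U) p n r y s x) (hQK : pathEdges r y ⊆ K)
    (hQ : ∀ f ∈ pathEdges r y, U f ≤ p) (hK : ∀ f ∈ K, f ∉ pathEdges r y → p < U f) :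
    Piv κ p n s(y 0, y 1) U := by
  have hq : s(y 0, y 1) ∈ pathEdges r y := mem_pathEdges.2 ⟨0, h.pos, rfl⟩
  constructor
  · have hr : rem K (Function.update U s(y 0, y 1) p) = rem K U := by
      ext e
      by_cases he : e ∈ K
      · rw [rem_of_mem he, rem_of_mem he]
      · rw [rem_of_notMem he, rem_of_notMem he, Function.update_of_ne]
        rintro rfl
        exact he (hQK hq)
    refine (HeadCut.thet hκ hp (hU.update _ _) (by rwa [hr]) ?_ ?_).arm
    · intro f hf
      by_cases hfq : f = s(y 0, y 1)
      · rw [hfq, Function.update_self]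
      · rw [Function.update_of_ne hfq]; exact hQ f hf
    · intro f hf hfQ
      have hne : f ≠ s(y 0, y 1) := by
        rintro rfl
        exact hfQ hq
      rw [Function.update_of_ne hne]
      exact hK f hf hfQ
  · rintro ⟨k, l, z, hz⟩
    have key : ∀ i ≤ k, ∃ j, 1 ≤ j ∧ j ≤ r ∧ z (k - i) = y j := by
      intro i
      induction i with
      | zero => exact fun _ => ⟨r, h.pos, le_rfl, by rw [Nat.sub_zero, hz.fin, h.fin]⟩
      | succ i ih =>
        intro hi
        obtain ⟨j, hj1, hj, hzj⟩ := ih (by omega)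
        have hlt : k - (i + 1) < k := by omega
        have hsucc : k - (i + 1) + 1 = k - i := by omega
        have hle := hz.le_p hlt
        have hnn := hz.nn hlt
        rw [hsucc] at hle hnn
        have hnq := notMem_of_rem_le hp hle
        rw [rem_of_notMem hnq] at hle
        rw [Finset.mem_singleton] at hnq
        set f := s(z (k - (i + 1)), z (k - i)) with hf
        have hjf : y j ∈ f := hzj ▸ Sym2.mem_mk_right _ _
        by_cases hfK : f ∈ K
        · have hfQ : f ∈ pathEdges r y := by
            by_contra hfQ
            exact absurd (hK f hfK hfQ) (not_lt.2 hle)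
          obtain ⟨a, ha, haf⟩ := mem_pathEdges.1 hfQ
          have ha0 : 1 ≤ a := by
            by_contra ha0
            have : a = 0 := by omega
            subst this
            exact hnq haf.symm
          have hm : z (k - (i + 1)) ∈ s(y a, y (a + 1)) := haf ▸ Sym2.mem_mk_left _ _
          rcases Sym2.mem_iff.1 hm with h1 | h1
          · exact ⟨a, ha0, ha.le, h1⟩
          · exact ⟨a + 1, by omega, ha, h1⟩
        · have := (h.only j hj f hnn hjf (by rwa [rem_of_notMem hfK])).2.1
          omega
    obtain ⟨j, hj1, hj, hzj⟩ := key k le_rfl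
    have h1 := hz.start
    have h2 := h.inside j hj1 hj
    rw [Nat.sub_self] at hzj
    rw [sub_zero, hzj] at h1
    omega

end

section
open scoped Classical
variable {d : ℕ} {κ : ℕ} {p : ℝ}

instance : Countable (Edge d) := by unfold Edge Sym2; infer_instance

lemma measurable_label_lt (f g : Edge d) : Measurable fun U : Config d => U f < U g :=
  measurableSet_setOfPred.1 (measurableSet_lt (measurable_pi_apply f) (measurable_pi_apply g))

lemma measurable_label_le (f : Edge d) (a : ℝ) : Measurable fun U : Config d => U f ≤ a :=
  measurableSet_setOfPred.1 (measurableSet_le (measurable_pi_apply f) measurable_const)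

lemma measurable_lt_label (f : Edge d) (a : ℝ) : Measurable fun U : Config d => a < U f :=
  measurableSet_setOfPred.1 (measurableSet_lt measurable_const (measurable_pi_apply f))

lemma measurable_ncard_lt {α ι : Type*} [MeasurableSpace α] (S : Finset ι) (A : α → ι → Prop)
    (hA : ∀ i, Measurable fun a => A a i) (hS : ∀ a i, A a i → i ∈ S) :
    Measurable fun a => Set.ncard {i | A a i} < κ := by
  have : (fun a => Set.ncard {i | A a i} < κ) =
      fun a => ∃ T : Finset S, T.card < κ ∧ ∀ i : S, (A a i ↔ i ∈ T) := by
    ext a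
    have hfin : {i | A a i}.Finite := S.finite_toSet.subset fun i hi => hS a i hi
    constructor
    · intro h
      refine ⟨S.attach.filter fun i => A a i, ?_, by simp⟩
      refine lt_of_le_of_lt ?_ h
      rw [← Set.ncard_coe_finset]
      refine Set.ncard_le_ncard_of_injOn (fun i => (i : ι)) ?_ Subtype.val_injective.injOn hfin
      intro i hi
      simpa using hi
    · rintro ⟨T, hT, h⟩
      refine lt_of_le_of_lt ?_ hT
      rw [← Set.ncard_coe_finset, ← Set.ncard_image_of_injective _ Subtype.val_injective]
      refine Set.ncard_le_ncard (fun i hi => ?_) (T.finite_toSet.image _)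
      exact ⟨⟨i, hS a i hi⟩, (h ⟨i, hS a i hi⟩).1 hi, rfl⟩
  rw [this]
  fun_prop

lemma measurable_opm (m : ℕ) (e : Edge d) :
    Measurable fun U : Config d => opm κ (fun f g => U f < U g) m e := by
  induction m generalizing e with
  | zero => simp only [opm]; exact measurable_const
  | succ m ih =>
    simp only [opm]
    refine Measurable.forall fun v => Measurable.imp measurable_const ?_
    have key : ∀ f : Edge d, Measurable fun U : Config d => (IsNNEdge f ∧ v ∈ f ∧ f ≠ e ∧
        U f < U e ∧ opm κ (fun f g => U f < U g) m f) := fun f =>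
      measurable_const.and (measurable_const.and (measurable_const.and
        ((measurable_label_lt f e).and (ih f))))
    exact measurable_ncard_lt (star v) _ key fun U f h => mem_star.2 ⟨h.1, h.2.1⟩

lemma measurable_mop (e : Edge d) : Measurable fun U : Config d => mop κ U e := by
  unfold mop
  have := fun m => measurable_opm (κ := κ) m e
  fun_prop

lemma measurable_oe (e : Edge d) : Measurable fun U : Config d => oe κ U p e := by
  unfold oe
  have := measurable_mop (κ := κ) e
  have := measurable_label_le e p
  fun_prop

lemma measurable_exists_path {α β : Type*} [MeasurableSpace α] [Countable β]
    (Q : α → (ℕ → β) → Prop) (k : ℕ) (hQ : ∀ x, Measurable fun a => Q a x)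
    (hloc : ∀ a x x', (∀ i ≤ k, x i = x' i) → Q a x → Q a x') :
    Measurable fun a => ∃ x, Q a x := by
  have : (fun a => ∃ x, Q a x) =
      fun a => ∃ w : Fin (k + 1) → β, Q a (fun i => w (Fin.ofNat (k + 1) i)) := by
    ext a
    constructor
    · rintro ⟨x, hx⟩
      refine ⟨fun i => x i, hloc a x _ (fun i hi => ?_) hx⟩
      simp [Fin.ofNat, Nat.mod_eq_of_lt (Nat.lt_succ_of_le hi)]
    · rintro ⟨w, hw⟩
      exact ⟨_, hw⟩
  rw [this]
  exact Measurable.exists fun w => hQ _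

lemma isPathOn_congr {k : ℕ} {x x' : ℕ → Vertex d} (h : ∀ i ≤ k, x i = x' i) (hx : IsPathOn k x) :
    IsPathOn k x' := by
  refine ⟨fun i hi => ?_, fun i hi j hj hij => ?_⟩
  · rw [← h i hi.le, ← h (i + 1) hi]; exact hx.1 i hi
  · rw [← h i hi, ← h j hj] at hij; exact hx.2 i hi j hj hij

lemma Wit.congr_path {O : Edge d → Prop} {U : Config d} {n : ℕ} {c : Vertex d} {k l : ℕ}
    {x x' : ℕ → Vertex d} (h : Wit O U p n c k l x) (hx : ∀ i ≤ k, x i = x' i) :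
    Wit O U p n c k l x' where
  path := isPathOn_congr hx h.path
  start := by rw [← hx 0 (by omega)]; exact h.start
  inside i h1 h2 := by rw [← hx i h2]; exact h.inside i h1 h2
  fin := by rw [← hx k le_rfl]; exact h.fin
  le := h.le
  head i hi := by
    have := h.le
    rw [← hx i (by omega), ← hx (i + 1) (by omega)]; exact h.head i hi
  tail_le i h1 h2 := by
    rw [← hx i (by omega), ← hx (i + 1) (by omega)]; exact h.tail_le i h1 h2
  tail_lt i h1 h2 := by
    rw [← hx i (by omega), ← hx (i + 1) (by omega), ← hx (i + 2) (by omega)]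
    exact h.tail_lt i h1 h2

lemma measurable_wit (n : ℕ) (c : Vertex d) (k l : ℕ) (x : ℕ → Vertex d) :
    Measurable fun U : Config d => Wit (oe κ U p) U p n c k l x := by
  have : (fun U : Config d => Wit (oe κ U p) U p n c k l x) = fun U =>
      IsPathOn k x ∧ norm1 (x 0 - c) = n ∧ (∀ i, 1 ≤ i → i ≤ k → norm1 (x i - c) < n) ∧ x k = c ∧
      l ≤ k ∧ (∀ i < l, oe κ U p s(x i, x (i + 1))) ∧
      (∀ i, l ≤ i → i < k → U s(x i, x (i + 1)) ≤ p) ∧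
      (∀ i, l ≤ i → i + 1 < k → U s(x (i + 1), x (i + 2)) < U s(x i, x (i + 1))) := by
    ext U
    exact ⟨fun ⟨a, b, c, d, e, f, g, h⟩ => ⟨a, b, c, d, e, f, g, h⟩,
      fun ⟨a, b, c, d, e, f, g, h⟩ => ⟨a, b, c, d, e, f, g, h⟩⟩
  rw [this]
  have := measurable_oe (d := d) (κ := κ) (p := p)
  have := measurable_label_le (d := d)
  have := measurable_label_lt (d := d)
  fun_prop

lemma measurable_arm (n : ℕ) (c : Vertex d) : Measurable fun U : Config d => Arm κ U p n c := by
  unfold Arm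
  refine Measurable.exists fun k => Measurable.exists fun l => ?_
  exact measurable_exists_path _ k (fun x => measurable_wit n c k l x)
    fun U x x' hx h => h.congr_path hx

lemma measurable_thet (n : ℕ) : Measurable fun U : Config d => Thet κ U p n := by
  unfold Thet
  refine Measurable.exists fun k => ?_
  exact measurable_exists_path _ k (fun x => measurable_wit n 0 k k x)
    fun U x x' hx h => h.congr_path hx

lemma measurable_rem (K : Finset (Edge d)) : Measurable (rem K) := by
  refine measurable_pi_lambda _ fun e => ?_
  unfold rem
  split_ifs
  · exact measurable_const
  · exact measurable_pi_apply e

lemma measurable_update_label (f : Edge d) (a : ℝ) :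
    Measurable fun U : Config d => Function.update U f a := by
  refine measurable_pi_lambda _ fun e => ?_
  by_cases he : e = f
  · subst he; simp
  · simp only [Function.update_of_ne he]; exact measurable_pi_apply e

lemma measurable_piv (n : ℕ) (f : Edge d) : Measurable (Piv κ p n f) := by
  unfold Piv
  have h := measurable_arm (d := d) (κ := κ) (p := p) n 0
  exact (h.comp (measurable_update_label f p)).and (h.comp (measurable_rem {f})).not

lemma headCut_iff {U : Config d} {n r s : ℕ} {y x : ℕ → Vertex d} :
    HeadCut κ U p n r y s x ↔ 1 ≤ r ∧ IsPathOn r y ∧ (∀ i, 1 ≤ i → i ≤ r → norm1 (y i) < n) ∧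
      y r = 0 ∧ IsPathOn s x ∧ norm1 (x 0) = n ∧ (∀ i, 1 ≤ i → i ≤ s → norm1 (x i) < n) ∧
      x s = y 0 ∧ (∀ i < s, ∀ j ≤ r, x i ≠ y j) ∧ (∀ i < s, oe κ U p s(x i, x (i + 1))) ∧
      ∀ j ≤ r, ∀ f, IsNNEdge f → y j ∈ f → U f ≤ p → 1 ≤ s ∧ j = 0 ∧ f = s(x (s - 1), x s) :=
  ⟨fun ⟨a, b, c, d, e, f, g, h, i, j, k⟩ => ⟨a, b, c, d, e, f, g, h, i, j, k⟩,
    fun ⟨a, b, c, d, e, f, g, h, i, j, k⟩ => ⟨a, b, c, d, e, f, g, h, i, j, k⟩⟩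

lemma HeadCut.congr_path {U : Config d} {n r s : ℕ} {y x y' x' : ℕ → Vertex d}
    (h : HeadCut κ U p n r y s x) (hy : ∀ i ≤ r, y i = y' i) (hx : ∀ i ≤ s, x i = x' i) :
    HeadCut κ U p n r y' s x' where
  pos := h.pos
  path := isPathOn_congr hy h.path
  inside i h1 h2 := by rw [← hy i h2]; exact h.inside i h1 h2
  fin := by rw [← hy r le_rfl]; exact h.fin
  xpath := isPathOn_congr hx h.xpath
  xstart := by rw [← hx 0 (by omega)]; exact h.xstart
  xinside i h1 h2 := by rw [← hx i h2]; exact h.xinside i h1 h2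
  join := by rw [← hx s le_rfl, ← hy 0 (by omega)]; exact h.join
  disj i hi j hj := by rw [← hx i hi.le, ← hy j hj]; exact h.disj i hi j hj
  xopen i hi := by rw [← hx i hi.le, ← hx (i + 1) hi]; exact h.xopen i hi
  only j hj := by
    rw [← hy j hj, ← hx s le_rfl, ← hx (s - 1) (by omega)]
    exact h.only j hj

lemma measurable_headCut (n r : ℕ) (y : ℕ → Vertex d) :
    Measurable fun U : Config d => ∃ s x, HeadCut κ U p n r y s x := by
  refine Measurable.exists fun s => ?_
  refine measurable_exists_path _ s (fun x => ?_) fun U x x' hx h =>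
    h.congr_path (fun _ _ => rfl) hx
  simp only [headCut_iff]
  have := measurable_oe (d := d) (κ := κ) (p := p)
  have := measurable_label_le (d := d)
  fun_prop

end

section
open scoped Classical ENNReal
variable {d : ℕ} {κ : ℕ} {p : ℝ} {P : Measure (Config d)}

/-- The uniform law on `[0, 1]`. -/
noncomputable def unif : Measure ℝ := volume.restrict (Set.Icc 0 1)

instance : IsProbabilityMeasure unif := ⟨by simp [unif]⟩

lemma IsProductUniform.cyl (hP : IsProductUniform P) (s : Finset (Edge d)) (t : Edge d → Set ℝ)
    (ht : ∀ e, MeasurableSet (t e)) : P {U | ∀ e ∈ s, U e ∈ t e} = ∏ e ∈ s, unif (t e) := by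
  rw [hP.2 s t fun e _ => ht e]
  exact Finset.prod_congr rfl fun e _ => (Measure.restrict_apply (ht e)).symm

lemma IsProductUniform.map_eq (hP : IsProductUniform P) {α : Type*} [MeasurableSpace α]
    {ν : Measure α} {T : α → Config d} (hT : Measurable T)
    (h : ∀ (s : Finset (Edge d)) (t : Edge d → Set ℝ), (∀ e, MeasurableSet (t e)) →
      ν {a | ∀ e ∈ s, T a e ∈ t e} = ∏ e ∈ s, unif (t e)) : ν.map T = P := by
  have h1 : P = Measure.infinitePi fun _ : Edge d => unif :=
    Measure.eq_infinitePi _ fun s t ht => hP.cyl s t ht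
  rw [h1]
  refine Measure.eq_infinitePi _ fun s t ht => ?_
  rw [Measure.map_apply hT (MeasurableSet.pi s.countable_toSet fun i _ => ht i), ← h s t ht]
  rfl

lemma measurable_comp_perm (π : Equiv.Perm (Edge d)) : Measurable fun (U : Config d) e => U (π e) :=
  measurable_pi_lambda _ fun e => measurable_pi_apply (π e)

lemma IsProductUniform.map_perm (hP : IsProductUniform P) (π : Equiv.Perm (Edge d)) :
    P.map (fun U e => U (π e)) = P := by
  refine hP.map_eq (measurable_comp_perm π) fun s t ht => ?_
  have := hP.cyl (s.map π.toEmbedding) (fun e => t (π.symm e)) fun e => ht _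
  rw [Finset.prod_map] at this
  simpa only [Finset.forall_mem_map, Equiv.coe_toEmbedding, Equiv.symm_apply_apply] using this

/-- The configuration equal to `Y` on `R` and to `X` off `R`. -/
noncomputable def hyb (R : Set (Edge d)) (X Y : Config d) : Config d :=
  fun e => if e ∈ R then Y e else X e

lemma hyb_of_mem {R : Set (Edge d)} {X Y : Config d} {e : Edge d} (h : e ∈ R) :
    hyb R X Y e = Y e := if_pos h

lemma hyb_of_notMem {R : Set (Edge d)} {X Y : Config d} {e : Edge d} (h : e ∉ R) :
    hyb R X Y e = X e := if_neg h

lemma measurable_hyb (R : Set (Edge d)) :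
    Measurable fun q : Config d × Config d => hyb R q.1 q.2 := by
  refine measurable_pi_lambda _ fun e => ?_
  unfold hyb
  split_ifs
  · exact (measurable_pi_apply e).comp measurable_snd
  · exact (measurable_pi_apply e).comp measurable_fst

lemma IsProductUniform.map_hyb (hP : IsProductUniform P) (R : Set (Edge d)) :
    (P.prod P).map (fun q => hyb R q.1 q.2) = P := by
  have := hP.1
  refine hP.map_eq (measurable_hyb R) fun s t ht => ?_
  have : {q : Config d × Config d | ∀ e ∈ s, hyb R q.1 q.2 e ∈ t e} =
      {U | ∀ e ∈ s.filter (· ∉ R), U e ∈ t e} ×ˢ {U | ∀ e ∈ s.filter (· ∈ R), U e ∈ t e} := by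
    ext ⟨X, Y⟩
    simp only [Set.mem_ofPred_eq, Set.mem_prod, Finset.mem_filter, hyb]
    constructor
    · intro h
      refine ⟨fun e he => ?_, fun e he => ?_⟩
      · simpa [he.2] using h e he.1
      · simpa [he.2] using h e he.1
    · rintro ⟨h1, h2⟩ e he
      split_ifs with h
      · exact h2 e ⟨he, h⟩
      · exact h1 e ⟨he, h⟩
  rw [this, Measure.prod_prod, hP.cyl _ _ ht, hP.cyl _ _ ht, mul_comm]
  exact Finset.prod_filter_mul_prod_filter_not _ _ _

lemma IsProductUniform.prod_hyb (hP : IsProductUniform P) (R : Set (Edge d)) {A : Set (Config d)}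
    (hA : MeasurableSet A) : (P.prod P) {q | hyb R q.1 q.2 ∈ A} = P A := by
  conv_rhs => rw [← hP.map_hyb R]
  rw [Measure.map_apply (measurable_hyb R) hA]
  rfl

lemma IsProductUniform.indep (hP : IsProductUniform P) (R : Set (Edge d)) {A B : Set (Config d)}
    (hA : MeasurableSet A) (hB : MeasurableSet B)
    (hAR : ∀ U V : Config d, (∀ e ∈ R, U e = V e) → (U ∈ A ↔ V ∈ A))
    (hBR : ∀ U V : Config d, (∀ e, e ∉ R → U e = V e) → (U ∈ B ↔ V ∈ B)) :
    P (A ∩ B) = P A * P B := by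
  have := hP.1
  rw [← hP.prod_hyb R (hA.inter hB)]
  have : {q : Config d × Config d | hyb R q.1 q.2 ∈ A ∩ B} = B ×ˢ A := by
    ext ⟨X, Y⟩
    simp only [Set.mem_ofPred_eq, Set.mem_inter_iff, Set.mem_prod]
    rw [hAR (hyb R X Y) Y fun e he => hyb_of_mem he, hBR (hyb R X Y) X fun e he => hyb_of_notMem he,
      and_comm]
  rw [this, Measure.prod_prod, mul_comm]

/-- Resampling the edges of `R` makes any event independent of the initial labels on `R`. -/
lemma IsProductUniform.prod_indep (hP : IsProductUniform P) (R : Set (Edge d))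
    {A B : Set (Config d)} (hA : MeasurableSet A) (hB : MeasurableSet B)
    (hAR : ∀ U V : Config d, (∀ e ∈ R, U e = V e) → (U ∈ A ↔ V ∈ A)) :
    (P.prod P) {q | q.1 ∈ A ∧ hyb R q.1 q.2 ∈ B} = P A * P B := by
  have := hP.1
  have hm : MeasurableSet {q : Config d × Config d | hyb R q.1 q.2 ∈ B} := measurable_hyb R hB
  have hm' : MeasurableSet {q : Config d × Config d | q.1 ∈ A ∧ hyb R q.1 q.2 ∈ B} :=
    (measurable_fst hA).inter hm
  rw [Measure.prod_apply_symm hm', ← hP.prod_hyb R hB, Measure.prod_apply_symm hm,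
    ← lintegral_const_mul']
  · refine lintegral_congr fun Y => ?_
    refine hP.indep R hA (B := (fun X => (X, Y)) ⁻¹' {q | hyb R q.1 q.2 ∈ B})
      (measurable_prodMk_right hm) hAR fun U V h => ?_
    have : hyb R U Y = hyb R V Y := by
      ext e
      unfold hyb
      split_ifs with he
      · rfl
      · exact h e he
    simp only [Set.mem_preimage, Set.mem_ofPred_eq, this]
  · exact measure_ne_top _ _

lemma lt_of_consecutive {m : ℕ} {u : ℕ → ℝ} (h : ∀ i, i + 1 < m → u i < u (i + 1)) {i j : ℕ}
    (hij : i < j) (hj : j < m) : u i < u j := by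
  induction j with
  | zero => omega
  | succ j ih =>
    rcases Nat.lt_succ_iff_lt_or_eq.1 hij with h1 | rfl
    · exact (ih h1 (by omega)).trans (h j hj)
    · exact h i hj

/-- A prescribed order of arrival for `m` edges costs a factor `m!`, even jointly with an event
that does not involve these edges. -/
lemma IsProductUniform.mono_bound (hP : IsProductUniform P) (m : ℕ) (f : ℕ → Edge d)
    (K : Finset (Edge d)) (hf : ∀ i < m, f i ∈ K) {G : Set (Config d)} (hG : MeasurableSet G) :
    (m.factorial : ℝ≥0∞) *
      P {U | (∀ i, i + 1 < m → U (f i) < U (f (i + 1))) ∧ rem K U ∈ G} ≤ P {U | rem K U ∈ G} := by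
  by_cases hinj : Function.Injective fun i : Fin m => f i
  · set g : Fin m ↪ Edge d := ⟨fun i => f i, hinj⟩ with hg
    set A : Equiv.Perm (Fin m) → Set (Config d) := fun π =>
      {U | StrictMono (fun i => U (g (π i))) ∧ rem K U ∈ G} with hA
    have hGm : MeasurableSet {U : Config d | rem K U ∈ G} := measurable_rem K hG
    have hAm : ∀ π, MeasurableSet (A π) := by
      intro π
      refine MeasurableSet.inter ?_ hGm
      refine measurableSet_setOfPred.2 ?_
      have := measurable_label_lt (d := d)
      fun_prop
    have hrange : ∀ e, e ∉ K → e ∉ Set.range g := by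
      rintro e he ⟨i, rfl⟩
      exact he (hf i i.2)
    have hPA : ∀ π, P (A π) = P (A 1) := by
      intro π
      conv_rhs => rw [← hP.map_perm (π.viaEmbedding g)]
      rw [Measure.map_apply (measurable_comp_perm _) (hAm 1)]
      congr 1
      ext U
      have hr : rem K (fun e => U (π.viaEmbedding g e)) = rem K U := by
        ext e
        by_cases he : e ∈ K
        · rw [rem_of_mem he, rem_of_mem he]
        · rw [rem_of_notMem he, rem_of_notMem he,
            Equiv.Perm.viaEmbedding_apply_of_notMem _ _ _ (hrange e he)]
      simp only [hA, Set.mem_preimage, Set.mem_ofPred_eq, hr, Equiv.Perm.viaEmbedding_apply,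
        Equiv.Perm.coe_one, id_eq]
    have hdisj : Pairwise (Function.onFun Disjoint A) := by
      intro π σ hne
      refine Set.disjoint_left.2 fun U h1 h2 => hne ?_
      have h3 := Tuple.unique_monotone (f := fun i => U (g i)) (σ := π) (τ := σ)
        h1.1.monotone h2.1.monotone
      have hUi : Function.Injective fun i => U (g i) := by
        intro a b hab
        have h4 := h1.1.injective (a₁ := π.symm a) (a₂ := π.symm b) (by simpa using hab)
        exact π.symm.injective h4
      ext i
      exact congrArg Fin.val (hUi (congrFun h3 i))
    calc _ ≤ (m.factorial : ℝ≥0∞) * P (A 1) := by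
          gcongr
          rintro U ⟨h1, h2⟩
          exact ⟨fun i j hij => lt_of_consecutive (u := fun i => U (f i)) h1 hij j.2, h2⟩
      _ = ∑ π, P (A π) := by
          rw [Finset.sum_congr rfl fun π _ => hPA π, Finset.sum_const, Finset.card_univ,
            Fintype.card_perm, Fintype.card_fin, nsmul_eq_mul]
      _ = P (⋃ π, A π) := by rw [measure_iUnion hdisj hAm, tsum_fintype]
      _ ≤ _ := measure_mono (Set.iUnion_subset fun π U h => h.2)
  · have : {U : Config d | (∀ i, i + 1 < m → U (f i) < U (f (i + 1))) ∧ rem K U ∈ G} = ∅ := by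
      refine Set.eq_empty_of_forall_notMem ?_
      rintro U ⟨h1, -⟩
      refine hinj fun i j hij => ?_
      have hij : f i = f j := hij
      by_contra hne
      rcases lt_or_gt_of_ne hne with h | h
      · have := lt_of_consecutive (u := fun i => U (f i)) h1 h j.2
        simp [hij] at this
      · have := lt_of_consecutive (u := fun i => U (f i)) h1 h i.2
        simp [hij] at this
    rw [this, measure_empty, mul_zero]
    exact zero_le

lemma IsProductUniform.anti_bound (hP : IsProductUniform P) (m : ℕ) (f : ℕ → Edge d)
    (K : Finset (Edge d)) (hf : ∀ i < m, f i ∈ K) {G : Set (Config d)} (hG : MeasurableSet G) :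
    (m.factorial : ℝ≥0∞) *
      P {U | (∀ i, i + 1 < m → U (f (i + 1)) < U (f i)) ∧ rem K U ∈ G} ≤ P {U | rem K U ∈ G} := by
  refine le_trans ?_ (hP.mono_bound m (fun i => f (m - 1 - i)) K (fun i hi => hf _ (by omega)) hG)
  refine mul_le_mul' le_rfl (measure_mono ?_)
  rintro U ⟨h1, h2⟩
  refine ⟨fun i hi => ?_, h2⟩
  have := h1 (m - 1 - (i + 1)) (by omega)
  rwa [show m - 1 - (i + 1) + 1 = m - 1 - i by omega] at this

lemma unif_Iic (h1 : p ≤ 1) : unif (Set.Iic p) = ENNReal.ofReal p := by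
  rw [unif, Measure.restrict_apply measurableSet_Iic]
  have : Set.Iic p ∩ Set.Icc 0 1 = Set.Icc 0 p := by
    ext x; simp only [Set.mem_inter_iff, Set.mem_Iic, Set.mem_Icc]
    constructor
    · rintro ⟨h, h', -⟩; exact ⟨h', h⟩
    · rintro ⟨h, h'⟩; exact ⟨h', h, h'.trans h1⟩
  rw [this, Real.volume_Icc, sub_zero]

lemma unif_Ioi (h0 : 0 ≤ p) : unif (Set.Ioi p) = ENNReal.ofReal (1 - p) := by
  rw [unif, Measure.restrict_apply measurableSet_Ioi]
  have : Set.Ioi p ∩ Set.Icc 0 1 = Set.Ioc p 1 := by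
    ext x; simp only [Set.mem_inter_iff, Set.mem_Ioi, Set.mem_Icc, Set.mem_Ioc]
    constructor
    · rintro ⟨h, -, h'⟩; exact ⟨h, h'⟩
    · rintro ⟨h, h'⟩; exact ⟨h, h0.trans h.le, h'⟩
  rw [this, Real.volume_Ioc]

/-- Insertion tolerance. -/
lemma IsProductUniform.insert_bound (hP : IsProductUniform P) (h0 : 0 ≤ p) (h1 : p ≤ 1)
    {δ : ℝ≥0∞} (hδ : δ ≤ ENNReal.ofReal p) (hδ' : δ ≤ ENNReal.ofReal (1 - p))
    (K Q : Finset (Edge d)) {G : Set (Config d)} (hG : MeasurableSet G) :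
    δ ^ K.card * P {U | rem K U ∈ G} ≤
      P {U | (∀ f ∈ K, (f ∈ Q → U f ≤ p) ∧ (f ∉ Q → p < U f)) ∧ rem K U ∈ G} := by
  set t : Edge d → Set ℝ := fun e => if e ∈ Q then Set.Iic p else Set.Ioi p with ht
  have htm : ∀ e, MeasurableSet (t e) := fun e => by
    simp only [ht]; split_ifs
    · exact measurableSet_Iic
    · exact measurableSet_Ioi
  have hset : {U : Config d | (∀ f ∈ K, (f ∈ Q → U f ≤ p) ∧ (f ∉ Q → p < U f)) ∧ rem K U ∈ G} =
      {U | ∀ e ∈ K, U e ∈ t e} ∩ {U | rem K U ∈ G} := by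
    ext U
    simp only [Set.mem_ofPred_eq, Set.mem_inter_iff]
    refine and_congr_left fun _ => forall₂_congr fun f _ => ?_
    by_cases hf : f ∈ Q <;> simp [ht, hf]
  rw [hset, hP.indep (K : Set (Edge d)) (B := {U | rem K U ∈ G}) _ (measurable_rem K hG)]
  · rw [hP.cyl K t htm]
    gcongr
    rw [← Finset.prod_const]
    refine Finset.prod_le_prod' fun e _ => ?_
    simp only [ht]
    split_ifs
    · rwa [unif_Iic h1]
    · rwa [unif_Ioi h0]
  · intro U V h
    simp only [Set.mem_ofPred_eq]
    refine forall₂_congr fun e he => ?_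
    rw [h e (by simpa using he)]
  · intro U V h
    have : rem K U = rem K V := by
      ext e
      by_cases he : e ∈ K
      · rw [rem_of_mem he, rem_of_mem he]
      · rw [rem_of_notMem he, rem_of_notMem he, h e (by simpa using he)]
    simp only [Set.mem_ofPred_eq, this]
  · have : {U : Config d | ∀ e ∈ K, U e ∈ t e} = (K : Set (Edge d)).pi t := rfl
    rw [this]
    exact MeasurableSet.pi K.countable_toSet fun e _ => htm e

end

section
open scoped Classical ENNReal
variable {d : ℕ} {κ : ℕ} {p : ℝ} {P : Measure (Config d)}

lemma IsProductUniform.label (hP : IsProductUniform P) (e : Edge d) {t : Set ℝ}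
    (ht : MeasurableSet t) : P {U | U e ∈ t} = unif t := by
  have := hP.cyl {e} (fun _ => t) fun _ => ht
  simpa using this

lemma IsProductUniform.ae_mem_Icc (hP : IsProductUniform P) :
    ∀ᵐ U ∂P, ∀ e, U e ∈ Set.Icc (0 : ℝ) 1 := by
  rw [ae_all_iff]
  intro e
  have := hP.label e (measurableSet_Icc (a := (0 : ℝ)) (b := 1)).compl
  rw [ae_iff]
  refine Eq.trans this ?_
  rw [unif, Measure.restrict_apply measurableSet_Icc.compl]
  simp

lemma unif_singleton (c : ℝ) : unif {c} = 0 :=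
  le_antisymm ((Measure.restrict_apply_le _ _).trans (by simp)) zero_le

lemma IsProductUniform.ae_injective (hP : IsProductUniform P) :
    ∀ᵐ U ∂P, ∀ e f, U e = U f → e = f := by
  have := hP.1
  rw [ae_all_iff]
  intro e
  rw [ae_all_iff]
  intro f
  by_cases h : e = f
  · exact Filter.Eventually.of_forall fun _ _ => h
  · have hm : MeasurableSet {U : Config d | U e = U f} :=
      measurableSet_eq_fun (measurable_pi_apply e) (measurable_pi_apply f)
    rw [ae_iff]
    have : {U : Config d | ¬(U e = U f → e = f)} = {U | U e = U f} := by
      ext U; simp [h]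
    rw [this, ← hP.prod_hyb {f} hm]
    have h2 : {q : Config d × Config d | hyb {f} q.1 q.2 ∈ {U : Config d | U e = U f}} =
        {q | q.1 e = q.2 f} := by
      ext q
      simp only [Set.mem_ofPred_eq]
      rw [hyb_of_notMem (by simpa using h), hyb_of_mem (Set.mem_singleton f)]
    have hm2 : MeasurableSet {q : Config d × Config d | q.1 e = q.2 f} :=
      measurableSet_eq_fun ((measurable_pi_apply e).comp measurable_fst)
        ((measurable_pi_apply f).comp measurable_snd)
    rw [h2, Measure.measure_prod_null hm2]
    refine Filter.Eventually.of_forall fun X => ?_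
    have := hP.label f (measurableSet_singleton (X e))
    rw [unif_singleton] at this
    simpa [Set.preimage, eq_comm] using this

lemma IsProductUniform.null_of_walks (hP : IsProductUniform P) (e : Edge d) {B : Set (Config d)}
    (A : ℕ → (ℕ → Edge d) → Set (Config d)) (hB : ∀ m, B ⊆ ⋃ w ∈ walks lnb m e, A m w)
    (hA : ∀ m w, (m.factorial : ℝ≥0∞) * P (A m w) ≤ 1) : P B = 0 := by
  have := hP.1
  have key : ∀ m : ℕ, (P B).toReal ≤ ((4 * d : ℕ) : ℝ) ^ m / m.factorial := by
    intro m
    rw [le_div_iff₀ (by positivity)]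
    have h1 : (m.factorial : ℝ≥0∞) * P B ≤ ((4 * d : ℕ) : ℝ≥0∞) ^ m := by
      calc _ ≤ (m.factorial : ℝ≥0∞) * ∑ w ∈ walks lnb m e, P (A m w) :=
            mul_le_mul' le_rfl ((measure_mono (hB m)).trans (measure_biUnion_finset_le _ _))
        _ = ∑ w ∈ walks lnb m e, (m.factorial : ℝ≥0∞) * P (A m w) := Finset.mul_sum _ _ _
        _ ≤ ∑ w ∈ walks lnb m e, 1 := Finset.sum_le_sum fun w _ => hA m w
        _ = ((walks lnb m e).card : ℝ≥0∞) := by simp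
        _ ≤ _ := by exact_mod_cast card_walks_le card_lnb_le m e
    have h2 := ENNReal.toReal_mono (by finiteness) h1
    rw [ENNReal.toReal_mul, ENNReal.toReal_pow] at h2
    simpa [mul_comm] using h2
  have h0 : (P B).toReal ≤ 0 :=
    ge_of_tendsto' (FloorSemiring.tendsto_pow_div_factorial_atTop ((4 * d : ℕ) : ℝ)) key
  have := le_antisymm h0 ENNReal.toReal_nonneg
  rcases (ENNReal.toReal_eq_zero_iff _).1 this with h | h
  · exact h
  · exact absurd h (measure_ne_top _ _)

lemma IsProductUniform.ae_wf (hP : IsProductUniform P) : ∀ᵐ U ∂P, Wf U := by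
  have := hP.1
  have key : ∀ e : Edge d, ∀ᵐ U ∂P, ¬ ∃ x : ℕ → Edge d, x 0 = e ∧
      ∀ i, LAdj (x (i + 1)) (x i) ∧ U (x (i + 1)) < U (x i) := by
    intro e
    rw [ae_iff]
    refine hP.null_of_walks e
      (fun m w => {U | (∀ i, i + 1 < m → U (w (i + 1)) < U (w i)) ∧
        rem ((Finset.range m).image w) U ∈ Set.univ}) (fun m U hU => ?_) fun m w => ?_
    · simp only [not_not, Set.mem_ofPred_eq] at hU
      obtain ⟨x, rfl, hx⟩ := hU
      obtain ⟨w, hw, hwx⟩ := exists_mem_walks m x fun i _ => (hx i).1.symm.mem_lnb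
      refine Set.mem_iUnion₂.2 ⟨w, hw, fun i hi => ?_, trivial⟩
      rw [hwx i (by omega), hwx (i + 1) (by omega)]
      exact (hx i).2
    · refine (hP.anti_bound m w _ (fun i hi => Finset.mem_image_of_mem _ (by simpa using hi))
        MeasurableSet.univ).trans prob_le_one
  filter_upwards [ae_all_iff.2 key] with U hU
  rw [wf_iff]
  rintro ⟨x, hx⟩
  exact hU (x 0) ⟨x, rfl, hx⟩

lemma IsProductUniform.ae_wfUp (hP : IsProductUniform P) : ∀ᵐ U ∂P, WfUp U := by
  have := hP.1
  have key : ∀ e : Edge d, ∀ᵐ U ∂P, ¬ ∃ x : ℕ → Edge d, x 0 = e ∧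
      ∀ i, LAdj (x (i + 1)) (x i) ∧ U (x i) < U (x (i + 1)) := by
    intro e
    rw [ae_iff]
    refine hP.null_of_walks e
      (fun m w => {U | (∀ i, i + 1 < m → U (w i) < U (w (i + 1))) ∧
        rem ((Finset.range m).image w) U ∈ Set.univ}) (fun m U hU => ?_) fun m w => ?_
    · simp only [not_not, Set.mem_ofPred_eq] at hU
      obtain ⟨x, rfl, hx⟩ := hU
      obtain ⟨w, hw, hwx⟩ := exists_mem_walks m x fun i _ => (hx i).1.symm.mem_lnb
      refine Set.mem_iUnion₂.2 ⟨w, hw, fun i hi => ?_, trivial⟩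
      rw [hwx i (by omega), hwx (i + 1) (by omega)]
      exact (hx i).2
    · refine (hP.mono_bound m w _ (fun i hi => Finset.mem_image_of_mem _ (by simpa using hi))
        MeasurableSet.univ).trans prob_le_one
  filter_upwards [ae_all_iff.2 key] with U hU
  rw [wfUp_iff, wf_iff]
  rintro ⟨x, hx⟩
  exact hU (x 0) ⟨x, rfl, fun i => ⟨(hx i).1, neg_lt_neg_iff.1 (hx i).2⟩⟩

/-- The almost sure properties of a configuration. -/
structure Nice (U : Config d) : Prop where
  range : ∀ e, U e ∈ Set.Icc (0 : ℝ) 1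
  inj : ∀ e f, U e = U f → e = f
  wf : Wf U
  wfUp : WfUp U

lemma IsProductUniform.ae_nice (hP : IsProductUniform P) : ∀ᵐ U ∂P, Nice U := by
  filter_upwards [hP.ae_mem_Icc, hP.ae_injective, hP.ae_wf, hP.ae_wfUp] with U h1 h2 h3 h4
  exact ⟨h1, h2, h3, h4⟩

lemma ladj_consecutive {x y z : Vertex d} {U : Config d} (h1 : adj x y) (h2 : adj y z)
    (h : U s(x, y) ≠ U s(y, z)) : LAdj s(x, y) s(y, z) :=
  ⟨isNNEdge_mk.2 h1, isNNEdge_mk.2 h2, fun he => h (by rw [he]), y, by simp, by simp⟩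

lemma Nice.good {U : Config d} (hU : Nice U) : U ∈ goodConfigs d := by
  refine ⟨fun e _ => hU.range e, fun e f _ _ => hU.inj e f, ?_⟩
  rintro ⟨w, hw, h | h⟩
  · refine (wf_iff.1 (wfUp_iff.1 hU.wfUp)) ⟨fun i => s(w i, w (i + 1)), fun i => ⟨?_, ?_⟩⟩
    · exact (ladj_consecutive (hw i) (hw (i + 1)) (h (Nat.lt_succ_self i)).ne).symm
    · exact neg_lt_neg_iff.2 (h (Nat.lt_succ_self i))
  · refine (wf_iff.1 hU.wf) ⟨fun i => s(w i, w (i + 1)), fun i => ⟨?_, ?_⟩⟩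
    · exact (ladj_consecutive (hw i) (hw (i + 1)) (h (Nat.lt_succ_self i)).ne').symm
    · exact h (Nat.lt_succ_self i)

lemma IsProductUniform.tau_eq (hP : IsProductUniform P) (n : ℕ) :
    tau κ P n p = (P {U | Arm κ U p n 0}).toReal := by
  unfold tau
  congr 1
  refine measure_congr ?_
  filter_upwards [hP.ae_nice] with U hU
  refine propext ?_
  change (U ∈ goodConfigs d ∧ modifiedOneArm κ n p U) ↔ Arm κ U p n 0
  rw [modifiedOneArm_iff hU.wf]
  exact and_iff_right hU.good

end

section
open scoped Classical ENNReal
variable {d : ℕ} {κ : ℕ} {p : ℝ} {U : Config d}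

lemma walks_zero {α : Type*} {nb : α → Finset α} {m : ℕ} {a : α} {w : ℕ → α}
    (h : w ∈ walks nb m a) : w 0 = a := by
  cases m with
  | zero => rw [walks, Finset.mem_singleton] at h; rw [h]
  | succ m =>
    simp only [walks, Finset.mem_biUnion, Finset.mem_image] at h
    obtain ⟨b, -, w', -, rfl⟩ := h
    rfl

lemma walks_step {α : Type*} {nb : α → Finset α} {m : ℕ} {a : α} {w : ℕ → α}
    (h : w ∈ walks nb m a) : ∀ i < m, w (i + 1) ∈ nb (w i) := by
  induction m generalizing a w with
  | zero => intro i hi; omega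
  | succ m ih =>
    simp only [walks, Finset.mem_biUnion, Finset.mem_image] at h
    obtain ⟨b, hb, w', hw', rfl⟩ := h
    intro i hi
    cases i with
    | zero => exact (congrArg (· ∈ nb a) (walks_zero hw')).mpr hb
    | succ i => exact ih hw' i (by omega)

/-- The path obtained by following `up` backwards for `c` steps and then `dn`. -/
def glue (c : ℕ) (up dn : ℕ → Vertex d) : ℕ → Vertex d :=
  fun i => if i ≤ c then up (c - i) else dn (i - c)

/-- The edges near the chain `w` and the path `y`. -/
noncomputable def near (m : ℕ) (w : ℕ → Edge d) (r : ℕ) (y : ℕ → Vertex d) : Finset (Edge d) :=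
  (Finset.range (m + 1)).biUnion (fun i => lnb (w i)) ∪ nearV r y

/-- The part of the surgery event which prescribes the labels along the path `y`, and the
configuration off `K`. -/
def TailCut (κ : ℕ) (p : ℝ) (n c₁ c₂ : ℕ) (y : ℕ → Vertex d) (K : Finset (Edge d)) (U : Config d) :
    Prop :=
  (∀ i, i + 1 < c₁ - 1 → U s(y (i + 2), y (i + 3)) < U s(y (i + 1), y (i + 2))) ∧
  (∀ i, i + 1 < c₂ →
    U s(y (c₁ + i + 1), y (c₁ + i + 2)) < U s(y (c₁ + i), y (c₁ + i + 1))) ∧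
  ∃ s x, HeadCut κ (rem K U) p n (c₁ + c₂) y s x

lemma nearV_congr {r : ℕ} {y y' : ℕ → Vertex d} (h : ∀ i ≤ r, y i = y' i) :
    nearV r y = nearV r y' := by
  refine Finset.biUnion_congr rfl fun i hi => ?_
  rw [h i (by simpa [Nat.lt_succ_iff] using hi)]

lemma Wit.exists_tailCut (hp : p < 2) (hU : Wf U) {n : ℕ} (hn : 1 ≤ n) {m : ℕ} {w : ℕ → Edge d}
    {S : Finset (Edge d)} (hw : ∀ i < m, w i ∈ S)
    (hS : S ⊆ (Finset.range m).biUnion fun i => lnb (w i)) {k l : ℕ} {x : ℕ → Vertex d}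
    (hx : Wit (oe κ (rem S U) p) (rem S U) p n 0 k l x) {b : ℕ} (hlb : l ≤ b) (hbk : b ≤ k) :
    ∃ c₁ c₂, ∃ up ∈ walks nbrs c₁ (x b), ∃ dn ∈ walks nbrs c₂ (x b),
      ∃ K ⊆ near m w (c₁ + c₂) (glue c₁ up dn), (∀ i < m, w i ∈ K) ∧
        pathEdges (c₁ + c₂) (glue c₁ up dn) ⊆ K ∧
        TailCut κ p n c₁ c₂ (glue c₁ up dn) K U := by
  obtain ⟨s, hs⟩ : ∃ s, s = l - 1 := ⟨_, rfl⟩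
  obtain ⟨W, hWn, hWe, hW⟩ := hx.headCut hp (hU.rem S) hn hs
  have hsb : s ≤ b := by omega
  obtain ⟨up, hup, hupx⟩ := exists_mem_walks (nb := nbrs) (b - s) (fun i => x (b - i))
    fun i hi => mem_nbrs.2 (by
      have := hx.path.1 (b - (i + 1)) (by omega)
      rw [show b - (i + 1) + 1 = b - i by omega] at this
      exact adj_comm.1 this)
  obtain ⟨dn, hdn, hdnx⟩ := exists_mem_walks (nb := nbrs) (k - b) (fun i => x (b + i))
    fun i hi => mem_nbrs.2 (hx.path.1 (b + i) (by omega))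
  have hr : b - s + (k - b) = k - s := by omega
  have hy : ∀ i ≤ k - s, glue (b - s) up dn i = x (s + i) := by
    intro i hi
    unfold glue
    split_ifs with h
    · rw [hupx _ (by omega)]
      congr 1
      omega
    · rw [hdnx _ (by omega)]
      congr 1
      omega
  have hlab : ∀ i, l ≤ i → i < k → U s(x i, x (i + 1)) = rem S U s(x i, x (i + 1)) :=
    fun i hi hik => (rem_of_notMem (notMem_of_rem_le hp (hx.tail_le i hi hik))).symm
  have hdec : ∀ i, l ≤ i → i + 1 < k → U s(x (i + 1), x (i + 2)) < U s(x i, x (i + 1)) := by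
    intro i hi hik
    rw [hlab i hi (by omega), hlab (i + 1) (by omega) hik]
    exact hx.tail_lt i hi hik
  refine ⟨b - s, k - b, up, hup, dn, hdn, S ∪ W, ?_, fun i hi => Finset.mem_union_left _ (hw i hi),
    ?_, ?_, ?_, s, x, ?_⟩
  · refine Finset.union_subset_union (hS.trans ?_) ?_
    · exact Finset.biUnion_subset_biUnion_of_subset_left _ (by simp)
    · rw [hr, nearV_congr hy]
      exact hWn
  · intro f hf
    obtain ⟨i, hi, rfl⟩ := mem_pathEdges.1 hf
    rw [hy i (by omega), hy (i + 1) (by omega)]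
    exact Finset.mem_union_right _ (hWe i (by omega))
  · intro i hi
    rw [hy _ (by omega), hy _ (by omega), hy _ (by omega)]
    exact hdec (s + (i + 1)) (by omega) (by omega)
  · intro i hi
    rw [hy _ (by omega), hy _ (by omega), hy _ (by omega)]
    have := hdec (s + (b - s + i)) (by omega) (by omega)
    exact this
  · rw [hr]
    refine HeadCut.congr_path (y := fun i => x (s + i)) (x := x) ?_ (fun i hi => (hy i hi).symm)
      fun _ _ => rfl
    rw [← rem_rem]
    exact hW

lemma piv_rem_singleton {n : ℕ} {f : Edge d} : Piv κ p n f (rem {f} U) ↔ Piv κ p n f U := by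
  have h1 : Function.update (rem {f} U) f p = Function.update U f p := by
    ext e
    by_cases h : e = f
    · subst h; simp
    · simp [h, rem]
  unfold Piv
  rw [h1, rem_rem, Finset.union_self]

lemma piv_of_rem (hp : p < 2) (hU : Wf U) {n : ℕ} {f : Edge d} {K : Finset (Edge d)} (hf : f ∈ K)
    (hK : ∀ g ∈ K, p < U g) (h : Piv κ p n f (rem K U)) : Piv κ p n f U := by
  have hne : ∀ g ∈ K.erase f, g ≠ f := fun g hg => Finset.ne_of_mem_erase hg
  have h1 : Function.update (rem K U) f p = rem (K.erase f) (Function.update U f p) := by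
    ext e
    by_cases h : e = f
    · subst h; simp [rem]
    · simp [h, rem]
  refine ⟨?_, fun h2 => h.2 ?_⟩
  · have := h.1
    rw [h1] at this
    refine (arm_rem_iff_of_lt hp (hU.update f p) fun g hg => ?_).1 this
    rw [Function.update_of_ne (hne g hg)]
    exact hK g (Finset.mem_of_mem_erase hg)
  · have : rem {f} (rem K U) = rem (K.erase f) (rem {f} U) := by
      rw [rem_rem, rem_rem]
      congr 1
      ext g
      simp only [Finset.mem_union, Finset.mem_singleton, Finset.mem_erase]
      by_cases h : g = f <;> simp [h, hf]
    rw [this]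
    refine (arm_rem_iff_of_lt hp (hU.rem _) fun g hg => ?_).2 h2
    rw [rem_of_notMem (by simpa using hne g hg)]
    exact hK g (Finset.mem_of_mem_erase hg)

/-- If removing `e` changes the arm event, a chain of increasing labels leads from `e` either to an
edge which is pivotal after surgery, or to the tail of a witness. -/
lemma exists_surgery (hp : p < 2) (hU : Wf U) (hUp : WfUp U) (hinj : ∀ e f, U e = U f → e = f)
    {n : ℕ} (hn : 1 ≤ n) (e : Edge d) (he : IsNNEdge e)
    (h : ¬ (Arm κ U p n 0 ↔ Arm κ (rem {e} U) p n 0)) :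
    ∃ m, ∃ w ∈ walks lnb m e, (∀ i, i + 1 < m → U (w i) < U (w (i + 1))) ∧
      ((∃ K ⊆ (Finset.range (m + 1)).biUnion (fun i => lnb (w i)), (∀ i ≤ m, w i ∈ K) ∧
          Piv κ p n (w m) (rem K U)) ∨
        ∃ v ∈ w m, ∃ c₁ c₂, ∃ up ∈ walks nbrs c₁ v, ∃ dn ∈ walks nbrs c₂ v,
          ∃ K ⊆ near m w (c₁ + c₂) (glue c₁ up dn), (∀ i < m, w i ∈ K) ∧
          pathEdges (c₁ + c₂) (glue c₁ up dn) ⊆ K ∧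
          TailCut κ p n c₁ c₂ (glue c₁ up dn) K U) := by
  obtain ⟨m, f, S, rfl, hf, -, hfS, hfm, hfp, hnn, hS, harm, hnarm⟩ :=
    exists_terminal (κ := κ) (n := n) (c := 0) hp hU hUp e he ∅ (by simp) (by simpa using h)
  obtain ⟨w, hw, hwf⟩ := exists_mem_walks (nb := lnb) m f fun i hi => (hf i hi).1.mem_lnb
  refine ⟨m, w, hw, fun i hi => ?_, ?_⟩
  · rw [hwf i (by omega), hwf (i + 1) (by omega)]
    exact (hf i (by omega)).2
  have hS' : S ⊆ (Finset.range m).biUnion fun i => lnb (w i) := by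
    rw [Finset.empty_union] at hS
    refine hS.trans (Finset.biUnion_mono fun i hi => ?_)
    rw [hwf i (by simp at hi; omega)]
  have hwS : ∀ i < m, w i ∈ S := fun i hi => by rw [hwf i hi.le]; exact hfS i hi
  have hwm : w m = f m := hwf m le_rfl
  obtain ⟨k, l, x, hx⟩ := harm
  by_cases ht : ∃ b, l ≤ b ∧ b ≤ k ∧ x b ∈ f m
  · obtain ⟨b, hlb, hbk, hb⟩ := ht
    exact Or.inr ⟨x b, hwm ▸ hb, hx.exists_tailCut hp hU hn hwS hS' hlb hbk⟩
  · push Not at ht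
    left
    have hVinj : ∀ a b, IsNNEdge a → IsNNEdge b → rem S U a ≤ p →
        rem S U a = rem S U b → a = b := by
      intro a b _ _ ha hab
      have hb : rem S U b ≤ p := hab ▸ ha
      rw [rem_of_notMem (notMem_of_rem_le hp ha), rem_of_notMem (notMem_of_rem_le hp hb)] at hab
      exact hinj a b hab
    have hpiv := hx.piv hp (hU.rem S) hVinj hnn (by rwa [rem_of_notMem hfm]) hnarm ht
    set T := kset κ (rem S U) p (f m) with hT
    refine ⟨S ∪ T, ?_, fun i hi => ?_, ?_⟩
    · refine Finset.union_subset (hS'.trans ?_) ((kset_subset hnn).trans ?_)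
      · exact Finset.biUnion_subset_biUnion_of_subset_left _ (by simp)
      · rw [← hwm]
        exact Finset.subset_biUnion_of_mem (fun i => lnb (w i)) (by simp)
    · rcases hi.lt_or_eq with h1 | rfl
      · exact Finset.mem_union_left _ (hwS i h1)
      · rw [hwm]
        exact Finset.mem_union_right _ self_mem_kset
    · rw [hwm]
      rw [← piv_rem_singleton, rem_rem, rem_rem] at hpiv
      have : T.erase (f m) ∪ {f m} = T := by
        rw [Finset.union_comm, ← Finset.insert_eq, Finset.insert_erase self_mem_kset]
      rwa [this] at hpiv

end

section
open scoped Classical ENNReal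
variable {d : ℕ} {κ : ℕ} {p : ℝ} {P : Measure (Config d)}

lemma measure_exists_le {Ω α : Type*} [MeasurableSpace Ω] {μ : Measure Ω} {s : Finset α} {N : ℕ}
    (hN : s.card ≤ N) {A : α → Ω → Prop} {b : ℝ≥0∞} (h : ∀ a ∈ s, μ {U | A a U} ≤ b) :
    μ {U | ∃ a ∈ s, A a U} ≤ N * b := by
  have : {U | ∃ a ∈ s, A a U} = ⋃ a ∈ s, {U | A a U} := by
    ext; simp
  rw [this]
  calc _ ≤ ∑ a ∈ s, μ {U | A a U} := measure_biUnion_finset_le _ _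
    _ ≤ s.card * b := by
        rw [← nsmul_eq_mul]
        exact Finset.sum_le_card_nsmul _ _ _ h
    _ ≤ _ := by gcongr

lemma le_inv_mul_of_mul_le {a b c : ℝ≥0∞} (h0 : a ≠ 0) (ht : a ≠ ⊤) (h : a * b ≤ c) :
    b ≤ a⁻¹ * c := by
  calc b = a⁻¹ * (a * b) := by rw [← mul_assoc, ENNReal.inv_mul_cancel h0 ht, one_mul]
    _ ≤ _ := by gcongr

/-- A positive lower bound for the probability of either state of an edge. -/
structure Tol (p : ℝ) (δ : ℝ≥0∞) : Prop where
  nonneg : 0 ≤ p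
  le_one : p ≤ 1
  pos : δ ≠ 0
  le_left : δ ≤ ENNReal.ofReal p
  le_right : δ ≤ ENNReal.ofReal (1 - p)

lemma Tol.one_le {δ : ℝ≥0∞} (h : Tol p δ) : δ ≤ 1 := by
  refine h.le_left.trans ?_
  rw [← ENNReal.ofReal_one]
  exact ENNReal.ofReal_le_ofReal h.le_one

lemma Tol.lt_two {δ : ℝ≥0∞} (h : Tol p δ) : p < 2 := by linarith [h.le_one]

lemma IsProductUniform.rem_bound (hP : IsProductUniform P) {δ : ℝ≥0∞} (hδ : Tol p δ)
    (K Q : Finset (Edge d)) {N : ℕ} (hK : K.card ≤ N) {G : Set (Config d)} (hG : MeasurableSet G)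
    {S : ℝ≥0∞}
    (hS : P {U | (∀ f ∈ K, (f ∈ Q → U f ≤ p) ∧ (f ∉ Q → p < U f)) ∧ rem K U ∈ G} ≤ S) :
    P {U | rem K U ∈ G} ≤ δ⁻¹ ^ N * S := by
  have ht : δ ≠ ⊤ := (hδ.one_le.trans_lt ENNReal.one_lt_top).ne
  have h1 := (hP.insert_bound hδ.nonneg hδ.le_one hδ.le_left hδ.le_right K Q hG).trans hS
  have h2 := le_inv_mul_of_mul_le (pow_ne_zero _ hδ.pos) (ENNReal.pow_ne_top ht) h1
  refine h2.trans (mul_le_mul' ?_ le_rfl)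
  rw [ENNReal.inv_pow]
  exact pow_le_pow_right₀ (ENNReal.one_le_inv.2 hδ.one_le) hK

lemma IsProductUniform.tailCut_bound (hP : IsProductUniform P) {δ : ℝ≥0∞} (hδ : Tol p δ)
    {n M m c₁ c₂ N : ℕ} {w : ℕ → Edge d} {y : ℕ → Vertex d} {K : Finset (Edge d)}
    (hM : M = m ∨ M = c₁ - 1 ∨ M = c₂) (hw : ∀ i < m, w i ∈ K) (hy : pathEdges (c₁ + c₂) y ⊆ K)
    (hK : K.card ≤ N) {S : ℝ≥0∞}
    (hS : P {U | (∀ f ∈ K, (f ∈ pathEdges (c₁ + c₂) y → U f ≤ p) ∧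
      (f ∉ pathEdges (c₁ + c₂) y → p < U f)) ∧
      ∃ s x, HeadCut κ (rem K U) p n (c₁ + c₂) y s x} ≤ S) :
    P {U | (∀ i, i + 1 < m → U (w i) < U (w (i + 1))) ∧ TailCut κ p n c₁ c₂ y K U} ≤
      (M.factorial : ℝ≥0∞)⁻¹ * (δ⁻¹ ^ N * S) := by
  set G : Set (Config d) := {U | ∃ s x, HeadCut κ U p n (c₁ + c₂) y s x} with hGdef
  have hG : MeasurableSet G := measurableSet_setOfPred.2 (measurable_headCut n (c₁ + c₂) y)
  have hb : P {U | rem K U ∈ G} ≤ δ⁻¹ ^ N * S := hP.rem_bound hδ K _ hK hG hS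
  have hmem : ∀ i < c₁ + c₂, s(y i, y (i + 1)) ∈ K :=
    fun i hi => hy (mem_pathEdges.2 ⟨i, hi, rfl⟩)
  refine (le_inv_mul_of_mul_le (by exact_mod_cast M.factorial_ne_zero)
    (ENNReal.natCast_ne_top _) ?_).trans (mul_le_mul' le_rfl hb)
  rcases hM with rfl | rfl | rfl
  · refine le_trans (mul_le_mul' le_rfl (measure_mono ?_)) (hP.mono_bound M w K hw hG)
    exact fun U hU => ⟨hU.1, hU.2.2.2⟩
  · refine le_trans (mul_le_mul' le_rfl (measure_mono ?_))
      (hP.anti_bound (c₁ - 1) (fun i => s(y (i + 1), y (i + 2))) K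
        (fun i hi => hmem (i + 1) (by omega)) hG)
    exact fun U hU => ⟨hU.2.1, hU.2.2.2⟩
  · refine le_trans (mul_le_mul' le_rfl (measure_mono ?_))
      (hP.anti_bound M (fun i => s(y (c₁ + i), y (c₁ + i + 1))) K
        (fun i hi => hmem (c₁ + i) (by omega)) hG)
    exact fun U hU => ⟨hU.2.2.1, hU.2.2.2⟩

/-- The union of the surgery events along paths through `v`, for chains of maximal length `M`. -/
def TailEv (κ : ℕ) (p : ℝ) (n M m : ℕ) (w : ℕ → Edge d) (v : Vertex d) (U : Config d) : Prop :=
  ∃ c₁ ∈ Finset.range (M + 2), ∃ c₂ ∈ Finset.range (M + 1), ∃ up ∈ walks nbrs c₁ v,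
    ∃ dn ∈ walks nbrs c₂ v, ∃ K ∈ (near m w (c₁ + c₂) (glue c₁ up dn)).powerset,
      ((M = m ∨ M = c₁ - 1 ∨ M = c₂) ∧ (∀ i < m, w i ∈ K) ∧
        pathEdges (c₁ + c₂) (glue c₁ up dn) ⊆ K) ∧
      (∀ i, i + 1 < m → U (w i) < U (w (i + 1))) ∧ TailCut κ p n c₁ c₂ (glue c₁ up dn) K U

/-- The growth rate of the size of the neighbourhood modified by the surgery. -/
def growth (d : ℕ) : ℕ := 4 * d + 16 * d ^ 2

/-- The base of the geometric factor in the surgery estimates. -/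
noncomputable def base (d : ℕ) (δ : ℝ≥0∞) : ℝ≥0∞ :=
  ((4 * (2 * d) ^ 2 * 2 ^ growth d : ℕ) : ℝ≥0∞) * δ⁻¹ ^ growth d

lemma card_chain_le {m M : ℕ} (hm : m ≤ M) (w : ℕ → Edge d) :
    ((Finset.range (m + 1)).biUnion fun i => lnb (w i)).card ≤ (M + 1) * (4 * d) := by
  refine (Finset.card_biUnion_le_card_mul _ _ _ fun i _ => card_lnb_le (w i)).trans ?_
  rw [Finset.card_range]
  gcongr

lemma card_near_le {m M r : ℕ} (hm : m ≤ M) (hr : r ≤ 2 * M + 1) (w : ℕ → Edge d)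
    (y : ℕ → Vertex d) : (near m w r y).card ≤ (M + 1) * growth d := by
  refine (Finset.card_union_le _ _).trans ?_
  have h1 := card_chain_le hm w
  have h2 := card_nearV_le r y
  have h3 : (r + 1) * (2 * d * (4 * d)) ≤ (2 * (M + 1)) * (2 * d * (4 * d)) := by
    gcongr; omega
  calc _ ≤ (M + 1) * (4 * d) + (2 * (M + 1)) * (2 * d * (4 * d)) := by omega
    _ = _ := by unfold growth; ring

lemma IsProductUniform.tailEv_bound (hP : IsProductUniform P) (hd : 1 ≤ d) {δ : ℝ≥0∞}
    (hδ : Tol p δ) {n M m : ℕ} (hm : m ≤ M) {w : ℕ → Edge d} {v : Vertex d} {S : ℝ≥0∞}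
    (hS : ∀ (r : ℕ) (y : ℕ → Vertex d) (c : ℕ) (K : Finset (Edge d)), 1 ≤ r → c ≤ r → c ≤ M + 1 →
      IsPathOn r y → y c = v → pathEdges r y ⊆ K →
      P {U | (∀ f ∈ K, (f ∈ pathEdges r y → U f ≤ p) ∧ (f ∉ pathEdges r y → p < U f)) ∧
        ∃ s x, HeadCut κ (rem K U) p n r y s x} ≤ S) :
    P {U | TailEv κ p n M m w v U} ≤
      base d δ ^ (M + 1) * (M.factorial : ℝ≥0∞)⁻¹ * S := by
  set b : ℝ≥0∞ := (M.factorial : ℝ≥0∞)⁻¹ * (δ⁻¹ ^ ((M + 1) * growth d) * S) with hb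
  have key : P {U | TailEv κ p n M m w v U} ≤ ((M + 2 : ℕ) : ℝ≥0∞) * (((M + 1 : ℕ) : ℝ≥0∞) *
      ((((2 * d) ^ (M + 1) : ℕ) : ℝ≥0∞) * ((((2 * d) ^ (M + 1) : ℕ) : ℝ≥0∞) *
        (((2 ^ ((M + 1) * growth d) : ℕ) : ℝ≥0∞) * b)))) := by
    refine measure_exists_le (by simp) fun c₁ hc₁ => ?_
    refine measure_exists_le (by simp) fun c₂ hc₂ => ?_
    simp only [Finset.mem_range] at hc₁ hc₂
    refine measure_exists_le ((card_walks_le card_nbrs_le c₁ v).trans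
      (Nat.pow_le_pow_right (by omega) (by omega))) fun up hup => ?_
    refine measure_exists_le ((card_walks_le card_nbrs_le c₂ v).trans
      (Nat.pow_le_pow_right (by omega) (by omega))) fun dn hdn => ?_
    have hcard := card_near_le hm (r := c₁ + c₂) (by omega) w (glue c₁ up dn)
    refine measure_exists_le (by
      rw [Finset.card_powerset]
      exact Nat.pow_le_pow_right (by omega) hcard) fun K hK => ?_
    by_cases hc : (M = m ∨ M = c₁ - 1 ∨ M = c₂) ∧ (∀ i < m, w i ∈ K) ∧
        pathEdges (c₁ + c₂) (glue c₁ up dn) ⊆ K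
    · refine (measure_mono fun U hU => hU.2).trans (hP.tailCut_bound hδ hc.1 hc.2.1 hc.2.2
        ((Finset.card_le_card (Finset.mem_powerset.1 hK)).trans hcard) ?_)
      by_cases hy : 1 ≤ c₁ + c₂ ∧ IsPathOn (c₁ + c₂) (glue c₁ up dn)
      · refine hS _ _ c₁ K hy.1 (by omega) (by omega) hy.2 ?_ hc.2.2
        simp [glue, walks_zero hup]
      · refine (measure_mono_null (t := ∅) ?_ measure_empty).trans_le zero_le
        rintro U ⟨-, s, x, h⟩
        exact hy ⟨h.pos, h.path⟩
    · simp [hc]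
  refine key.trans ?_
  have e1 : ((M + 2 : ℕ) : ℝ≥0∞) ≤ ((2 ^ (M + 1) : ℕ) : ℝ≥0∞) := by
    exact_mod_cast Nat.lt_two_pow_self (n := M + 1)
  have e2 : ((M + 1 : ℕ) : ℝ≥0∞) ≤ ((2 ^ (M + 1) : ℕ) : ℝ≥0∞) := by
    exact_mod_cast (Nat.lt_two_pow_self (n := M + 1)).le
  calc _ ≤ ((2 ^ (M + 1) : ℕ) : ℝ≥0∞) * (((2 ^ (M + 1) : ℕ) : ℝ≥0∞) *
      ((((2 * d) ^ (M + 1) : ℕ) : ℝ≥0∞) * ((((2 * d) ^ (M + 1) : ℕ) : ℝ≥0∞) *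
        (((2 ^ ((M + 1) * growth d) : ℕ) : ℝ≥0∞) * b)))) := by gcongr
    _ = _ := by
      rw [hb, base]
      push_cast
      have : 4 * (2 * (d : ℝ≥0∞)) ^ 2 = 2 * 2 * (2 * d) * (2 * d) := by ring
      rw [this, mul_comm (M + 1) (growth d), pow_mul, pow_mul]
      simp only [mul_pow]
      ring

/-- The sum of the surgery factors over all lengths. -/
noncomputable def expSum (x : ℝ≥0∞) : ℝ≥0∞ := ∑' M : ℕ, x ^ (M + 1) * (M.factorial : ℝ≥0∞)⁻¹

lemma expSum_ne_top {x : ℝ≥0∞} (hx : x ≠ ⊤) : expSum x ≠ ⊤ := by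
  have h : ∀ M : ℕ, x ^ (M + 1) * (M.factorial : ℝ≥0∞)⁻¹ =
      x * ENNReal.ofReal (x.toReal ^ M / M.factorial) := by
    intro M
    have hM : (0 : ℝ) < M.factorial := by positivity
    rw [ENNReal.ofReal_div_of_pos hM, ENNReal.ofReal_pow ENNReal.toReal_nonneg,
      ENNReal.ofReal_toReal hx, ENNReal.ofReal_natCast, div_eq_mul_inv, pow_succ']
    ring
  unfold expSum
  simp_rw [h]
  rw [ENNReal.tsum_mul_left]
  exact ENNReal.mul_ne_top hx (Real.summable_pow_div_factorial x.toReal).tsum_ofReal_ne_top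

lemma base_ne_top {δ : ℝ≥0∞} (hδ : δ ≠ 0) : base d δ ≠ ⊤ :=
  ENNReal.mul_ne_top (ENNReal.natCast_ne_top _) (ENNReal.pow_ne_top (ENNReal.inv_ne_top.2 hδ))

/-- The modified arm event is comparable to the arm event. -/
lemma IsProductUniform.arm_le_thet (hP : IsProductUniform P) (hd : 1 ≤ d) (hκ : 2 ≤ κ) {δ : ℝ≥0∞}
    (hδ : Tol p δ) {n : ℕ} (hn : 1 ≤ n) :
    P {U | Arm κ U p n 0} ≤ expSum (base d δ) * P {U | Thet κ U p n} := by
  set w : ℕ → Edge d := fun _ => s(0, 0)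
  have hsub : P {U | Arm κ U p n 0} ≤ P (⋃ M, {U | TailEv κ p n M 0 w 0 U}) := by
    refine measure_mono_ae ?_
    filter_upwards [hP.ae_wf] with U hU hA
    obtain ⟨k, l, x, hx⟩ := show Arm κ U p n 0 from hA
    obtain ⟨c₁, c₂, up, hup, dn, hdn, K, hK, h1, h2, h3⟩ :=
      Wit.exists_tailCut (m := 0) (w := w) (S := ∅) (b := k) hδ.lt_two hU hn (by simp) (by simp)
        (by simpa using hx) hx.le le_rfl
    rw [hx.fin] at hup hdn
    refine Set.mem_iUnion.2 ⟨max (c₁ - 1) c₂, c₁, ?_, c₂, ?_, up, hup, dn, hdn, K,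
      Finset.mem_powerset.2 hK, ⟨Or.inr ?_, h1, h2⟩, fun i hi => absurd hi (by omega), h3⟩
    · simp only [Finset.mem_range]; omega
    · simp only [Finset.mem_range]; omega
    · omega
  refine hsub.trans ((measure_iUnion_le _).trans ?_)
  rw [expSum, ← ENNReal.tsum_mul_right]
  refine ENNReal.tsum_le_tsum fun M => hP.tailEv_bound hd hδ (Nat.zero_le _) ?_
  intro r y c K _ _ _ _ _ hyK
  refine measure_mono_ae ?_
  filter_upwards [hP.ae_wf] with U hU hA
  obtain ⟨h1, s, x, h2⟩ := hA
  exact h2.thet hκ hδ.lt_two hU (fun f hf => (h1 f (hyK hf)).1 hf) fun f hf => (h1 f hf).2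

end

section
open scoped Classical ENNReal
variable {d : ℕ} {κ : ℕ} {p : ℝ} {P : Measure (Config d)}

lemma lball_mono {M N : ℕ} (h : M ≤ N) {e f : Edge d} (hf : IsNNEdge f) (hfe : f ∈ lball M e) :
    f ∈ lball N e := by
  have := lball_trans hfe
    (mem_lball_chain (m := N - M) (f := fun _ => f) fun _ _ => self_mem_lnb hf)
  rwa [show M + (N - M) = N by omega] at this

lemma walks_mem_lball {m : ℕ} {e : Edge d} (he : IsNNEdge e) {w : ℕ → Edge d}
    (hw : w ∈ walks lnb m e) : w m ∈ lball m e ∧ IsNNEdge (w m) := by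
  have h := walks_step hw
  refine ⟨by simpa only [walks_zero hw] using mem_lball_chain h, ?_⟩
  cases m with
  | zero => rwa [walks_zero hw]
  | succ m => exact (mem_lnb.1 (h m (by omega))).2.1

lemma IsPathOn.mem_lball {r c : ℕ} {y : ℕ → Vertex d} (hy : IsPathOn r y) (hr : 1 ≤ r) (hc : c ≤ r)
    {g : Edge d} (hg : IsNNEdge g) (hv : y c ∈ g) : s(y 0, y 1) ∈ lball (max c 1) g := by
  have h1 : ∀ i < r, IsNNEdge s(y i, y (i + 1)) := fun i hi => isNNEdge_mk.2 (hy.1 i hi)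
  have h0 : s(y (c - 1), y (c - 1 + 1)) ∈ lball 1 g := by
    rw [show (1 : ℕ) = 0 + 1 from rfl, lball, lball, Finset.singleton_biUnion]
    refine mem_lnb.2 ⟨hg, h1 _ (by omega), y c, hv, ?_⟩
    rw [Sym2.mem_iff]
    rcases Nat.eq_zero_or_pos c with rfl | hc0
    · exact Or.inl rfl
    · right; congr 1; omega
  have h2 := mem_lball_chain (m := c - 1) (f := fun j => s(y (c - 1 - j), y (c - 1 - j + 1)))
    fun i hi => mem_lnb.2 ⟨h1 _ (by omega), h1 _ (by omega), y (c - 1 - i), by simp, by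
      rw [Sym2.mem_iff]; right; congr 1; omega⟩
  have h3 := lball_trans h0 h2
  rw [show 1 + (c - 1) = max c 1 by omega] at h3
  simpa using h3

/-- The union of the surgery events for chains of length `M` which end at a pivotal edge. -/
def ChainEv (κ : ℕ) (p : ℝ) (n M m : ℕ) (w : ℕ → Edge d) (U : Config d) : Prop :=
  ∃ K ∈ ((Finset.range (m + 1)).biUnion fun i => lnb (w i)).powerset,
    (M = m ∧ ∀ i ≤ m, w i ∈ K) ∧ (∀ i, i + 1 < m → U (w i) < U (w (i + 1))) ∧
      Piv κ p n (w m) (rem K U)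

lemma IsProductUniform.chainEv_bound (hP : IsProductUniform P) (hd : 1 ≤ d) {δ : ℝ≥0∞}
    (hδ : Tol p δ) {n M m : ℕ} (hm : m ≤ M) {w : ℕ → Edge d} {S : ℝ≥0∞}
    (hS : P {U | Piv κ p n (w m) U} ≤ S) :
    P {U | ChainEv κ p n M m w U} ≤ base d δ ^ (M + 1) * (M.factorial : ℝ≥0∞)⁻¹ * S := by
  set b : ℝ≥0∞ := (M.factorial : ℝ≥0∞)⁻¹ * (δ⁻¹ ^ ((M + 1) * growth d) * S) with hb
  have hcard : ((Finset.range (m + 1)).biUnion fun i => lnb (w i)).card ≤ (M + 1) * growth d :=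
    (card_chain_le hm w).trans (Nat.mul_le_mul_left _ (Nat.le_add_right _ _))
  have key : P {U | ChainEv κ p n M m w U} ≤ ((2 ^ ((M + 1) * growth d) : ℕ) : ℝ≥0∞) * b := by
    refine measure_exists_le (by
      rw [Finset.card_powerset]
      exact Nat.pow_le_pow_right (by omega) hcard) fun K hK => ?_
    by_cases hc : M = m ∧ ∀ i ≤ m, w i ∈ K
    · refine (measure_mono fun U hU => hU.2).trans ?_
      obtain ⟨rfl, hw⟩ := hc
      have hG : MeasurableSet {U | Piv κ p n (w M) U} :=
        measurableSet_setOfPred.2 (measurable_piv n _)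
      have hKc := (Finset.card_le_card (Finset.mem_powerset.1 hK)).trans hcard
      refine (le_inv_mul_of_mul_le (by exact_mod_cast M.factorial_ne_zero)
        (ENNReal.natCast_ne_top _) (hP.mono_bound M w K (fun i hi => hw i hi.le) hG)).trans ?_
      refine mul_le_mul' le_rfl (hP.rem_bound hδ K ∅ hKc hG ((measure_mono_ae ?_).trans hS))
      filter_upwards [hP.ae_wf] with U hU hA
      exact piv_of_rem hδ.lt_two hU (hw M le_rfl) (fun g hg => (hA.1 g hg).2 (by simp)) hA.2
    · simp [hc]
  refine key.trans ?_
  have h1 : (1 : ℝ≥0∞) ≤ ((4 * (2 * d) ^ 2 : ℕ) : ℝ≥0∞) ^ (M + 1) := by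
    have : 1 ≤ (4 * (2 * d) ^ 2) ^ (M + 1) := Nat.one_le_pow _ _ (by positivity)
    exact_mod_cast this
  calc _ = 1 * ((2 ^ growth d) ^ (M + 1) * (δ⁻¹ ^ growth d) ^ (M + 1) *
        (M.factorial : ℝ≥0∞)⁻¹ * S) := by
        rw [hb]
        push_cast
        rw [mul_comm (M + 1) (growth d), pow_mul, pow_mul]
        ring
    _ ≤ ((4 * (2 * d) ^ 2 : ℕ) : ℝ≥0∞) ^ (M + 1) * ((2 ^ growth d) ^ (M + 1) *
        (δ⁻¹ ^ growth d) ^ (M + 1) * (M.factorial : ℝ≥0∞)⁻¹ * S) := by gcongr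
    _ = _ := by
        rw [base]
        push_cast
        simp only [mul_pow]
        ring

lemma IsProductUniform.flip_bound (hP : IsProductUniform P) (hd : 1 ≤ d) (hκ : 2 ≤ κ) {δ : ℝ≥0∞}
    (hδ : Tol p δ) {n : ℕ} (hn : 1 ≤ n) (e : Edge d) (he : IsNNEdge e) :
    P {U | ¬ (Arm κ U p n 0 ↔ Arm κ (rem {e} U) p n 0)} ≤
      ∑' M : ℕ, (((24 * d : ℕ) : ℝ≥0∞) * base d δ) ^ (M + 1) * (M.factorial : ℝ≥0∞)⁻¹ *
        ∑ g ∈ lball (2 * M + 1) e, P {U | Piv κ p n g U} := by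
  set S : ℕ → ℝ≥0∞ := fun M => ∑ g ∈ lball (2 * M + 1) e, P {U | Piv κ p n g U} with hSdef
  have hsub : P {U | ¬ (Arm κ U p n 0 ↔ Arm κ (rem {e} U) p n 0)} ≤
      P (⋃ M : ℕ, {U | ∃ m ∈ Finset.range (M + 1), ∃ w ∈ walks lnb m e,
        ChainEv κ p n M m w U ∨ ∃ v ∈ (w m).toFinset, TailEv κ p n M m w v U}) := by
    refine measure_mono_ae ?_
    filter_upwards [hP.ae_nice] with U hU hA
    obtain ⟨m, w, hw, hlt, ⟨K, hK, h1, h2⟩ |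
        ⟨v, hv, c₁, c₂, up, hup, dn, hdn, K, hK, h1, h2, h3⟩⟩ :=
      exists_surgery hδ.lt_two hU.wf hU.wfUp hU.inj hn e he hA
    · exact Set.mem_iUnion.2 ⟨m, m, by simp, w, hw, Or.inl ⟨K, Finset.mem_powerset.2 hK, ⟨rfl, h1⟩,
        hlt, h2⟩⟩
    · refine Set.mem_iUnion.2 ⟨max m (max (c₁ - 1) c₂), m, ?_, w, hw, Or.inr ⟨v, by simpa using hv,
        c₁, ?_, c₂, ?_, up, hup, dn, hdn, K, Finset.mem_powerset.2 hK, ⟨?_, h1, h2⟩, hlt, h3⟩⟩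
      · simp only [Finset.mem_range]; omega
      · simp only [Finset.mem_range]; omega
      · simp only [Finset.mem_range]; omega
      · omega
  refine hsub.trans ((measure_iUnion_le _).trans (ENNReal.tsum_le_tsum fun M => ?_))
  set X := base d δ ^ (M + 1) * (M.factorial : ℝ≥0∞)⁻¹ * S M with hX
  have key : P {U | ∃ m ∈ Finset.range (M + 1), ∃ w ∈ walks lnb m e,
      ChainEv κ p n M m w U ∨ ∃ v ∈ (w m).toFinset, TailEv κ p n M m w v U} ≤
      ((M + 1 : ℕ) : ℝ≥0∞) * ((((4 * d) ^ (M + 1) : ℕ) : ℝ≥0∞) * (X + (2 : ℕ) * X)) := by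
    refine measure_exists_le (by simp) fun m hm => ?_
    simp only [Finset.mem_range] at hm
    refine measure_exists_le ((card_walks_le card_lnb_le m e).trans
      (Nat.pow_le_pow_right (by omega) (by omega))) fun w hw => ?_
    obtain ⟨hwm, hwn⟩ := walks_mem_lball he hw
    refine (measure_union_le _ _).trans (add_le_add ?_ ?_)
    · refine hP.chainEv_bound hd hδ (by omega) ?_
      exact Finset.single_le_sum (f := fun g => P {U | Piv κ p n g U}) (fun _ _ => zero_le)
        (lball_mono (by omega) hwn hwm)
    · refine measure_exists_le (card_toFinset_le _) fun v hv => ?_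
      rw [Sym2.mem_toFinset] at hv
      refine hP.tailEv_bound hd hδ (by omega) fun r y c K hr hc hcM hy hyc hyK => ?_
      have hmem : s(y 0, y 1) ∈ lball (2 * M + 1) e :=
        lball_mono (by omega) (isNNEdge_mk.2 (hy.1 0 hr))
          (lball_trans hwm (hy.mem_lball hr hc hwn (hyc ▸ hv)))
      refine le_trans ?_ (Finset.single_le_sum (f := fun g => P {U | Piv κ p n g U})
        (fun _ _ => zero_le) hmem)
      refine measure_mono_ae ?_
      filter_upwards [hP.ae_wf] with U hU hA
      obtain ⟨h1, s, x, h2⟩ := hA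
      exact h2.piv hκ hδ.lt_two hU hyK (fun f hf => (h1 f (hyK hf)).1 hf) fun f hf => (h1 f hf).2
  refine key.trans ?_
  have e2 : ((M + 1 : ℕ) : ℝ≥0∞) ≤ ((2 ^ (M + 1) : ℕ) : ℝ≥0∞) := by
    exact_mod_cast (Nat.lt_two_pow_self (n := M + 1)).le
  have e3 : (3 : ℝ≥0∞) ≤ 3 ^ (M + 1) := le_self_pow₀ (by norm_num) (by omega)
  calc _ = ((M + 1 : ℕ) : ℝ≥0∞) * ((((4 * d) ^ (M + 1) : ℕ) : ℝ≥0∞) * (3 * X)) := by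
        congr 2; push_cast; ring
    _ ≤ ((2 ^ (M + 1) : ℕ) : ℝ≥0∞) * ((((4 * d) ^ (M + 1) : ℕ) : ℝ≥0∞) * (3 ^ (M + 1) * X)) := by
        gcongr
    _ = _ := by
        have : ((24 * d : ℕ) : ℝ≥0∞) = 2 * (4 * d) * 3 := by push_cast; ring
        rw [this, hX]
        push_cast
        rw [mul_pow _ (base d δ), mul_pow _ 3, mul_pow 2]
        ring

/-- The constant in the comparison between influences and pivotal probabilities. -/
noncomputable def flipConst (d : ℕ) (δ : ℝ≥0∞) : ℝ≥0∞ :=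
  expSum (((24 * d * (4 * d) ^ 2 : ℕ) : ℝ≥0∞) * base d δ)

lemma flipConst_ne_top {δ : ℝ≥0∞} (hδ : δ ≠ 0) : flipConst d δ ≠ ⊤ :=
  expSum_ne_top (ENNReal.mul_ne_top (ENNReal.natCast_ne_top _) (base_ne_top hδ))

lemma IsProductUniform.flip_sum_le (hP : IsProductUniform P) (hd : 1 ≤ d) (hκ : 2 ≤ κ) {δ : ℝ≥0∞}
    (hδ : Tol p δ) {n : ℕ} (hn : 1 ≤ n) :
    ∑' e : Edge d, (if IsNNEdge e then P {U | ¬ (Arm κ U p n 0 ↔ Arm κ (rem {e} U) p n 0)} else 0) ≤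
      flipConst d δ * ∑' g : Edge d, P {U | Piv κ p n g U} := by
  calc _ ≤ ∑' e : Edge d, ∑' M : ℕ, (((24 * d : ℕ) : ℝ≥0∞) * base d δ) ^ (M + 1) *
        (M.factorial : ℝ≥0∞)⁻¹ * ∑ g ∈ lball (2 * M + 1) e, P {U | Piv κ p n g U} := by
        refine ENNReal.tsum_le_tsum fun e => ?_
        split_ifs with he
        · exact hP.flip_bound hd hκ hδ hn e he
        · exact zero_le
    _ = ∑' M : ℕ, (((24 * d : ℕ) : ℝ≥0∞) * base d δ) ^ (M + 1) * (M.factorial : ℝ≥0∞)⁻¹ *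
        ∑' e : Edge d, ∑ g ∈ lball (2 * M + 1) e, P {U | Piv κ p n g U} := by
        rw [ENNReal.tsum_comm]
        exact tsum_congr fun M => ENNReal.tsum_mul_left
    _ ≤ ∑' M : ℕ, (((24 * d * (4 * d) ^ 2 : ℕ) : ℝ≥0∞) * base d δ) ^ (M + 1) *
        (M.factorial : ℝ≥0∞)⁻¹ * ∑' g : Edge d, P {U | Piv κ p n g U} := by
        refine ENNReal.tsum_le_tsum fun M => ?_
        have h1 : ((4 * d : ℕ) : ℝ≥0∞) ^ (2 * M + 1) ≤ (((4 * d) ^ 2 : ℕ) : ℝ≥0∞) ^ (M + 1) := by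
          rw [Nat.cast_pow, ← pow_mul]
          exact pow_le_pow_right₀ (by exact_mod_cast (by omega : 1 ≤ 4 * d)) (by omega)
        calc _ ≤ (((24 * d : ℕ) : ℝ≥0∞) * base d δ) ^ (M + 1) * (M.factorial : ℝ≥0∞)⁻¹ *
              ((((4 * d) ^ 2 : ℕ) : ℝ≥0∞) ^ (M + 1) * ∑' g : Edge d, P {U | Piv κ p n g U}) := by
              gcongr
              exact (tsum_lball_le _ _).trans (mul_le_mul' h1 le_rfl)
          _ = _ := by
              rw [Nat.cast_mul (24 * d), mul_pow, mul_pow (_ * _) (base d δ),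
                mul_pow _ (((4 * d) ^ 2 : ℕ) : ℝ≥0∞)]
              ring
    _ = _ := by rw [ENNReal.tsum_mul_right]; rfl

end

section
open scoped Classical ENNReal
variable {d : ℕ} {κ : ℕ} {p : ℝ} {P : Measure (Config d)}

/-- A fixed enumeration of the edges. -/
noncomputable def enc : Edge d → ℕ := (exists_injective_nat (Edge d)).choose

lemma enc_injective : Function.Injective (enc : Edge d → ℕ) :=
  (exists_injective_nat (Edge d)).choose_spec

/-- `e` is the candidate to be revealed next, once `A` is revealed. -/
def IsNext (C : Finset (Edge d) → Config d → Edge d → Prop) (A : Finset (Edge d)) (U : Config d)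
    (e : Edge d) : Prop := C A U e ∧ ∀ e', C A U e' → enc e ≤ enc e'

/-- The set of edges revealed after `t` steps of the exploration with candidates `C`. -/
noncomputable def expl (C : Finset (Edge d) → Config d → Edge d → Prop) :
    ℕ → Config d → Finset (Edge d)
  | 0, _ => ∅
  | t + 1, U => if h : ∃ e, IsNext C (expl C t U) U e then insert h.choose (expl C t U)
      else expl C t U

/-- The candidates are unrevealed edges, chosen from the information revealed so far. -/
structure Rule (C : Finset (Edge d) → Config d → Edge d → Prop) : Prop where
  meas : ∀ A e, Measurable fun U => C A U e
  notMem : ∀ A U e, C A U e → e ∉ A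
  congr : ∀ A U V e, (∀ f ∈ A, U f = V f) → C A U e → C A V e

variable {C : Finset (Edge d) → Config d → Edge d → Prop}

lemma IsNext.unique {A : Finset (Edge d)} {U : Config d} {e f : Edge d} (he : IsNext C A U e)
    (hf : IsNext C A U f) : e = f :=
  enc_injective (le_antisymm (he.2 f hf.1) (hf.2 e he.1))

lemma exists_isNext {A : Finset (Edge d)} {U : Config d} (h : ∃ e, C A U e) :
    ∃ e, IsNext C A U e := by
  obtain ⟨e, he, hm⟩ := (measure (enc : Edge d → ℕ)).wf.has_min {e | C A U e} h
  exact ⟨e, he, fun f hf => not_lt.1 (hm f hf)⟩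

lemma Rule.isNext_congr (hC : Rule C) {A : Finset (Edge d)} {U V : Config d} {e : Edge d}
    (h : ∀ f ∈ A, U f = V f) (he : IsNext C A U e) : IsNext C A V e :=
  ⟨hC.congr A U V e h he.1, fun f hf => he.2 f (hC.congr A V U f (fun g hg => (h g hg).symm) hf)⟩

lemma expl_succ_of_isNext {t : ℕ} {U : Config d} {e : Edge d} (h : IsNext C (expl C t U) U e) :
    expl C (t + 1) U = insert e (expl C t U) := by
  have h' : ∃ e, IsNext C (expl C t U) U e := ⟨e, h⟩
  rw [expl, dif_pos h', h'.choose_spec.unique h]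

lemma expl_succ_of_not {t : ℕ} {U : Config d} (h : ¬ ∃ e, IsNext C (expl C t U) U e) :
    expl C (t + 1) U = expl C t U := by rw [expl, dif_neg h]

lemma expl_subset_succ (t : ℕ) (U : Config d) : expl C t U ⊆ expl C (t + 1) U := by
  by_cases h : ∃ e, IsNext C (expl C t U) U e
  · obtain ⟨e, he⟩ := h
    rw [expl_succ_of_isNext he]
    exact Finset.subset_insert _ _
  · rw [expl_succ_of_not h]

lemma expl_mono (U : Config d) : Monotone fun t => expl C t U :=
  monotone_nat_of_le_succ fun t => expl_subset_succ t U

lemma Rule.expl_congr (hC : Rule C) {t : ℕ} {U V : Config d}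
    (h : ∀ f ∈ expl C t U, U f = V f) : expl C t V = expl C t U := by
  induction t with
  | zero => rfl
  | succ t ih =>
    have h' : ∀ f ∈ expl C t U, U f = V f := fun f hf => h f (expl_subset_succ t U hf)
    have ih := ih h'
    by_cases hn : ∃ e, IsNext C (expl C t U) U e
    · obtain ⟨e, he⟩ := hn
      have he' := hC.isNext_congr h' he
      rw [← ih] at he'
      rw [expl_succ_of_isNext he, expl_succ_of_isNext he', ih]
    · rw [expl_succ_of_not hn, expl_succ_of_not, ih]
      rintro ⟨e, he⟩
      rw [ih] at he
      exact hn ⟨e, hC.isNext_congr (fun f hf => (h' f hf).symm) he⟩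

lemma Rule.measurable_isNext (hC : Rule C) (A : Finset (Edge d)) (e : Edge d) :
    Measurable fun U => IsNext C A U e := by
  have := hC.meas
  unfold IsNext
  fun_prop

lemma Rule.measurable_expl (hC : Rule C) (t : ℕ) :
    ∀ A : Finset (Edge d), Measurable fun U => expl C t U = A := by
  induction t with
  | zero =>
    intro A
    show Measurable fun _ : Config d => (∅ : Finset (Edge d)) = A
    exact measurable_const
  | succ t ih =>
    intro A
    have key : (fun U => expl C (t + 1) U = A) = fun U => ∃ B : Finset (Edge d), expl C t U = B ∧
        ((∃ e, IsNext C B U e ∧ insert e B = A) ∨ ((∀ e, ¬ IsNext C B U e) ∧ B = A)) := by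
      ext U
      by_cases hn : ∃ e, IsNext C (expl C t U) U e
      · obtain ⟨e, he⟩ := hn
        rw [expl_succ_of_isNext he]
        constructor
        · exact fun h => ⟨_, rfl, Or.inl ⟨e, he, h⟩⟩
        · rintro ⟨B, rfl, ⟨f, hf, h⟩ | ⟨h, _⟩⟩
          · rwa [he.unique hf]
          · exact absurd he (h e)
      · rw [expl_succ_of_not hn]
        constructor
        · exact fun h => ⟨_, rfl, Or.inr ⟨not_exists.1 hn, h⟩⟩
        · rintro ⟨B, rfl, ⟨f, hf, h⟩ | ⟨_, h⟩⟩
          · exact absurd ⟨f, hf⟩ hn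
          · exact h
    rw [key]
    have := hC.measurable_isNext
    fun_prop

lemma Rule.measurable_isNext_expl (hC : Rule C) (t : ℕ) (e : Edge d) :
    Measurable fun U => IsNext C (expl C t U) U e := by
  have : (fun U => IsNext C (expl C t U) U e) =
      fun U => ∃ A : Finset (Edge d), expl C t U = A ∧ IsNext C A U e := by
    ext U; simp
  rw [this]
  have := hC.measurable_expl t
  have := hC.measurable_isNext
  fun_prop

lemma Rule.sum_isNext_le (hC : Rule C) (M : ℕ) (e : Edge d) :
    ∑ t ∈ Finset.range M, P {U | IsNext C (expl C t U) U e} ≤ P {U | e ∈ expl C M U} := by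
  rw [← measure_biUnion_finset]
  · refine measure_mono fun U hU => ?_
    simp only [Set.mem_iUnion, Finset.mem_range, Set.mem_ofPred_eq, exists_prop] at hU ⊢
    obtain ⟨t, ht, h⟩ := hU
    refine expl_mono U (Nat.succ_le_of_lt ht) ?_
    show e ∈ expl C (t + 1) U
    rw [expl_succ_of_isNext h]
    exact Finset.mem_insert_self _ _
  · have aux : ∀ s t U, s < t → IsNext C (expl C s U) U e → ¬ IsNext C (expl C t U) U e := by
      intro s t U hst h h'
      refine hC.notMem _ _ _ h'.1 (expl_mono U (Nat.succ_le_of_lt hst) ?_)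
      show e ∈ expl C (s + 1) U
      rw [expl_succ_of_isNext h]
      exact Finset.mem_insert_self _ _
    intro s _ t _ hst
    refine Set.disjoint_left.2 fun U hs ht => ?_
    rcases lt_or_gt_of_ne hst with h | h
    · exact aux s t U h hs ht
    · exact aux t s U h ht hs
  · exact fun t _ => measurableSet_setOfPred.2 (hC.measurable_isNext_expl t e)

lemma rem_singleton_hyb_insert (A : Finset (Edge d)) (e : Edge d) (X Y : Config d) :
    rem {e} (hyb (insert e A : Finset (Edge d)) X Y) = rem {e} (hyb A X Y) := by
  ext f
  by_cases h : f = e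
  · simp [rem, h]
  · rw [rem_of_notMem (by simpa using h), rem_of_notMem (by simpa using h)]
    simp [hyb, h]

lemma IsProductUniform.step_bound (hP : IsProductUniform P) (hC : Rule C) {G : Config d → Prop}
    (hG : Measurable G) (t : ℕ) (e : Edge d) :
    (P.prod P) {q | IsNext C (expl C t q.1) q.1 e ∧
      ¬ (G (hyb (expl C t q.1) q.1 q.2) ↔ G (hyb (expl C (t + 1) q.1) q.1 q.2))} ≤
    2 * (P {U | IsNext C (expl C t U) U e} * P {U | ¬ (G U ↔ G (rem {e} U))}) := by
  set E : Finset (Edge d) → Set (Config d) := fun A => {U | expl C t U = A ∧ IsNext C A U e}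
  set B : Set (Config d) := {U | ¬ (G U ↔ G (rem {e} U))}
  have hBm : MeasurableSet B := by
    have : Measurable fun U => G (rem {e} U) := hG.comp (measurable_rem {e})
    exact measurableSet_setOfPred.2 (hG.iff this).not
  have hEm : ∀ A, MeasurableSet (E A) := fun A => measurableSet_setOfPred.2 <|
    (hC.measurable_expl t A).and (hC.measurable_isNext A e)
  have hEdet : ∀ (A : Finset (Edge d)) (R : Set (Edge d)), (A : Set (Edge d)) ⊆ R →
      ∀ U V : Config d, (∀ f ∈ R, U f = V f) → (U ∈ E A ↔ V ∈ E A) := by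
    have aux : ∀ (A : Finset (Edge d)) (U V : Config d), (∀ f ∈ A, U f = V f) →
        U ∈ E A → V ∈ E A := by
      rintro A U V h ⟨rfl, h2⟩
      exact ⟨hC.expl_congr h, hC.isNext_congr h h2⟩
    exact fun A R hR U V h => ⟨aux A U V fun f hf => h f (hR hf),
      aux A V U fun f hf => (h f (hR hf)).symm⟩
  have hsum : ∑' A, P (E A) = P {U | IsNext C (expl C t U) U e} := by
    rw [← measure_iUnion _ hEm]
    · congr 1
      ext U
      simp [E]
    · intro A A' hAA
      refine Set.disjoint_left.2 fun U h h' => hAA ?_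
      exact h.1.symm.trans h'.1
  calc (P.prod P) {q | IsNext C (expl C t q.1) q.1 e ∧
      ¬ (G (hyb (expl C t q.1) q.1 q.2) ↔ G (hyb (expl C (t + 1) q.1) q.1 q.2))}
      ≤ (P.prod P) (⋃ A : Finset (Edge d), ({q | q.1 ∈ E A ∧ hyb A q.1 q.2 ∈ B} ∪
          {q | q.1 ∈ E A ∧ hyb (insert e A : Finset (Edge d)) q.1 q.2 ∈ B})) := by
        refine measure_mono ?_
        rintro q ⟨h1, h2⟩
        rw [expl_succ_of_isNext h1] at h2
        refine Set.mem_iUnion.2 ⟨expl C t q.1, ?_⟩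
        have hE : q.1 ∈ E (expl C t q.1) := ⟨rfl, h1⟩
        have hr := rem_singleton_hyb_insert (expl C t q.1) e q.1 q.2
        by_contra hn
        simp only [Set.mem_union, Set.mem_ofPred_eq, hE, true_and, B, not_or, not_not, hr] at hn
        exact h2 (hn.1.trans hn.2.symm)
    _ ≤ ∑' A : Finset (Edge d), (P (E A) * P B + P (E A) * P B) := by
        refine (measure_iUnion_le _).trans (ENNReal.tsum_le_tsum fun A => ?_)
        refine (measure_union_le _ _).trans (add_le_add ?_ ?_)
        · exact (hP.prod_indep _ (hEm A) hBm (hEdet A _ subset_rfl)).le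
        · exact (hP.prod_indep _ (hEm A) hBm (hEdet A _ (by simp))).le
    _ = 2 * (P {U | IsNext C (expl C t U) U e} * P B) := by
        rw [← hsum, ← ENNReal.tsum_mul_right, ← ENNReal.tsum_mul_left]
        exact tsum_congr fun A => (two_mul _).symm

/-- The **OSSS inequality** for an exploration which certifies `G` by the event `F`. -/
theorem IsProductUniform.osss (hP : IsProductUniform P) (hC : Rule C) {G : Config d → Prop}
    (hG : Measurable G) {F : Finset (Edge d) → Config d → Prop} (hF : ∀ A, Measurable (F A))
    (hFdet : ∀ A U V, (∀ f ∈ A, U f = V f) → F A U → F A V) (M : ℕ)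
    (hFG : ∀ᵐ U ∂P, F (expl C M U) U → G U) :
    P {U | F (expl C M U) U} * P {U | ¬ G U} ≤
      2 * ∑' e, P {U | e ∈ expl C M U} * P {U | ¬ (G U ↔ G (rem {e} U))} := by
  have := hP.1
  set E : Finset (Edge d) → Set (Config d) := fun A => {U | expl C M U = A ∧ F A U}
  set B : Set (Config d) := {U | ¬ G U}
  have hBm : MeasurableSet B := measurableSet_setOfPred.2 hG.not
  have hEm : ∀ A, MeasurableSet (E A) := fun A => measurableSet_setOfPred.2 <|
    (hC.measurable_expl M A).and (hF A)
  have hEdet : ∀ A : Finset (Edge d), ∀ U V : Config d, (∀ f ∈ (A : Set (Edge d)), U f = V f) →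
      (U ∈ E A ↔ V ∈ E A) := by
    have aux : ∀ (A : Finset (Edge d)) (U V : Config d), (∀ f ∈ A, U f = V f) →
        U ∈ E A → V ∈ E A := by
      rintro A U V h ⟨rfl, h2⟩
      exact ⟨hC.expl_congr h, hFdet _ U V h h2⟩
    exact fun A U V h => ⟨aux A U V fun f hf => h f hf, aux A V U fun f hf => (h f hf).symm⟩
  have hae : ∀ᵐ q ∂(P.prod P), F (expl C M q.1) q.1 → G q.1 :=
    Measure.quasiMeasurePreserving_fst.ae hFG
  calc P {U | F (expl C M U) U} * P B
      ≤ (∑' A, P (E A)) * P B := by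
        gcongr
        refine (measure_mono fun U hU => ?_).trans (measure_iUnion_le _)
        exact Set.mem_iUnion.2 ⟨expl C M U, rfl, hU⟩
    _ = (P.prod P) (⋃ A : Finset (Edge d), {q | q.1 ∈ E A ∧ hyb A q.1 q.2 ∈ B}) := by
        rw [measure_iUnion, ← ENNReal.tsum_mul_right]
        · exact tsum_congr fun A => (hP.prod_indep _ (hEm A) hBm (hEdet A)).symm
        · intro A A' hAA
          refine Set.disjoint_left.2 fun U h h' => hAA ?_
          exact h.1.1.symm.trans h'.1.1
        · exact fun A => ((hEm A).preimage measurable_fst).inter (hBm.preimage (measurable_hyb _))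
    _ ≤ (P.prod P) (⋃ t ∈ Finset.range M, ⋃ e, {q | IsNext C (expl C t q.1) q.1 e ∧
          ¬ (G (hyb (expl C t q.1) q.1 q.2) ↔ G (hyb (expl C (t + 1) q.1) q.1 q.2))}) := by
        refine measure_mono_ae ?_
        filter_upwards [hae] with q hq hqm
        obtain ⟨A, ⟨⟨hA, hFA⟩, hB⟩⟩ := Set.mem_iUnion.1 hqm
        subst hA
        have h0 : G (hyb (expl C 0 q.1) q.1 q.2) := by
          have : hyb (expl C 0 q.1) q.1 q.2 = q.1 := by
            ext e
            simp [expl, hyb]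
          rw [this]
          exact hq hFA
        by_contra hn
        have hn' : ∀ t < M, ∀ e, IsNext C (expl C t q.1) q.1 e →
            (G (hyb (expl C t q.1) q.1 q.2) ↔ G (hyb (expl C (t + 1) q.1) q.1 q.2)) := by
          intro t ht e he
          by_contra hc
          refine hn (Set.mem_iUnion₂.2 ⟨t, Finset.mem_range.2 ht, Set.mem_iUnion.2 ⟨e, he, hc⟩⟩)
        have hall : ∀ t ≤ M, G (hyb (expl C t q.1) q.1 q.2) := by
          intro t
          induction t with
          | zero => exact fun _ => h0
          | succ t ih =>
            intro ht
            by_cases hx : ∃ e, IsNext C (expl C t q.1) q.1 e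
            · obtain ⟨e, he⟩ := hx
              exact (hn' t (by omega) e he).1 (ih (by omega))
            · rw [expl_succ_of_not hx]
              exact ih (by omega)
        exact hB (hall M le_rfl)
    _ ≤ ∑ t ∈ Finset.range M, ∑' e, 2 * (P {U | IsNext C (expl C t U) U e} *
          P {U | ¬ (G U ↔ G (rem {e} U))}) := by
        refine (measure_biUnion_finset_le _ _).trans (Finset.sum_le_sum fun t _ => ?_)
        exact (measure_iUnion_le _).trans (ENNReal.tsum_le_tsum fun e => hP.step_bound hC hG t e)
    _ = 2 * ∑' e, (∑ t ∈ Finset.range M, P {U | IsNext C (expl C t U) U e}) *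
          P {U | ¬ (G U ↔ G (rem {e} U))} := by
        rw [← Summable.tsum_finsetSum fun _ _ => ENNReal.summable, ← ENNReal.tsum_mul_left]
        refine tsum_congr fun e => ?_
        rw [Finset.sum_mul, Finset.mul_sum]
    _ ≤ _ := by
        gcongr with e
        exact hC.sum_isNext_le M e

end

section
open scoped Classical ENNReal
variable {d : ℕ} {κ : ℕ} {p : ℝ} {P : Measure (Config d)}

/-- The edge opens at its arrival time, for the order of arrival `r`. -/
def mo (κ : ℕ) (r : Edge d → Edge d → Prop) (e : Edge d) : Prop := ∃ m₀, ∀ m ≥ m₀, opm κ r m e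

/-- All edges that influence the state of `g` have been revealed. -/
def Settled (A : Finset (Edge d)) (r : Edge d → Edge d → Prop) (g : Edge d) : Prop :=
  ∀ g', Relation.ReflTransGen (fun a b => LAdj b a ∧ r b a) g g' →
    g' ∈ A ∧ ∀ h, LAdj h g' → h ∈ A

/-- Vertices known to be connected to the sphere of radius `k` inside the ball of radius `n`, when
the edges of `A` are revealed, `r` is the order of arrival and `q` is arrival before time `p`. -/
inductive OReach (κ n k : ℕ) (A : Finset (Edge d)) (r : Edge d → Edge d → Prop)
    (q : Edge d → Prop) : Vertex d → Prop
  | base (v : Vertex d) (h : norm1 v = k) : OReach κ n k A r q v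
  | step (u v : Vertex d) (hu : OReach κ n k A r q u) (huv : adj u v) (hv : norm1 v ≤ n)
      (hs : Settled A r s(u, v)) (hq : q s(u, v)) (hm : mo κ r s(u, v)) : OReach κ n k A r q v

/-- Oriented edges at the end of a revealed walk that consists of open edges followed by edges of
decreasing labels. -/
inductive DReach (κ n k : ℕ) (A : Finset (Edge d)) (r : Edge d → Edge d → Prop)
    (q : Edge d → Prop) : Vertex d → Vertex d → Prop
  | base (a b : Vertex d) (ha : OReach κ n k A r q a) (hab : adj a b) (hA : s(a, b) ∈ A)
      (hq : q s(a, b)) : DReach κ n k A r q a b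
  | step (a b c : Vertex d) (hab : DReach κ n k A r q a b) (hbc : adj b c) (hA : s(b, c) ∈ A)
      (hr : r s(b, c) s(a, b)) : DReach κ n k A r q b c

/-- Vertices reached by the exploration. -/
def Reached (κ n k : ℕ) (A : Finset (Edge d)) (r : Edge d → Edge d → Prop) (q : Edge d → Prop)
    (v : Vertex d) : Prop := OReach κ n k A r q v ∨ ∃ a, DReach κ n k A r q a v

/-- The configuration `U` where only the labels of `A` are known. -/
noncomputable def res (A : Finset (Edge d)) (U : Config d) : Config d :=
  fun e => if e ∈ A then U e else 2

lemma res_of_mem {A : Finset (Edge d)} {U : Config d} {e : Edge d} (h : e ∈ A) :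
    res A U e = U e := if_pos h

lemma res_of_notMem {A : Finset (Edge d)} {U : Config d} {e : Edge d} (h : e ∉ A) :
    res A U e = 2 := if_neg h

lemma res_congr {A : Finset (Edge d)} {U V : Config d} (h : ∀ f ∈ A, U f = V f) :
    res A U = res A V := by
  ext e
  by_cases he : e ∈ A
  · rw [res_of_mem he, res_of_mem he, h e he]
  · rw [res_of_notMem he, res_of_notMem he]

lemma wf_res (A : Finset (Edge d)) (U : Config d) : Wf (res A U) :=
  wf_of_finite 2 A A.finite_toSet fun _ he => res_of_notMem (by simpa using he)

/-- The order of arrival, as far as it is known from the labels of `A`. -/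
abbrev ltOn (A : Finset (Edge d)) (U : Config d) (f g : Edge d) : Prop := res A U f < res A U g

/-- Arrival before time `p`, as far as it is known from the labels of `A`. -/
abbrev leOn (p : ℝ) (A : Finset (Edge d)) (U : Config d) (f : Edge d) : Prop := res A U f ≤ p

/-- Unrevealed edges at the vertices reached by the exploration from the sphere of radius `k`. -/
def Cand (κ : ℕ) (p : ℝ) (n k : ℕ) (A : Finset (Edge d)) (U : Config d) (e : Edge d) : Prop :=
  IsNNEdge e ∧ e ∉ A ∧ ∃ v ∈ e,
    Reached κ n k A (ltOn A U) (leOn p A U) v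

variable {n k : ℕ} {A : Finset (Edge d)} {U : Config d}

lemma Settled.mop_iff (hU : Wf U) {g : Edge d} (hg : IsNNEdge g) (h : Settled A (ltOn A U) g) :
    mop κ U g ↔ mop κ (res A U) g := by
  refine mop_congr hU (wf_res A U) {g | Settled A (ltOn A U) g} ?_ ?_ g h hg
  · intro e he f hf hlt g' hg'
    refine he g' (.head ⟨hf, ?_⟩ hg')
    rwa [ltOn, res_of_mem ((he e .refl).2 f hf), res_of_mem (he e .refl).1]
  · intro e he f hf
    rw [res_of_mem ((he e .refl).2 f hf), res_of_mem (he e .refl).1]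

lemma DReach.mem {a b : Vertex d} (h : DReach κ n k A (ltOn A U) (leOn p A U) a b) :
    s(a, b) ∈ A := by
  cases h <;> assumption

lemma DReach.adj {a b : Vertex d} (h : DReach κ n k A (ltOn A U) (leOn p A U) a b) : adj a b := by
  cases h <;> assumption

lemma DReach.le {a b : Vertex d} (h : DReach κ n k A (ltOn A U) (leOn p A U) a b) :
    res A U s(a, b) ≤ p := by
  induction h with
  | base a b ha hab hA hq => exact hq
  | step a b c hab hbc hA hr ih => exact hr.le.trans ih

lemma DReach.reached_left {a b : Vertex d} (h : DReach κ n k A (ltOn A U) (leOn p A U) a b) :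
    Reached κ n k A (ltOn A U) (leOn p A U) a := by
  cases h with
  | base a b ha hab hA hq => exact Or.inl ha
  | step z a b hza hab hA hr => exact Or.inr ⟨z, hza⟩

lemma DReach.sibling {a b c : Vertex d} (h : DReach κ n k A (ltOn A U) (leOn p A U) a b)
    (hac : CDP.adj a c) (hA : s(a, c) ∈ A) (hlt : res A U s(a, c) < res A U s(a, b)) :
    DReach κ n k A (ltOn A U) (leOn p A U) a c := by
  cases h with
  | base _ _ ha hab _ hq => exact .base a c ha hac hA (hlt.le.trans hq)
  | step z _ _ hza hab _ hr => exact .step z a c hza hac hA (hlt.trans hr)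

lemma exists_eq_mk_of_mem {h : Edge d} (hn : IsNNEdge h) {v : Vertex d} (hv : v ∈ h) :
    ∃ c, h = s(v, c) ∧ adj v c := by
  obtain ⟨c, rfl⟩ := Sym2.mem_iff_exists.1 hv
  exact ⟨c, rfl, isNNEdge_mk.1 hn⟩

lemma dReach_of_desc (hC : ∀ e, ¬ Cand κ p n k A U e) {v : Vertex d}
    (hv : OReach κ n k A (ltOn A U) (leOn p A U) v) {g : Edge d} (hg : IsNNEdge g) (hvg : v ∈ g)
    (hq : res A U g ≤ p) {g' : Edge d}
    (h : Relation.ReflTransGen (fun a b => LAdj b a ∧ ltOn A U b a) g g') :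
    ∃ a b, g' = s(a, b) ∧ DReach κ n k A (ltOn A U) (leOn p A U) a b := by
  have hmem : ∀ {e : Edge d} {v}, IsNNEdge e → v ∈ e →
      Reached κ n k A (ltOn A U) (leOn p A U) v → e ∈ A := by
    intro e v he hve hv
    by_contra hA
    exact hC e ⟨he, hA, v, hve, hv⟩
  induction h with
  | refl =>
    obtain ⟨w, rfl, hw⟩ := exists_eq_mk_of_mem hg hvg
    exact ⟨v, w, rfl, .base v w hv hw (hmem hg hvg (Or.inl hv)) hq⟩
  | tail _ hbc ih =>
    obtain ⟨a, b, rfl, hab⟩ := ih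
    obtain ⟨hl, hlt⟩ := hbc
    obtain ⟨u, hu, hu'⟩ := hl.2.2.2
    obtain ⟨c, rfl, hc⟩ := exists_eq_mk_of_mem hl.1 hu
    rcases Sym2.mem_iff.1 hu' with rfl | rfl
    · exact ⟨u, c, rfl, hab.sibling hc (hmem hl.1 hu hab.reached_left) hlt⟩
    · exact ⟨u, c, rfl, .step a u c hab hc (hmem hl.1 hu (Or.inr ⟨a, hab⟩)) hlt⟩

lemma OReach.settled (hC : ∀ e, ¬ Cand κ p n k A U e) {v : Vertex d}
    (hv : OReach κ n k A (ltOn A U) (leOn p A U) v) {g : Edge d} (hg : IsNNEdge g) (hvg : v ∈ g)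
    (hq : res A U g ≤ p) : Settled A (ltOn A U) g := by
  intro g' hg'
  obtain ⟨a, b, rfl, hab⟩ := dReach_of_desc hC hv hg hvg hq hg'
  refine ⟨hab.mem, fun h hl => ?_⟩
  obtain ⟨u, hu, hu'⟩ := hl.2.2.2
  by_contra hA
  refine hC h ⟨hl.1, hA, u, hu, ?_⟩
  rcases Sym2.mem_iff.1 hu' with rfl | rfl
  · exact hab.reached_left
  · exact Or.inr ⟨a, hab⟩

lemma OReach.oe_iff (hU : Wf U) (hC : ∀ e, ¬ Cand κ p n k A U e) {v : Vertex d}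
    (hv : OReach κ n k A (ltOn A U) (leOn p A U) v) {g : Edge d} (hvg : v ∈ g) :
    oe κ U p g ↔ oe κ (res A U) p g := by
  unfold oe
  refine and_congr_right fun hg => ?_
  have hA : g ∈ A := by
    by_contra hA
    exact hC g ⟨hg, hA, v, hvg, Or.inl hv⟩
  rw [← res_of_mem (U := U) hA]
  exact and_congr_right fun hq => (hv.settled hC hg hvg hq).mop_iff hU hg

lemma OReach.next (hC : ∀ e, ¬ Cand κ p n k A U e) {u v : Vertex d}
    (hu : OReach κ n k A (ltOn A U) (leOn p A U) u) (huv : adj u v) (hv : norm1 v ≤ n)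
    (ho : oe κ (res A U) p s(u, v)) : OReach κ n k A (ltOn A U) (leOn p A U) v :=
  .step u v hu huv hv (hu.settled hC ho.1 (Sym2.mem_mk_left _ _) ho.2.1) ho.2.1 ho.2.2

lemma norm1_step {x y : Vertex d} (h : adj x y) : |norm1 x - norm1 y| ≤ 1 := by
  unfold norm1
  rw [← Finset.sum_sub_distrib]
  refine (Finset.abs_sum_le_sum_abs _ _).trans (le_of_le_of_eq (Finset.sum_le_sum fun i _ => ?_) h)
  exact abs_abs_sub_abs_le_abs_sub _ _

lemma exists_norm1_eq (hkn : k ≤ n) {O : Edge d → Prop} {V : Config d} {K l : ℕ} {x : ℕ → Vertex d}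
    (h : Wit O V p n 0 K l x) : ∃ j ≤ K, norm1 (x j) = k := by
  have hK : norm1 (x K) ≤ k := by rw [h.fin]; simp [norm1]
  have hex : ∃ j, norm1 (x j) ≤ k := ⟨K, hK⟩
  refine ⟨Nat.find hex, Nat.find_min' hex hK, le_antisymm (Nat.find_spec hex) ?_⟩
  rcases Nat.eq_zero_or_pos (Nat.find hex) with h0 | h0
  · rw [h0]
    have := h.start
    simp only [sub_zero] at this
    rw [this]
    exact_mod_cast hkn
  · obtain ⟨i, hi⟩ : ∃ i, Nat.find hex = i + 1 := ⟨_, (Nat.succ_pred_eq_of_pos h0).symm⟩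
    have h1 := Nat.find_min hex (m := i) (by omega)
    have h2 := norm1_step (h.path.1 i (by have := Nat.find_min' hex hK; omega))
    rw [hi]
    have := (abs_le.1 h2).2
    omega

lemma Wit.norm_le {O : Edge d → Prop} {V : Config d} {K l : ℕ} {x : ℕ → Vertex d}
    (h : Wit O V p n 0 K l x) {i : ℕ} (hi : i ≤ K) : norm1 (x i) ≤ n := by
  rcases Nat.eq_zero_or_pos i with rfl | h0
  · have := h.start
    simp only [sub_zero] at this
    exact this.le
  · have := h.inside i h0 hi
    simp only [sub_zero] at this
    exact this.le

/-- If the exploration from a sphere is over, it has revealed all open paths through that sphere. -/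
lemma oReach_of_wit (hC : ∀ e, ¬ Cand κ p n k A U e) (hkn : k ≤ n)
    {O : Edge d → Prop} (hO : ∀ v, OReach κ n k A (ltOn A U) (leOn p A U) v → ∀ g, v ∈ g → O g →
      oe κ (res A U) p g) {V : Config d} {K : ℕ} {x : ℕ → Vertex d}
    (h : Wit O V p n 0 K K x) : ∀ i ≤ K, OReach κ n k A (ltOn A U) (leOn p A U) (x i) := by
  obtain ⟨j, hj, hjk⟩ := exists_norm1_eq hkn h
  have up : ∀ m, j + m ≤ K → OReach κ n k A (ltOn A U) (leOn p A U) (x (j + m)) := by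
    intro m
    induction m with
    | zero => exact fun _ => .base _ hjk
    | succ m ih =>
      intro hm
      have ih := ih (by omega)
      exact ih.next hC (h.path.1 _ (by omega)) (h.norm_le hm)
        (hO _ ih _ (Sym2.mem_mk_left _ _) (h.head _ (by omega)))
  have down : ∀ m ≤ j, OReach κ n k A (ltOn A U) (leOn p A U) (x (j - m)) := by
    intro m
    induction m with
    | zero => exact fun _ => .base _ hjk
    | succ m ih =>
      intro hm
      have ih := ih (by omega)
      obtain ⟨i, hi⟩ : ∃ i, j - m = i + 1 := ⟨j - m - 1, by omega⟩
      have hi' : j - (m + 1) = i := by omega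
      rw [hi] at ih
      rw [hi']
      refine ih.next hC (adj_comm.1 (h.path.1 i (by omega))) (h.norm_le (by omega)) ?_
      rw [Sym2.eq_swap]
      exact hO _ ih _ (Sym2.mem_mk_right _ _) (h.head _ (by omega))
  intro i hi
  rcases le_total j i with hji | hji
  · simpa [Nat.add_sub_cancel' hji] using up (i - j) (by omega)
  · simpa [Nat.sub_sub_self hji] using down (j - i) (by omega)

lemma thet_res_iff (hU : Wf U) (hC : ∀ e, ¬ Cand κ p n k A U e) (hkn : k ≤ n) :
    Thet κ (res A U) p n ↔ Thet κ U p n := by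
  constructor
  · rintro ⟨K, x, h⟩
    have hr := oReach_of_wit hC hkn (fun _ _ _ _ h => h) h
    exact ⟨K, x, h.congr (fun i hi ho => ((hr i hi.le).oe_iff hU hC (Sym2.mem_mk_left _ _)).2 ho)
      fun i hi hiK => absurd hiK (by omega)⟩
  · rintro ⟨K, x, h⟩
    have hr := oReach_of_wit hC hkn (fun _ hv _ hg h => (hv.oe_iff hU hC hg).1 h) h
    exact ⟨K, x, h.congr (fun i hi ho => ((hr i hi.le).oe_iff hU hC (Sym2.mem_mk_left _ _)).1 ho)
      fun i hi hiK => absurd hiK (by omega)⟩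

end

section
open scoped Classical ENNReal
variable {d : ℕ} {κ : ℕ} {p : ℝ} {P : Measure (Config d)}

/-- A walk whose first `l` edges satisfy `O` and along whose other edges the labels decrease. -/
structure Wk (O : Edge d → Prop) (U : Config d) (p : ℝ) (K l : ℕ) (x : ℕ → Vertex d) : Prop where
  adj : ∀ i < K, adj (x i) (x (i + 1))
  le : l ≤ K
  head : ∀ i < l, O s(x i, x (i + 1))
  tail_le : ∀ i, l ≤ i → i < K → U s(x i, x (i + 1)) ≤ p
  tail_lt : ∀ i, l ≤ i → i + 1 < K → U s(x (i + 1), x (i + 2)) < U s(x i, x (i + 1))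

variable {O : Edge d → Prop} {U : Config d} {K l : ℕ} {x : ℕ → Vertex d}

/-- Append a vertex to a walk. -/
def snoc (K : ℕ) (x : ℕ → Vertex d) (c : Vertex d) : ℕ → Vertex d :=
  fun i => if i ≤ K then x i else c

lemma snoc_le {c : Vertex d} {i : ℕ} (h : i ≤ K) : snoc K x c i = x i := if_pos h

lemma snoc_last {c : Vertex d} : snoc K x c (K + 1) = c := if_neg (by omega)

lemma Wk.snoc_head (h : Wk O U p K K x) {c : Vertex d} (hc : CDP.adj (x K) c) (hO : O s(x K, c)) :
    Wk O U p (K + 1) (K + 1) (snoc K x c) where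
  adj i hi := by
    rcases Nat.lt_succ_iff_lt_or_eq.1 hi with hi | rfl
    · rw [snoc_le hi.le, snoc_le hi]; exact h.adj i hi
    · rwa [snoc_le le_rfl, snoc_last]
  le := le_rfl
  head i hi := by
    rcases Nat.lt_succ_iff_lt_or_eq.1 hi with hi | rfl
    · rw [snoc_le hi.le, snoc_le hi]; exact h.head i hi
    · rwa [snoc_le le_rfl, snoc_last]
  tail_le i hi hik := absurd hik (by omega)
  tail_lt i hi hik := absurd hik (by omega)

lemma Wk.snoc_tail (h : Wk O U p K l x) {c : Vertex d} (hc : CDP.adj (x K) c)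
    (hp : U s(x K, c) ≤ p) (hlt : ∀ i, l ≤ i → i + 1 = K → U s(x K, c) < U s(x i, x K)) :
    Wk O U p (K + 1) l (snoc K x c) where
  adj i hi := by
    rcases Nat.lt_succ_iff_lt_or_eq.1 hi with hi | rfl
    · rw [snoc_le hi.le, snoc_le hi]; exact h.adj i hi
    · rwa [snoc_le le_rfl, snoc_last]
  le := h.le.trans (Nat.le_succ _)
  head i hi := by
    have := h.le
    rw [snoc_le (by omega), snoc_le (by omega)]
    exact h.head i hi
  tail_le i hli hi := by
    rcases Nat.lt_succ_iff_lt_or_eq.1 hi with hi | rfl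
    · rw [snoc_le hi.le, snoc_le hi]; exact h.tail_le i hli hi
    · rwa [snoc_le le_rfl, snoc_last]
  tail_lt i hli hi := by
    rcases Nat.lt_succ_iff_lt_or_eq.1 hi with hi | rfl
    · rw [snoc_le hi, snoc_le (by omega), snoc_le (by omega)]; exact h.tail_lt i hli hi
    · rw [snoc_le le_rfl, snoc_last, snoc_le (by omega)]
      exact hlt i hli rfl

variable {n k : ℕ} {A : Finset (Edge d)}

lemma OReach.exists_walk (hU : Wf U) {v : Vertex d} (h : OReach κ n k A (ltOn A U) (leOn p A U) v) :
    ∃ K x, Wk (oe κ U p) U p K K x ∧ norm1 (x 0) = k ∧ x K = v := by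
  induction h with
  | base v h =>
    exact ⟨0, fun _ => v, ⟨fun i hi => absurd hi (by omega), le_rfl,
      fun i hi => absurd hi (by omega), fun i _ hi => absurd hi (by omega),
      fun i _ hi => absurd hi (by omega)⟩, h, rfl⟩
  | step u v _ huv _ hs hq hm ih =>
    obtain ⟨K, x, hx, h0, rfl⟩ := ih
    have hn := isNNEdge_mk.2 huv
    refine ⟨K + 1, snoc K x v, hx.snoc_head huv ⟨hn, ?_, (hs.mop_iff hU hn).2 hm⟩, ?_, snoc_last⟩
    · rwa [leOn, res_of_mem (hs _ .refl).1] at hq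
    · rwa [snoc_le (Nat.zero_le _)]

lemma DReach.exists_walk (hU : Wf U) {a b : Vertex d}
    (h : DReach κ n k A (ltOn A U) (leOn p A U) a b) :
    ∃ K l x, Wk (oe κ U p) U p (K + 1) l x ∧ norm1 (x 0) = k ∧ x K = a ∧ x (K + 1) = b := by
  induction h with
  | base a b ha hab hA hq =>
    obtain ⟨K, x, hx, h0, rfl⟩ := ha.exists_walk hU
    rw [leOn, res_of_mem hA] at hq
    refine ⟨K, K, snoc K x b, hx.snoc_tail hab hq fun i h1 h2 => absurd h1 (by omega), ?_,
      snoc_le le_rfl, snoc_last⟩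
    rwa [snoc_le (Nat.zero_le _)]
  | step a b c hab hbc hA hr ih =>
    obtain ⟨K, l, x, hx, h0, rfl, rfl⟩ := ih
    have hr' := hr
    rw [ltOn, res_of_mem hA, res_of_mem hab.mem] at hr'
    refine ⟨K + 1, l, snoc (K + 1) x c, hx.snoc_tail hbc ?_ ?_, ?_, snoc_le le_rfl, snoc_last⟩
    · have := hab.le
      rw [res_of_mem hab.mem] at this
      exact hr'.le.trans this
    · intro i _ hi
      obtain rfl : i = K := by omega
      exact hr'
    · rwa [snoc_le (Nat.zero_le _)]

lemma Reached.exists_walk (hU : Wf U) {v : Vertex d}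
    (h : Reached κ n k A (ltOn A U) (leOn p A U) v) :
    ∃ K l x, Wk (oe κ U p) U p K l x ∧ norm1 (x 0) = k ∧ x K = v := by
  rcases h with h | ⟨a, h⟩
  · obtain ⟨K, x, h⟩ := h.exists_walk hU
    exact ⟨K, K, x, h⟩
  · obtain ⟨K, l, x, hx, h0, _, h⟩ := h.exists_walk hU
    exact ⟨K + 1, l, x, hx, h0, h⟩

lemma Wk.anti (h : Wk O U p K l x) {i j : ℕ} (hi : l ≤ i) (hij : i < j) (hj : j < K) :
    U s(x j, x (j + 1)) < U s(x i, x (i + 1)) := by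
  induction j, hij using Nat.le_induction with
  | base => exact h.tail_lt i hi hj
  | succ j hij ih =>
    exact (h.tail_lt j (by omega) hj).trans (ih (by omega))

/-- Erase a loop of a walk. -/
lemma Wk.erase (h : Wk O U p K l x) {i m : ℕ} (him : i + m ≤ K) (hx : x i = x (i + m)) :
    ∃ l' x', Wk O U p (K - m) l' x' ∧ x' 0 = x 0 ∧ x' (K - m) = x K := by
  set x' : ℕ → Vertex d := fun t => if t < i then x t else x (t + m)
  have hlt : ∀ t ≤ i, x' t = x t := by
    intro t ht
    rcases ht.lt_or_eq with ht | rfl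
    · exact if_pos ht
    · simp only [x', lt_irrefl, if_false, hx]
  have hge : ∀ t, i ≤ t → x' t = x (t + m) := fun t ht => if_neg (by omega)
  have helt : ∀ t < i, s(x' t, x' (t + 1)) = s(x t, x (t + 1)) := fun t ht => by
    rw [hlt t ht.le, hlt (t + 1) ht]
  have hege : ∀ t, i ≤ t → s(x' t, x' (t + 1)) = s(x (t + m), x (t + m + 1)) := fun t ht => by
    rw [hge t ht, hge (t + 1) (by omega), show t + 1 + m = t + m + 1 by omega]
  have hle := h.le
  refine ⟨if l ≤ i then l else if l ≤ i + m then i else l - m, x', ⟨?_, ?_, ?_, ?_, ?_⟩,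
    hlt 0 (Nat.zero_le _), ?_⟩
  · intro t ht
    rcases lt_or_ge t i with hti | hti
    · rw [hlt t hti.le, hlt (t + 1) hti]; exact h.adj t (by omega)
    · rw [hge t hti, hge (t + 1) (by omega), show t + 1 + m = t + m + 1 by omega]
      exact h.adj _ (by omega)
  · split_ifs <;> omega
  · intro t ht
    rcases lt_or_ge t i with hti | hti
    · rw [helt t hti]
      exact h.head t (by split_ifs at ht <;> omega)
    · rw [hege t hti]
      exact h.head _ (by split_ifs at ht <;> omega)
  · intro t hlt ht
    rcases lt_or_ge t i with hti | hti
    · rw [helt t hti]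
      exact h.tail_le t (by split_ifs at hlt <;> omega) (by omega)
    · rw [hege t hti]
      exact h.tail_le _ (by split_ifs at hlt <;> omega) (by omega)
  · intro t hlt ht
    rcases lt_or_ge (t + 1) i with hti | hti
    · rw [helt t (by omega), helt (t + 1) hti]
      exact h.tail_lt t (by split_ifs at hlt <;> omega) (by omega)
    · rw [hege (t + 1) hti]
      rcases lt_or_ge t i with hti' | hti'
      · rw [helt t hti']
        exact h.anti (by split_ifs at hlt <;> omega) (by omega) (by omega)
      · rw [hege t hti']
        exact h.anti (by split_ifs at hlt <;> omega) (by omega) (by omega)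
  · rw [hge _ (by omega), Nat.sub_add_cancel (by omega)]

lemma Wk.drop (h : Wk O U p K l x) (i : ℕ) (hi : i ≤ K) :
    Wk O U p (K - i) (l - i) (fun t => x (t + i)) := by
  have hle := h.le
  refine ⟨fun t ht => ?_, by omega, fun t ht => ?_, fun t h1 h2 => ?_, fun t h1 h2 => ?_⟩
  · simpa only [Nat.add_right_comm] using h.adj (t + i) (by omega)
  · simpa only [Nat.add_right_comm] using h.head (t + i) (by omega)
  · simpa only [Nat.add_right_comm] using h.tail_le (t + i) (by omega) (by omega)
  · simpa only [Nat.add_right_comm] using h.tail_lt (t + i) (by omega) (by omega)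

lemma Wk.exists_wit (h : Wk O U p K l x) {m : ℕ} (hm : (m : ℤ) ≤ norm1 (x 0 - x K)) :
    ∃ K' l' x', Wit O U p m (x K) K' l' x' := by
  have hex : ∃ K' l' x', Wk O U p K' l' x' ∧ (m : ℤ) ≤ norm1 (x' 0 - x K) ∧ x' K' = x K :=
    ⟨K, l, x, h, hm, rfl⟩
  obtain ⟨l', x', hx', hm', hK⟩ := Nat.find_spec hex
  set K' := Nat.find hex
  have hmin : ∀ M < K', ∀ l' x', Wk O U p M l' x' → (m : ℤ) ≤ norm1 (x' 0 - x K) → x' M ≠ x K :=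
    fun M hM l' x' h1 h2 h3 => Nat.find_min hex hM ⟨l', x', h1, h2, h3⟩
  have hinj : ∀ i j, i < j → j ≤ K' → x' i ≠ x' j := by
    intro i j hij hj he
    obtain ⟨m', rfl⟩ := Nat.exists_eq_add_of_lt hij
    obtain ⟨l'', x'', h1, h2, h3⟩ := hx'.erase (i := i) (m := m' + 1) (by omega) (by
      rw [he, add_assoc])
    exact hmin _ (by omega) _ _ h1 (by rwa [h2]) (h3.trans hK)
  have hin : ∀ i, 1 ≤ i → i ≤ K' → norm1 (x' i - x K) < m := by
    intro i h1 h2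
    by_contra hge
    refine hmin (K' - i) (by omega) _ _ (hx'.drop i h2) (by simpa using hge) ?_
    simp only [Nat.sub_add_cancel h2, hK]
  refine ⟨K', l', x', ⟨⟨hx'.adj, fun i hi j hj he => ?_⟩, ?_, hin, hK, hx'.le, hx'.head,
    hx'.tail_le, hx'.tail_lt⟩⟩
  · rcases lt_trichotomy i j with h | h | h
    · exact absurd he (hinj i j h hj)
    · exact h
    · exact absurd he.symm (hinj j i h hi)
  · refine le_antisymm ?_ hm'
    rcases Nat.eq_zero_or_pos K' with h0 | h0
    · rw [h0] at hK
      simp [hK, norm1]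
    · have h1 := hin 1 le_rfl h0
      have hadj : CDP.adj (x' 0 - x K) (x' 1 - x K) := by
        have := hx'.adj 0 h0
        simpa [CDP.adj] using this
      have := (abs_le.1 (norm1_step hadj)).2
      omega

lemma abs_norm1_sub_le (x y : Vertex d) : |norm1 x - norm1 y| ≤ norm1 (x - y) := by
  unfold norm1
  rw [← Finset.sum_sub_distrib]
  refine (Finset.abs_sum_le_sum_abs _ _).trans (Finset.sum_le_sum fun i _ => ?_)
  exact abs_abs_sub_abs_le_abs_sub _ _

/-- A lower bound for the distance of `v` to the sphere of radius `k`, for `1 ≤ k ≤ n`. -/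
noncomputable def gap (n k : ℕ) (v : Vertex d) : ℕ :=
  Nat.dist (max 1 (min (norm1 v).toNat n)) k

lemma Reached.arm (hU : Wf U) (h1 : 1 ≤ k) (hk : k ≤ n) {v : Vertex d}
    (h : Reached κ n k A (ltOn A U) (leOn p A U) v) : Arm κ U p (gap n k v) v := by
  obtain ⟨K, l, x, hx, h0, rfl⟩ := h.exists_walk hU
  refine hx.exists_wit (le_trans ?_ (abs_norm1_sub_le _ _))
  have hv : 0 ≤ norm1 (x K) := Finset.sum_nonneg fun i _ => abs_nonneg _
  rw [h0, gap, Nat.dist, le_abs]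
  omega

end

section
open scoped Classical ENNReal
variable {d : ℕ} {κ : ℕ} {p : ℝ} {P : Measure (Config d)} {n k : ℕ} {A : Finset (Edge d)}
  {U : Config d}

/-- Events which depend on the labels of `A` only through their order and their position with
respect to `p` are measurable. -/
lemma measurable_of_pattern (A : Finset (Edge d))
    (Φ : (Edge d → Edge d → Prop) → (Edge d → Prop) → Prop) :
    Measurable fun U => Φ (ltOn A U) (leOn p A U) := by
  let T : Config d → (A → A → Prop) × (A → Prop) × (A → Prop) × (A → Prop) := fun U =>
    (fun f g => U f < U g, fun f => U f < 2, fun f => 2 < U f, fun f => U f ≤ p)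
  have hT : Measurable T := by
    refine .prodMk ?_ (.prodMk ?_ (.prodMk ?_ ?_))
    · exact measurable_pi_lambda _ fun f => measurable_pi_lambda _ fun g => measurable_label_lt _ _
    · exact measurable_pi_lambda _ fun f => (measurableSet_setOfPred.1
        (measurableSet_lt (measurable_pi_apply _) measurable_const))
    · exact measurable_pi_lambda _ fun f => measurable_lt_label _ _
    · exact measurable_pi_lambda _ fun f => measurable_label_le _ _
  let Ψ : (A → A → Prop) × (A → Prop) × (A → Prop) × (A → Prop) → Prop := fun t =>
    Φ (fun f g => if hf : f ∈ A then if hg : g ∈ A then t.1 ⟨f, hf⟩ ⟨g, hg⟩ else t.2.1 ⟨f, hf⟩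
        else if hg : g ∈ A then t.2.2.1 ⟨g, hg⟩ else False)
      (fun f => if hf : f ∈ A then t.2.2.2 ⟨f, hf⟩ else 2 ≤ p)
  have hΨ : (fun U => Φ (ltOn A U) (leOn p A U)) = Ψ ∘ T := by
    ext U
    simp only [Function.comp, Ψ, T]
    congr! with f g f
    · unfold ltOn res
      split_ifs <;> simp
    · unfold leOn res
      split_ifs <;> simp
  rw [hΨ]
  exact (measurable_of_countable Ψ).comp hT

lemma measurable_res (A : Finset (Edge d)) : Measurable (res A) := by
  refine measurable_pi_lambda _ fun e => ?_
  unfold res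
  split_ifs
  · exact measurable_pi_apply e
  · exact measurable_const

lemma rule_cand : Rule (Cand κ p n k : Finset (Edge d) → Config d → Edge d → Prop) where
  meas A e := measurable_of_pattern A fun r q => IsNNEdge e ∧ e ∉ A ∧ ∃ v ∈ e, Reached κ n k A r q v
  notMem A U e h := h.2.1
  congr A U V e h hU := by
    unfold Cand ltOn leOn at hU ⊢
    rwa [res_congr h] at hU

/-- The exploration is over and it has found an open path. -/
def Cert (κ : ℕ) (p : ℝ) (n k : ℕ) (A : Finset (Edge d)) (U : Config d) : Prop :=
  (∀ e, ¬ Cand κ p n k A U e) ∧ Thet κ (res A U) p n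

lemma measurable_cert (A : Finset (Edge d)) : Measurable (Cert κ p n k A) := by
  have h1 := (rule_cand (κ := κ) (p := p) (n := n) (k := k) (d := d)).meas A
  have h2 : Measurable fun U : Config d => Thet κ (res A U) p n :=
    (measurable_thet n).comp (measurable_res A)
  unfold Cert
  fun_prop

lemma Cert.congr {V : Config d} (h : ∀ f ∈ A, U f = V f) (hU : Cert κ p n k A U) :
    Cert κ p n k A V :=
  ⟨fun e he => hU.1 e (rule_cand.congr A V U e (fun f hf => (h f hf).symm) he),
    res_congr h ▸ hU.2⟩

lemma finite_desc (hU : Wf U) (g : Edge d) :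
    {g' | Relation.ReflTransGen (fun a b => LAdj b a ∧ U b < U a) g g'}.Finite := by
  induction g using hU.induction with
  | h g ih =>
    have : {g' | Relation.ReflTransGen (fun a b => LAdj b a ∧ U b < U a) g g'} ⊆
        {g} ∪ ⋃ h ∈ {h | h ∈ lnb g ∧ LAdj h g ∧ U h < U g},
          {g' | Relation.ReflTransGen (fun a b => LAdj b a ∧ U b < U a) h g'} := by
      intro g' hg'
      rcases Relation.ReflTransGen.cases_head hg' with rfl | ⟨h, hh, hg'⟩
      · exact Or.inl rfl
      · exact Or.inr (Set.mem_iUnion₂.2 ⟨h, ⟨hh.1.symm.mem_lnb, hh⟩, hg'⟩)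
    refine Set.Finite.subset ((Set.finite_singleton g).union (Set.Finite.biUnion ?_ ?_)) this
    · exact (lnb g).finite_toSet.subset fun h hh => hh.1
    · exact fun h hh => ih h hh.2

lemma finite_ball (n : ℕ) : {v : Vertex d | norm1 v ≤ n}.Finite := by
  refine (Set.finite_Icc (fun _ => -(n : ℤ)) (fun _ => (n : ℤ))).subset fun v hv => ?_
  have hv' : ∀ i, |v i| ≤ n := fun i =>
    (Finset.single_le_sum (f := fun i => |v i|) (fun i _ => abs_nonneg _)
      (Finset.mem_univ i)).trans hv
  exact ⟨fun i => (abs_le.1 (hv' i)).1, fun i => (abs_le.1 (hv' i)).2⟩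

lemma OReach.norm_le (hk : k ≤ n) {v : Vertex d} (h : OReach κ n k A (ltOn A U) (leOn p A U) v) :
    norm1 v ≤ n := by
  cases h with
  | base _ h => rw [h]; exact_mod_cast hk
  | step u _ _ _ hv _ _ _ => exact hv

lemma DReach.desc (hk : k ≤ n) {a b : Vertex d} (h : DReach κ n k A (ltOn A U) (leOn p A U) a b) :
    ∃ v, norm1 v ≤ n ∧ ∃ g ∈ star v,
      Relation.ReflTransGen (fun a b => LAdj b a ∧ U b < U a) g s(a, b) := by
  induction h with
  | base a b ha hab hA hq =>
    exact ⟨a, ha.norm_le hk, s(a, b), mem_star.2 ⟨isNNEdge_mk.2 hab, Sym2.mem_mk_left _ _⟩, .refl⟩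
  | step a b c hab hbc hA hr ih =>
    obtain ⟨v, hv, g, hg, hd⟩ := ih
    refine ⟨v, hv, g, hg, hd.tail ?_⟩
    have hr' := hr
    rw [ltOn, res_of_mem hA, res_of_mem hab.mem] at hr'
    refine ⟨⟨isNNEdge_mk.2 hbc, isNNEdge_mk.2 hab.adj, fun h => ?_, b, Sym2.mem_mk_left _ _,
      Sym2.mem_mk_right _ _⟩, hr'⟩
    rw [h] at hr'
    exact lt_irrefl _ hr'

lemma finite_cand (hU : Wf U) (hk : k ≤ n) :
    ∃ S : Finset (Edge d), ∀ A e, Cand κ p n k A U e → e ∈ S := by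
  have hfin : ((⋃ v ∈ {v : Vertex d | norm1 v ≤ n}, (star v : Set (Edge d))) ∪
      ⋃ v ∈ {v : Vertex d | norm1 v ≤ n}, ⋃ g ∈ (star v : Set (Edge d)),
        ⋃ g' ∈ {g' | Relation.ReflTransGen (fun a b => LAdj b a ∧ U b < U a) g g'},
          ⋃ w ∈ (g'.toFinset : Set (Vertex d)), (star w : Set (Edge d))).Finite := by
    refine Set.Finite.union ((finite_ball n).biUnion fun v _ => (star v).finite_toSet) ?_
    exact (finite_ball n).biUnion fun v _ => (star v).finite_toSet.biUnion fun g _ =>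
      (finite_desc hU g).biUnion fun g' _ => g'.toFinset.finite_toSet.biUnion fun w _ =>
        (star w).finite_toSet
  refine ⟨hfin.toFinset, fun A e he => ?_⟩
  rw [Set.Finite.mem_toFinset]
  obtain ⟨hn, _, v, hve, hv | ⟨a, hv⟩⟩ := he
  · exact Or.inl (Set.mem_iUnion₂.2 ⟨v, hv.norm_le hk, mem_star.2 ⟨hn, hve⟩⟩)
  · obtain ⟨u, hu, g, hg, hd⟩ := hv.desc hk
    refine Or.inr (Set.mem_iUnion₂.2 ⟨u, hu, Set.mem_iUnion₂.2 ⟨g, hg, Set.mem_iUnion₂.2 ⟨_, hd,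
      Set.mem_iUnion₂.2 ⟨v, ?_, mem_star.2 ⟨hn, hve⟩⟩⟩⟩⟩)
    simp

lemma exists_expl_terminal {C : Finset (Edge d) → Config d → Edge d → Prop} (hC : Rule C)
    {S : Finset (Edge d)} (hS : ∀ A e, C A U e → e ∈ S) : ∃ M, ∀ e, ¬ C (expl C M U) U e := by
  by_contra! hn
  have hsub : ∀ t, expl C t U ⊆ S ∧ t ≤ (expl C t U).card := by
    intro t
    induction t with
    | zero => exact ⟨Finset.empty_subset _, Nat.zero_le _⟩
    | succ t ih =>
      obtain ⟨e, he⟩ := exists_isNext (hn t)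
      rw [expl_succ_of_isNext he, Finset.card_insert_of_notMem (hC.notMem _ _ _ he.1)]
      exact ⟨Finset.insert_subset (hS _ _ he.1) ih.1, by omega⟩
  have := Finset.card_le_card (hsub (S.card + 1)).1
  have := (hsub (S.card + 1)).2
  omega

lemma expl_eq_of_terminal {C : Finset (Edge d) → Config d → Edge d → Prop} {M : ℕ}
    (h : ∀ e, ¬ C (expl C M U) U e) {N : ℕ} (hN : M ≤ N) : expl C N U = expl C M U := by
  induction N, hN using Nat.le_induction with
  | base => rfl
  | succ N hN ih =>
    rw [expl_succ_of_not, ih]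
    rintro ⟨e, he⟩
    rw [ih] at he
    exact h e he.1

lemma exists_reached_of_mem_expl {t : ℕ} {e : Edge d} (h : e ∈ expl (Cand κ p n k) t U) :
    IsNNEdge e ∧ ∃ A, ∃ v ∈ e, Reached κ n k A (ltOn A U) (leOn p A U) v := by
  induction t with
  | zero => simp [expl] at h
  | succ t ih =>
    by_cases hn : ∃ e, IsNext (Cand κ p n k) (expl (Cand κ p n k) t U) U e
    · obtain ⟨f, hf⟩ := hn
      rw [expl_succ_of_isNext hf, Finset.mem_insert] at h
      rcases h with rfl | h
      · exact ⟨hf.1.1, _, hf.1.2.2⟩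
      · exact ih h
    · rw [expl_succ_of_not hn] at h
      exact ih h

end

section
open scoped Classical ENNReal
variable {d : ℕ} {κ : ℕ} {p : ℝ} {P : Measure (Config d)} {n k : ℕ} {U : Config d}

/-- Translation of the edges. -/
def shift (c : Vertex d) : Equiv.Perm (Edge d) where
  toFun := Sym2.map (· + c)
  invFun := Sym2.map (· - c)
  left_inv e := by simp [Sym2.map_map]
  right_inv e := by simp [Sym2.map_map]

lemma shift_mk (c x y : Vertex d) : shift c s(x, y) = s(x + c, y + c) := rfl

lemma adj_add {c x y : Vertex d} : adj (x + c) (y + c) ↔ adj x y := by simp [adj]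

lemma isNNEdge_shift {c : Vertex d} {e : Edge d} : IsNNEdge (shift c e) ↔ IsNNEdge e := by
  induction e using Sym2.ind with
  | _ x y => rw [shift_mk, isNNEdge_mk, isNNEdge_mk, adj_add]

lemma add_mem_shift {c v : Vertex d} {e : Edge d} : v + c ∈ shift c e ↔ v ∈ e := by
  induction e using Sym2.ind with
  | _ x y => simp [shift_mk]

lemma opm_shift (c : Vertex d) (m : ℕ) (e : Edge d) :
    opm κ (fun f g => U (shift c f) < U (shift c g)) m e ↔
      opm κ (fun f g => U f < U g) m (shift c e) := by
  induction m generalizing e with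
  | zero => rfl
  | succ m ih =>
    rw [opm, opm]
    have key : ∀ v, Set.ncard {f | IsNNEdge f ∧ v + c ∈ f ∧ f ≠ shift c e ∧ U f < U (shift c e) ∧
        opm κ (fun f g => U f < U g) m f} = Set.ncard {f | IsNNEdge f ∧ v ∈ f ∧ f ≠ e ∧
          U (shift c f) < U (shift c e) ∧
          opm κ (fun f g => U (shift c f) < U (shift c g)) m f} := by
      intro v
      conv_rhs => rw [← Set.ncard_image_of_injective _ (shift c).injective]
      congr 1
      ext f
      obtain ⟨f, rfl⟩ := (shift c).surjective f
      rw [(shift c).injective.mem_set_image]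
      simp only [Set.mem_ofPred_eq, isNNEdge_shift, add_mem_shift, ne_eq,
        (shift c).injective.eq_iff, ih]
    constructor
    · intro h v hv
      have hv' : v - c + c ∈ shift c e := by rwa [sub_add_cancel]
      have := h (v - c) (add_mem_shift.1 hv')
      rw [← key, sub_add_cancel] at this
      exact this
    · intro h v hv
      rw [← key]
      exact h _ (add_mem_shift.2 hv)

lemma oe_shift (c : Vertex d) (e : Edge d) :
    oe κ (fun f => U (shift c f)) p e ↔ oe κ U p (shift c e) := by
  unfold oe mop
  simp only [opm_shift, isNNEdge_shift]

lemma arm_shift (c : Vertex d) : Arm κ (fun f => U (shift c f)) p n 0 ↔ Arm κ U p n c := by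
  constructor
  · rintro ⟨k, l, x, h⟩
    refine ⟨k, l, fun i => x i + c, ⟨⟨fun i hi => adj_add.2 (h.path.1 i hi), fun i hi j hj he =>
      h.path.2 i hi j hj (add_right_cancel he)⟩, by simpa using h.start, by simpa using h.inside,
      by simp [h.fin], h.le, fun i hi => ?_, h.tail_le, h.tail_lt⟩⟩
    exact (oe_shift c _).1 (h.head i hi)
  · rintro ⟨k, l, x, h⟩
    have hs : ∀ a b, shift c s(a - c, b - c) = s(a, b) := fun a b => by
      rw [shift_mk, sub_add_cancel, sub_add_cancel]
    refine ⟨k, l, fun i => x i - c, ⟨⟨fun i hi => ?_, fun i hi j hj he =>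
      h.path.2 i hi j hj (sub_left_injective he)⟩, by simpa using h.start, by simpa using h.inside,
      by simp [h.fin], h.le, fun i hi => ?_, ?_, ?_⟩⟩
    · rw [← adj_add (c := c), sub_add_cancel, sub_add_cancel]
      exact h.path.1 i hi
    · rw [oe_shift, hs]
      exact h.head i hi
    · simp only [hs]
      exact h.tail_le
    · simp only [hs]
      exact h.tail_lt

lemma IsProductUniform.arm_eq (hP : IsProductUniform P) (c : Vertex d) :
    P {U | Arm κ U p n c} = P {U | Arm κ U p n 0} := by
  conv_rhs => rw [← hP.map_perm (shift c)]
  rw [Measure.map_apply (measurable_comp_perm _) (measurableSet_setOfPred.2 (measurable_arm n 0))]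
  simp only [Set.preimage_ofPred_eq, arm_shift]

lemma IsProductUniform.reveal_le (hP : IsProductUniform P) (h1 : 1 ≤ k) (hk : k ≤ n) (M : ℕ)
    (e : Edge d) : P {U | e ∈ expl (Cand κ p n k) M U} ≤
      ∑ v ∈ e.toFinset, P {U | Arm κ U p (gap n k v) 0} := by
  calc P {U | e ∈ expl (Cand κ p n k) M U}
      ≤ P (⋃ v ∈ e.toFinset, {U | Arm κ U p (gap n k v) v}) := by
        refine measure_mono_ae ?_
        filter_upwards [hP.ae_wf] with U hU he
        obtain ⟨_, A, v, hv, hr⟩ := exists_reached_of_mem_expl he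
        exact Set.mem_iUnion₂.2 ⟨v, Sym2.mem_toFinset.2 hv, hr.arm hU h1 hk⟩
    _ ≤ _ := by
        refine (measure_biUnion_finset_le _ _).trans (Finset.sum_le_sum fun v _ => ?_)
        exact (hP.arm_eq v).le

lemma sum_gap_le (f : ℕ → ℝ≥0∞) (v : Vertex d) (hn : 1 ≤ n) :
    ∑ k ∈ Finset.Icc 1 n, f (gap n k v) ≤ 2 * ∑ j ∈ Finset.range n, f j := by
  unfold gap
  set r := max 1 (min (norm1 v).toNat n)
  have hr1 : 1 ≤ r := le_max_left _ _
  have hrn : r ≤ n := max_le hn (min_le_right _ _)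
  rw [← Finset.sum_filter_add_sum_filter_not _ (fun k => k ≤ r), two_mul]
  refine add_le_add ?_ ?_
  · rw [← Finset.sum_image (f := f) (g := fun k => Nat.dist r k)]
    · refine Finset.sum_le_sum_of_subset fun j hj => ?_
      simp only [Finset.mem_image, Finset.mem_filter, Finset.mem_Icc, Nat.dist,
        Finset.mem_range] at hj ⊢
      omega
    · intro a ha b hb hab
      simp only [Finset.coe_filter, Set.mem_ofPred_eq, Finset.mem_Icc, Nat.dist] at ha hb hab
      omega
  · rw [← Finset.sum_image (f := f) (g := fun k => Nat.dist r k)]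
    · refine Finset.sum_le_sum_of_subset fun j hj => ?_
      simp only [Finset.mem_image, Finset.mem_filter, Finset.mem_Icc, Nat.dist,
        Finset.mem_range] at hj ⊢
      omega
    · intro a ha b hb hab
      simp only [Finset.coe_filter, Set.mem_ofPred_eq, Finset.mem_Icc, Nat.dist] at ha hb hab
      omega

/-- The OSSS inequality for the exploration from the sphere of radius `k`. -/
lemma IsProductUniform.thet_mul_le (hP : IsProductUniform P) (h1 : 1 ≤ k) (hk : k ≤ n) :
    P {U | Thet κ U p n} * P {U | ¬ Arm κ U p n 0} ≤
      2 * ∑' e : Edge d, (∑ v ∈ e.toFinset, P {U | Arm κ U p (gap n k v) 0}) *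
        (if IsNNEdge e then P {U | ¬ (Arm κ U p n 0 ↔ Arm κ (rem {e} U) p n 0)} else 0) := by
  set C : Finset (Edge d) → Config d → Edge d → Prop := Cand κ p n k
  have hC : Rule C := rule_cand
  have hmono : Monotone fun M => {U | Cert κ p n k (expl C M U) U} := by
    intro M N hMN U hU
    show Cert κ p n k (expl C N U) U
    rw [expl_eq_of_terminal hU.1 hMN]
    exact hU
  have hle : P {U | Thet κ U p n} ≤ ⨆ M, P {U | Cert κ p n k (expl C M U) U} := by
    rw [← hmono.measure_iUnion]
    refine measure_mono_ae ?_
    filter_upwards [hP.ae_wf] with U hU hT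
    obtain ⟨S, hS⟩ := finite_cand (κ := κ) (p := p) hU hk
    obtain ⟨M, hM⟩ := exists_expl_terminal hC hS
    exact Set.mem_iUnion.2 ⟨M, hM, (thet_res_iff hU hM hk).2 hT⟩
  refine (mul_le_mul_left hle _).trans ?_
  rw [ENNReal.iSup_mul]
  refine iSup_le fun M => ?_
  refine (hP.osss hC (G := fun U => Arm κ U p n 0) (measurable_arm n 0) (F := Cert κ p n k)
    (measurable_cert) (fun A U V h => Cert.congr h) M ?_).trans ?_
  · filter_upwards [hP.ae_wf] with U hU hc
    exact ((thet_res_iff hU hc.1 hk).1 hc.2).arm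
  · refine mul_le_mul_right (ENNReal.tsum_le_tsum fun e => ?_) _
    split_ifs with he
    · refine mul_le_mul_left ?_ _
      exact hP.reveal_le h1 hk M e
    · have : P {U | e ∈ expl C M U} = 0 := by
        convert measure_empty (μ := P) using 2
        ext U
        simp only [Set.mem_ofPred_eq, Set.mem_empty_iff_false, iff_false]
        exact fun h => he (exists_reached_of_mem_expl h).1
      rw [this, zero_mul, mul_zero]

/-- The OSSS inequality averaged over the explorations. -/
theorem IsProductUniform.card_mul_thet_le (hP : IsProductUniform P) (hn : 1 ≤ n) :
    n * (P {U | Thet κ U p n} * P {U | ¬ Arm κ U p n 0}) ≤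
      8 * (∑ j ∈ Finset.range n, P {U | Arm κ U p j 0}) * ∑' e : Edge d,
        (if IsNNEdge e then P {U | ¬ (Arm κ U p n 0 ↔ Arm κ (rem {e} U) p n 0)} else 0) := by
  set I : Edge d → ℝ≥0∞ := fun e =>
    if IsNNEdge e then P {U | ¬ (Arm κ U p n 0 ↔ Arm κ (rem {e} U) p n 0)} else 0
  set S := ∑ j ∈ Finset.range n, P {U | Arm κ U p j 0}
  calc n * (P {U | Thet κ U p n} * P {U | ¬ Arm κ U p n 0})
      = ∑ k ∈ Finset.Icc 1 n, P {U | Thet κ U p n} * P {U | ¬ Arm κ U p n 0} := by simp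
    _ ≤ ∑ k ∈ Finset.Icc 1 n, 2 * ∑' e : Edge d,
          (∑ v ∈ e.toFinset, P {U | Arm κ U p (gap n k v) 0}) * I e :=
        Finset.sum_le_sum fun k hk => hP.thet_mul_le (Finset.mem_Icc.1 hk).1 (Finset.mem_Icc.1 hk).2
    _ = 2 * ∑' e : Edge d, (∑ v ∈ e.toFinset, ∑ k ∈ Finset.Icc 1 n,
          P {U | Arm κ U p (gap n k v) 0}) * I e := by
        rw [← Finset.mul_sum, ← Summable.tsum_finsetSum fun _ _ => ENNReal.summable]
        congr 1
        refine tsum_congr fun e => ?_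
        rw [← Finset.sum_mul, Finset.sum_comm]
    _ ≤ 2 * ∑' e : Edge d, (4 * S) * I e := by
        gcongr with e
        calc ∑ v ∈ e.toFinset, ∑ k ∈ Finset.Icc 1 n, P {U | Arm κ U p (gap n k v) 0}
            ≤ ∑ v ∈ e.toFinset, 2 * S :=
              Finset.sum_le_sum fun v _ => sum_gap_le (fun j => P {U | Arm κ U p j 0}) v hn
          _ ≤ 2 * (2 * S) := by
              rw [Finset.sum_const, nsmul_eq_mul]
              gcongr
              exact_mod_cast card_toFinset_le e
          _ = 4 * S := by rw [← mul_assoc]; norm_num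
    _ = 8 * S * ∑' e, I e := by
        rw [ENNReal.tsum_mul_left, ← mul_assoc, ← mul_assoc]
        norm_num

end

section
open scoped Classical ENNReal
variable {d : ℕ} {κ : ℕ} {p : ℝ} {P : Measure (Config d)} {n : ℕ} {U : Config d}

/-- The edges with an endpoint in the ball of radius `n`. -/
noncomputable def ballEdges (d n : ℕ) : Finset (Edge d) :=
  (finite_ball (d := d) n).toFinset.biUnion star

/-- The edges of the ball of radius `n` and their neighbours. -/
noncomputable def nearEdges (d n : ℕ) : Finset (Edge d) := (ballEdges d n).biUnion lnb

lemma isNNEdge_of_mem_ballEdges {e : Edge d} (he : e ∈ ballEdges d n) : IsNNEdge e := by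
  obtain ⟨v, _, hv⟩ := Finset.mem_biUnion.1 he
  exact (mem_star.1 hv).1

lemma ballEdges_subset : ballEdges d n ⊆ nearEdges d n := fun e he =>
  Finset.mem_biUnion.2 ⟨e, he, self_mem_lnb (isNNEdge_of_mem_ballEdges he)⟩

lemma Wit.mem_ballEdges {O : Edge d → Prop} {k l : ℕ} {x : ℕ → Vertex d}
    (h : Wit O U p n 0 k l x) {i : ℕ} (hi : i < k) : s(x i, x (i + 1)) ∈ ballEdges d n :=
  Finset.mem_biUnion.2 ⟨x i, (Set.Finite.mem_toFinset _).2 (h.norm_le hi.le),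
    mem_star.2 ⟨h.nn hi, Sym2.mem_mk_left _ _⟩⟩

lemma Arm.mono {a b : ℝ} (hab : a ≤ b) {c : Vertex d} (h : Arm κ U a n c) : Arm κ U b n c := by
  obtain ⟨k, l, x, h⟩ := h
  exact ⟨k, l, x, h.path, h.start, h.inside, h.fin, h.le,
    fun i hi => ⟨(h.head i hi).1, (h.head i hi).2.1.trans hab, (h.head i hi).2.2⟩,
    fun i hi hk => (h.tail_le i hi hk).trans hab, h.tail_lt⟩

lemma Arm.of_level {a b : ℝ} (h : ∀ e ∈ ballEdges d n, U e ≤ a → U e ≤ b) (hA : Arm κ U a n 0) :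
    Arm κ U b n 0 := by
  obtain ⟨k, l, x, hx⟩ := hA
  refine ⟨k, l, x, hx.path, hx.start, hx.inside, hx.fin, hx.le, fun i hi => ?_, fun i hi hk =>
    h _ (hx.mem_ballEdges hk) (hx.tail_le i hi hk), hx.tail_lt⟩
  have := hx.head i hi
  exact ⟨this.1, h _ (hx.mem_ballEdges (hi.trans_le hx.le)) this.2.1, this.2.2⟩

lemma Arm.congr_order {V : Config d} (hU : Wf U) (hV : Wf V)
    (hc : ∀ e f, LAdj f e → (U f < U e ↔ V f < V e))
    (hp : ∀ e, U e ≤ p → V e ≤ p) (hA : Arm κ U p n 0) : Arm κ V p n 0 := by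
  obtain ⟨k, l, x, hx⟩ := hA
  refine ⟨k, l, x, hx.path, hx.start, hx.inside, hx.fin, hx.le, fun i hi => ?_, fun i hi hk =>
    hp _ (hx.tail_le i hi hk), fun i hi hk => (hc _ _ ?_).1 (hx.tail_lt i hi hk)⟩
  · obtain ⟨h1, h2, h3⟩ := hx.head i hi
    exact ⟨h1, hp _ h2, (mop_congr hU hV Set.univ (fun _ _ _ _ _ => trivial)
      (fun e _ f => hc e f) _ trivial h1).1 h3⟩
  · refine ladj_of (v := x (i + 1)) (hx.nn (by omega)) (Sym2.mem_mk_right _ _) (hx.nn hk)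
      (Sym2.mem_mk_left _ _) fun h => (hx.tail_lt i hi hk).ne (congrArg U h)

lemma piv_mem_ballEdges {f : Edge d} (hp : p < 2) (hU : Wf U) (h : Piv κ p n f U) :
    f ∈ ballEdges d n := by
  by_contra hf
  obtain ⟨⟨k, l, x, hx⟩, h2⟩ := h
  have hin : Inert κ (Function.update U f p) p {f} := by
    intro t _ _ ht _ g hg _ hlt
    rw [Finset.mem_singleton.1 hg, Function.update_self] at hlt
    exact absurd ht (not_le.2 hlt)
  have hrem : rem {f} (Function.update U f p) = rem {f} U := by
    ext e
    by_cases he : e = f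
    · simp [rem, he]
    · simp [rem, he]
  refine h2 ⟨k, l, x, ?_⟩
  rw [← hrem]
  refine hin.wit_rem hp (hU.update f p) hx fun i hi he => hf ?_
  rw [← Finset.mem_singleton.1 he]
  exact hx.mem_ballEdges hi

/-- If `f` is the only edge near the ball whose label lies in `[a, b]`, the arm event appears
between the times `a` and `b` if and only if `f` is pivotal. -/
lemma piv_iff_of_unique {a b : ℝ} {f : Edge d} (hU : Wf U) (hf : f ∈ ballEdges d n)
    (hb : b < 2) (hp : p ∈ Set.Icc a b) (hfU : U f ∈ Set.Ioc a b)
    (huniq : ∀ e ∈ nearEdges d n, e ≠ f → U e ∉ Set.Icc a b) :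
    Piv κ p n f U ↔ Arm κ U b n 0 ∧ ¬ Arm κ U a n 0 := by
  obtain ⟨hap, hpb⟩ := hp
  have hcases : ∀ e ∈ nearEdges d n, e ≠ f → U e < a ∨ b < U e := by
    intro e he hef
    have := huniq e he hef
    rw [Set.mem_Icc] at this
    by_contra! hc
    exact this hc
  have hlow : Arm κ (rem {f} U) p n 0 ↔ Arm κ U a n 0 := by
    rw [← arm_rem_iff_of_lt (W := {f}) (p := a) (by linarith) hU (by simpa using hfU.1)]
    refine ⟨fun h => h.of_level fun e he hep => ?_, fun h => h.mono hap⟩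
    by_cases hef : e = f
    · rw [rem_of_mem (by simpa using hef)] at hep
      linarith
    · rw [rem_of_notMem (by simpa using hef)] at hep ⊢
      rcases hcases e (ballEdges_subset he) hef with h | h <;> linarith
  have hhigh : Arm κ (Function.update U f p) p n 0 ↔ Arm κ U b n 0 := by
    have hlev : Arm κ (Function.update U f p) p n 0 ↔ Arm κ (Function.update U f p) b n 0 := by
      refine ⟨fun h => h.mono hpb, fun h => h.of_level fun e he heb => ?_⟩
      by_cases hef : e = f
      · rw [hef, Function.update_self]
      · rw [Function.update_of_ne hef] at heb ⊢
        rcases hcases e (ballEdges_subset he) hef with h | h <;> linarith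
    have hord : ∀ e g, LAdj g e →
        (U g < U e ↔ Function.update U f p g < Function.update U f p e) := by
      intro e g hge
      have hn : ∀ {e'}, LAdj e' f → U e' < a ∨ b < U e' := fun h =>
        hcases _ (Finset.mem_biUnion.2 ⟨f, hf, h.symm.mem_lnb⟩) h.2.2.1
      have := hfU.1
      have := hfU.2
      by_cases hef : e = f
      · subst hef
        rw [Function.update_self, Function.update_of_ne hge.2.2.1]
        rcases hn hge with h | h
        · exact ⟨fun _ => by linarith, fun _ => by linarith⟩
        · exact ⟨fun _ => by linarith, fun _ => by linarith⟩
      · rw [Function.update_of_ne hef]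
        by_cases hgf : g = f
        · subst hgf
          rw [Function.update_self]
          rcases hn hge.symm with h | h
          · exact ⟨fun _ => by linarith, fun _ => by linarith⟩
          · exact ⟨fun _ => by linarith, fun _ => by linarith⟩
        · rw [Function.update_of_ne hgf]
    rw [hlev]
    refine ⟨Arm.congr_order (hU.update f p) hU (fun e g h => (hord e g h).symm) fun e he => ?_,
      Arm.congr_order hU (hU.update f p) hord fun e he => ?_⟩
    · by_cases hef : e = f
      · rw [hef]
        exact hfU.2
      · rwa [Function.update_of_ne hef] at he
    · by_cases hef : e = f
      · rwa [hef, Function.update_self]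
      · rwa [Function.update_of_ne hef]
  rw [Piv, hlow, hhigh]

/-- Two edges near the ball have labels in `[a, b]`. -/
def Crowded (n : ℕ) (a b : ℝ) (U : Config d) : Prop :=
  ∃ e ∈ nearEdges d n, ∃ f ∈ nearEdges d n, e ≠ f ∧ U e ∈ Set.Icc a b ∧ U f ∈ Set.Icc a b

lemma measurable_mem_Icc (e : Edge d) (a b : ℝ) :
    Measurable fun U : Config d => U e ∈ Set.Icc a b :=
  measurableSet_setOfPred.1 (measurable_pi_apply e measurableSet_Icc)

lemma measurable_crowded (a b : ℝ) : Measurable fun U : Config d => Crowded n a b U := by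
  have := measurable_mem_Icc (d := d)
  unfold Crowded
  fun_prop

lemma unif_Icc {a b : ℝ} (ha : 0 ≤ a) (hb : b ≤ 1) :
    unif (Set.Icc a b) = ENNReal.ofReal (b - a) := by
  rw [unif, Measure.restrict_apply measurableSet_Icc,
    Set.inter_eq_left.2 (Set.Icc_subset_Icc ha hb), Real.volume_Icc]

lemma unif_Ioc {a b : ℝ} (ha : 0 ≤ a) (hb : b ≤ 1) :
    unif (Set.Ioc a b) = ENNReal.ofReal (b - a) := by
  rw [unif, Measure.restrict_apply measurableSet_Ioc, Set.inter_eq_left.2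
    (Set.Ioc_subset_Icc_self.trans (Set.Icc_subset_Icc ha hb)), Real.volume_Ioc]

lemma IsProductUniform.crowded_le (hP : IsProductUniform P) {a b : ℝ} (ha : 0 ≤ a) (hab : a ≤ b)
    (hb : b ≤ 1) : P.real {U | Crowded n a b U} ≤ (nearEdges d n).card ^ 2 * (b - a) ^ 2 := by
  have := hP.1
  have hpair : ∀ e f : Edge d, P {U | e ≠ f ∧ U e ∈ Set.Icc a b ∧ U f ∈ Set.Icc a b} ≤
      ENNReal.ofReal ((b - a) ^ 2) := by
    intro e f
    by_cases hef : e = f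
    · simp [hef]
    · have := hP.cyl {e, f} (fun _ => Set.Icc a b) fun _ => measurableSet_Icc
      rw [Finset.prod_pair hef, unif_Icc ha hb, ← ENNReal.ofReal_mul (by linarith),
        ← pow_two] at this
      rw [← this]
      refine measure_mono fun U hU => ?_
      simpa using hU.2
  have hle : P {U | Crowded n a b U} ≤
      ENNReal.ofReal ((nearEdges d n).card ^ 2 * (b - a) ^ 2) := by
    calc P {U | Crowded n a b U}
        ≤ P (⋃ q ∈ nearEdges d n ×ˢ nearEdges d n,
            {U | q.1 ≠ q.2 ∧ U q.1 ∈ Set.Icc a b ∧ U q.2 ∈ Set.Icc a b}) := by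
          refine measure_mono ?_
          rintro U ⟨e, he, f, hf, h⟩
          exact Set.mem_iUnion₂.2 ⟨(e, f), Finset.mem_product.2 ⟨he, hf⟩, h⟩
      _ ≤ ∑ q ∈ nearEdges d n ×ˢ nearEdges d n, ENNReal.ofReal ((b - a) ^ 2) :=
          (measure_biUnion_finset_le _ _).trans (Finset.sum_le_sum fun q _ => hpair _ _)
      _ = _ := by
          rw [Finset.sum_const, Finset.card_product, ← ENNReal.ofReal_nsmul, nsmul_eq_mul]
          congr 1
          push_cast
          ring
  exact ENNReal.toReal_le_of_le_ofReal (by positivity) hle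

lemma IsProductUniform.label_piv (hP : IsProductUniform P) {a b : ℝ} (ha : 0 ≤ a) (hab : a ≤ b)
    (hb : b ≤ 1) (f : Edge d) :
    P.real {U | U f ∈ Set.Ioc a b ∧ Piv κ p n f U} = (b - a) * P.real {U | Piv κ p n f U} := by
  have hm : MeasurableSet {U : Config d | U f ∈ Set.Ioc a b} :=
    measurable_pi_apply f measurableSet_Ioc
  have := hP.indep {f} hm (measurableSet_setOfPred.2 (measurable_piv (κ := κ) (p := p) n f))
    (fun U V h => by simp [h f rfl]) (fun U V h => by
      have : rem {f} U = rem {f} V := by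
        ext e
        by_cases he : e = f
        · simp [rem, he]
        · simpa [rem, he] using h e (by simpa using he)
      rw [Set.mem_ofPred_eq, Set.mem_ofPred_eq, ← piv_rem_singleton, this, piv_rem_singleton])
  rw [hP.label f measurableSet_Ioc, unif_Ioc ha hb] at this
  rw [measureReal_def, measureReal_def, ← ENNReal.toReal_ofReal (sub_nonneg.2 hab),
    ← ENNReal.toReal_mul, ← this]
  rfl

lemma IsProductUniform.tau_eq_real (hP : IsProductUniform P) :
    tau κ P n p = P.real {U | Arm κ U p n 0} := hP.tau_eq n

lemma IsProductUniform.abs_tau_sub_le (hP : IsProductUniform P) {a b : ℝ} (ha : 0 ≤ a)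
    (hb : b ≤ 1) (hp : p ∈ Set.Icc a b) :
    |tau κ P n b - tau κ P n a - (b - a) * ∑ f ∈ ballEdges d n, P.real {U | Piv κ p n f U}| ≤
      ((ballEdges d n).card + 1) * ((nearEdges d n).card ^ 2 * (b - a) ^ 2) := by
  have := hP.1
  have hab : a ≤ b := hp.1.trans hp.2
  set B : Set (Config d) := {U | Crowded n a b U}
  have hB : MeasurableSet B := measurableSet_setOfPred.2 (measurable_crowded a b)
  have hBle : P.real B ≤ (nearEdges d n).card ^ 2 * (b - a) ^ 2 := hP.crowded_le ha hab hb
  set A : Set (Config d) := {U | Arm κ U b n 0} \ {U | Arm κ U a n 0}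
  have hA : tau κ P n b - tau κ P n a = P.real A := by
    have hsub : {U | Arm κ U a n 0} ⊆ {U : Config d | Arm κ U b n 0} := fun U hU =>
      Arm.mono hab hU
    rw [hP.tau_eq_real, hP.tau_eq_real, measureReal_sdiff hsub
      (measurableSet_setOfPred.2 (measurable_arm n 0))]
  set E : Edge d → Set (Config d) := fun f => {U | U f ∈ Set.Ioc a b ∧ Piv κ p n f U}
  have hEm : ∀ f, MeasurableSet (E f) := fun f =>
    (measurable_pi_apply f measurableSet_Ioc).inter
      (measurableSet_setOfPred.2 (measurable_piv n f))
  have huniq : ∀ {U : Config d} {f : Edge d}, U ∉ B → f ∈ ballEdges d n → U f ∈ Set.Ioc a b →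
      ∀ e ∈ nearEdges d n, e ≠ f → U e ∉ Set.Icc a b := fun hU hf hfU e he hef hc =>
    hU ⟨e, he, _, ballEdges_subset hf, hef, hc, Set.Ioc_subset_Icc_self hfU⟩
  have hAE : P.real (A \ B) = ∑ f ∈ ballEdges d n, P.real (E f \ B) := by
    rw [← measureReal_biUnion_finset]
    · refine measureReal_congr ?_
      filter_upwards [hP.ae_wf] with U hU
      refine propext ⟨fun h => ?_, fun h => ?_⟩
      · obtain ⟨⟨h1, h2⟩, h3⟩ := h
        have : ∃ f ∈ ballEdges d n, U f ∈ Set.Ioc a b := by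
          by_contra! hc
          refine h2 (Arm.of_level (fun e he heb => ?_) h1)
          by_contra! hlt
          exact hc e he ⟨hlt, heb⟩
        obtain ⟨f, hf, hfU⟩ := this
        exact Set.mem_iUnion₂.2 ⟨f, hf, ⟨hfU, (piv_iff_of_unique hU hf (by linarith) hp hfU
          (huniq h3 hf hfU)).2 ⟨h1, h2⟩⟩, h3⟩
      · obtain ⟨f, hf, ⟨hfU, h1⟩, h3⟩ := Set.mem_iUnion₂.1 h
        exact ⟨(piv_iff_of_unique hU hf (by linarith) hp hfU (huniq h3 hf hfU)).1 h1, h3⟩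
    · intro e he f hf hef
      refine Set.disjoint_left.2 ?_
      rintro U ⟨⟨h1, _⟩, h2⟩ ⟨⟨h3, _⟩, _⟩
      exact huniq h2 hf h3 e (ballEdges_subset he) hef (Set.Ioc_subset_Icc_self h1)
    · exact fun f _ => (hEm f).diff hB
  have hsplit : ∀ S : Set (Config d), P.real (S \ B) ≤ P.real S ∧
      P.real S ≤ P.real (S \ B) + P.real B := fun S => by
    refine ⟨measureReal_mono Set.sdiff_subset, ?_⟩
    rw [← measureReal_sdiff_add_inter hB (s := S)]
    exact add_le_add_right (measureReal_mono Set.inter_subset_right) _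
  have hsum : (b - a) * ∑ f ∈ ballEdges d n, P.real {U | Piv κ p n f U} =
      ∑ f ∈ ballEdges d n, P.real (E f) := by
    rw [Finset.mul_sum]
    exact Finset.sum_congr rfl fun f _ => (hP.label_piv ha hab hb f).symm
  have h1 : ∑ f ∈ ballEdges d n, P.real (E f \ B) ≤ ∑ f ∈ ballEdges d n, P.real (E f) :=
    Finset.sum_le_sum fun f _ => (hsplit _).1
  have h2 : ∑ f ∈ ballEdges d n, P.real (E f) ≤
      ∑ f ∈ ballEdges d n, P.real (E f \ B) + (ballEdges d n).card * P.real B := by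
    rw [← nsmul_eq_mul, ← Finset.sum_const, ← Finset.sum_add_distrib]
    exact Finset.sum_le_sum fun f _ => (hsplit _).2
  obtain ⟨h3, h4⟩ := hsplit A
  have h0 : 0 ≤ P.real B := measureReal_nonneg
  have hc : (0 : ℝ) ≤ (ballEdges d n).card := Nat.cast_nonneg _
  rw [hA, hsum]
  refine le_trans ?_ (mul_le_mul_of_nonneg_left hBle (by positivity))
  rw [abs_le]
  constructor <;> nlinarith [mul_nonneg hc h0]

/-- Russo's formula. -/
theorem IsProductUniform.hasDerivWithinAt_tau (hP : IsProductUniform P)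
    (hp : p ∈ Set.Icc (0 : ℝ) 1) :
    HasDerivWithinAt (fun q => tau κ P n q)
      (∑ f ∈ ballEdges d n, P.real {U | Piv κ p n f U}) (Set.Icc 0 1) p := by
  rw [hasDerivWithinAt_iff_isLittleO]
  set D := ∑ f ∈ ballEdges d n, P.real {U | Piv κ p n f U}
  set K : ℝ := ((ballEdges d n).card + 1) * (nearEdges d n).card ^ 2
  have hO : (fun q => tau κ P n q - tau κ P n p - (q - p) • D) =O[nhdsWithin p (Set.Icc 0 1)]
      fun q => (q - p) ^ 2 := by
    refine Asymptotics.IsBigO.of_bound K ?_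
    filter_upwards [self_mem_nhdsWithin] with q hq
    rw [Real.norm_eq_abs, Real.norm_eq_abs, abs_of_nonneg (sq_nonneg (q - p)), smul_eq_mul]
    rcases le_total p q with h | h
    · refine (hP.abs_tau_sub_le hp.1 hq.2 (Set.left_mem_Icc.2 h)).trans_eq ?_
      ring
    · have := hP.abs_tau_sub_le (κ := κ) (n := n) hq.1 hp.2 (Set.right_mem_Icc.2 h)
      rw [← abs_neg] at this
      refine (le_of_eq ?_).trans (this.trans_eq ?_)
      · congr 1
        ring
      · ring
  refine hO.trans_isLittleO (Asymptotics.IsLittleO.mono ?_ nhdsWithin_le_nhds)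
  simpa using (Asymptotics.isLittleO_pow_sub_sub p one_lt_two).norm_left

end

section
open scoped Classical ENNReal
variable {d : ℕ} {κ : ℕ} {p : ℝ} {P : Measure (Config d)} {n : ℕ} {U : Config d} {δ : ℝ≥0∞}

lemma Tol.le_one_sub_pow_not_arm (hP : IsProductUniform P) (hδ : Tol p δ) (hn : 1 ≤ n) :
    δ ^ (2 * d) ≤ P {U | ¬ Arm κ U p n 0} := by
  have hδ1 : δ ≤ 1 := hδ.le_left.trans (by simpa using hδ.le_one)
  calc δ ^ (2 * d) ≤ δ ^ (star (0 : Vertex d)).card :=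
        pow_le_pow_right_of_le_one' hδ1 (card_star_le 0)
    _ ≤ ∏ _e ∈ star (0 : Vertex d), unif (Set.Ioi p) := by
        rw [Finset.prod_const, unif_Ioi hδ.nonneg]
        gcongr
        exact hδ.le_right
    _ = P {U | ∀ e ∈ star (0 : Vertex d), U e ∈ Set.Ioi p} :=
        (hP.cyl _ _ fun _ => measurableSet_Ioi).symm
    _ ≤ _ := by
        refine measure_mono ?_
        rintro U hU ⟨k, l, x, hx⟩
        have hk : k ≠ 0 := by
          rintro rfl
          have := hx.start
          rw [hx.fin] at this
          simp [norm1] at this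
          omega
        obtain ⟨k, rfl⟩ := Nat.exists_eq_succ_of_ne_zero hk
        refine not_lt.2 (hx.le_p k.lt_succ_self) (hU _ (mem_star.2 ⟨hx.nn k.lt_succ_self, ?_⟩))
        rw [← hx.fin]
        exact Sym2.mem_mk_right _ _

lemma IsProductUniform.card_mul_arm_le (hP : IsProductUniform P) (hd : 1 ≤ d) (hκ : 2 ≤ κ)
    (hδ : Tol p δ) (hn : 1 ≤ n) :
    δ ^ (2 * d) * (n * P {U | Arm κ U p n 0}) ≤ 8 * flipConst d δ * expSum (base d δ) *
      (∑ j ∈ Finset.range n, P {U | Arm κ U p j 0}) *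
        ∑ f ∈ ballEdges d n, P {U | Piv κ p n f U} := by
  have hpiv : ∑' g : Edge d, P {U | Piv κ p n g U} =
      ∑ f ∈ ballEdges d n, P {U | Piv κ p n f U} := by
    refine tsum_eq_sum fun f hf => ?_
    refine measure_mono_null_ae ?_ (measure_empty (μ := P))
    filter_upwards [hP.ae_wf] with U hU h
    exact hf (piv_mem_ballEdges hδ.lt_two hU h)
  calc δ ^ (2 * d) * (n * P {U | Arm κ U p n 0})
      ≤ P {U | ¬ Arm κ U p n 0} * (n * (expSum (base d δ) * P {U | Thet κ U p n})) := by
        gcongr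
        · exact hδ.le_one_sub_pow_not_arm hP hn
        · exact hP.arm_le_thet hd hκ hδ hn
    _ = expSum (base d δ) * (n * (P {U | Thet κ U p n} * P {U | ¬ Arm κ U p n 0})) := by ring
    _ ≤ expSum (base d δ) * (8 * (∑ j ∈ Finset.range n, P {U | Arm κ U p j 0}) *
          (flipConst d δ * ∑ f ∈ ballEdges d n, P {U | Piv κ p n f U})) := by
        refine mul_le_mul_right ((hP.card_mul_thet_le hn).trans (mul_le_mul_right ?_ _)) _
        rw [← hpiv]
        exact hP.flip_sum_le hd hκ hδ hn
    _ = _ := by ring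

lemma IsProductUniform.tau_zero (hP : IsProductUniform P) : tau κ P 0 p = 1 := by
  have := hP.1
  have huniv : {U : Config d | Arm κ U p 0 0} = Set.univ := by
    refine Set.eq_univ_of_forall fun U => ⟨0, 0, fun _ => 0, ?_⟩
    constructor <;> simp [IsPathOn, norm1]
    omega
  rw [hP.tau_eq_real, huniv, probReal_univ]

lemma IsProductUniform.diff_ineq (hP : IsProductUniform P) (hd : 1 ≤ d) (hκ : 2 ≤ κ)
    (hδ : Tol p δ) (hn : 1 ≤ n) {C : ℝ} (hC : 0 < C)
    (hle : 8 * (flipConst d δ).toReal * (expSum (base d δ)).toReal ≤ C * δ.toReal ^ (2 * d)) :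
    n / (C * ∑ k ∈ Finset.range n, tau κ P k p) * tau κ P n p ≤
      ∑ f ∈ ballEdges d n, P.real {U | Piv κ p n f U} := by
  have := hP.1
  have hδt : δ ≠ ∞ := ne_top_of_le_ne_top ENNReal.ofReal_ne_top hδ.le_left
  have hδ0 : 0 < δ.toReal ^ (2 * d) := pow_pos (ENNReal.toReal_pos hδ.pos hδt) _
  have hf := flipConst_ne_top (d := d) hδ.pos
  have he := expSum_ne_top (base_ne_top (d := d) hδ.pos)
  have key := ENNReal.toReal_mono ?_ (hP.card_mul_arm_le (κ := κ) hd hκ hδ hn)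
  · simp only [ENNReal.toReal_mul, ENNReal.toReal_pow, ENNReal.toReal_natCast,
      ENNReal.toReal_ofNat, ENNReal.toReal_sum fun _ _ => measure_ne_top P _, ← hP.tau_eq] at key
    have hS : 0 < ∑ k ∈ Finset.range n, tau κ P k p := by
      refine Finset.sum_pos' (fun _ _ => ENNReal.toReal_nonneg) ⟨0, Finset.mem_range.2 hn, ?_⟩
      rw [hP.tau_zero]
      exact one_pos
    have hD : 0 ≤ ∑ f ∈ ballEdges d n, P.real {U | Piv κ p n f U} :=
      Finset.sum_nonneg fun _ _ => measureReal_nonneg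
    rw [div_mul_eq_mul_div, div_le_iff₀ (by positivity)]
    refine le_of_mul_le_mul_left (key.trans ?_) hδ0
    calc _ ≤ C * δ.toReal ^ (2 * d) * (∑ k ∈ Finset.range n, tau κ P k p) *
          ∑ f ∈ ballEdges d n, P.real {U | Piv κ p n f U} := by
          gcongr
          exact le_rfl
      _ = _ := by ring
  · have h1 : ∑ j ∈ Finset.range n, P {U | Arm κ U p j 0} ≠ ∞ :=
      ENNReal.sum_ne_top.2 fun _ _ => measure_ne_top P _
    have h2 : ∑ f ∈ ballEdges d n, P {U | Piv κ p n f U} ≠ ∞ :=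
      ENNReal.sum_ne_top.2 fun _ _ => measure_ne_top P _
    finiteness

end

/-- For all `0 < p₋ < p₊ < 1` there is `C = C(p₋, p₊, d) > 0` such that for every `n ≥ 1`
and `p ∈ [p₋, p₊]`, `τ_n` is differentiable at `p` with
`τ_n'(p) ≥ (n / (C Σ_n(p))) τ_n(p)`, where `Σ_n(p) = Σ_{k<n} τ_k(p)`. -/
theorem tau_differential_inequality (d κ : ℕ) (hd : 2 ≤ d) (hκ₁ : 2 ≤ κ) (hκ₂ : κ ≤ 2 * d)
    (P : Measure (Config d)) (hP : IsProductUniform P)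
    (pm pp : ℝ) (h0 : 0 < pm) (h1 : pm < pp) (h2 : pp < 1) :
    ∃ C : ℝ, 0 < C ∧ ∀ n : ℕ, 1 ≤ n → ∀ p ∈ Set.Icc pm pp,
      ∃ D : ℝ, HasDerivWithinAt (fun q => tau κ P n q) D (Set.Icc 0 1) p ∧
        ((n : ℝ) / (C * ∑ k ∈ Finset.range n, tau κ P k p)) * tau κ P n p ≤ D := by
  have hr : 0 < min pm (1 - pp) := lt_min h0 (by linarith)
  set δ := ENNReal.ofReal (min pm (1 - pp)) with hδ_def
  have hδ0 : δ ≠ 0 := by simpa [hδ_def] using hr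
  have hδr : 0 < δ.toReal ^ (2 * d) := pow_pos (ENNReal.toReal_pos hδ0 ENNReal.ofReal_ne_top) _
  have hpos : 0 ≤ 8 * (flipConst d δ).toReal * (expSum (base d δ)).toReal := by positivity
  refine ⟨8 * (flipConst d δ).toReal * (expSum (base d δ)).toReal / δ.toReal ^ (2 * d) + 1,
    by positivity, fun n hn p hp => ?_⟩
  have hp01 : p ∈ Set.Icc (0 : ℝ) 1 := ⟨h0.le.trans hp.1, hp.2.trans h2.le⟩
  have hδ : Tol p δ := ⟨hp01.1, hp01.2, hδ0,
    ENNReal.ofReal_le_ofReal ((min_le_left _ _).trans hp.1),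
    ENNReal.ofReal_le_ofReal ((min_le_right _ _).trans (by linarith [hp.2]))⟩
  refine ⟨_, hP.hasDerivWithinAt_tau hp01, hP.diff_ineq (by omega) hκ₁ hδ hn (by positivity) ?_⟩
  rw [add_mul, div_mul_cancel₀ _ hδr.ne']
  linarith

end CDP
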